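/- For every integer d ≥ 2 with d + 2 even, a double cover X → ℙ⁴ branched along a very general complex hypersurface Y ⊂ ℙ⁴ of degree d + 2 having multiplicity d along a fixed line is not stably rational. -/

import Mathlib

/-!
Rationality, stable rationality and stable birationality, expressed via function fields:
a variety `X` over `k` with function field `F` (a `k`-algebra via `c : k →+* F`) is rational
iff `F ≅ k(t₁,…,t_n)` over `k`, and stably rational iff `F(t₁,…,t_m) ≅ k(t₁,…,t_n)` over `k`
for some `m, n`. Two varieties are stably birational iff their function fields become
isomorphic after adjoining finitely many indeterminates.
-/

noncomputable section

/-- The rational function field `k(t₁, …, t_n)`. -/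
def ratFuncField (k : Type) [Field k] (n : ℕ) : Type :=
  FractionRing (MvPolynomial (Fin n) k)

instance (k : Type) [Field k] (n : ℕ) : Field (ratFuncField k n) := by
  unfold ratFuncField; infer_instance

/-- The canonical map `k → k(t₁, …, t_n)`. -/
def ratFuncFieldMap (k : Type) [Field k] (n : ℕ) : k →+* ratFuncField k n :=
  (algebraMap (MvPolynomial (Fin n) k) (FractionRing (MvPolynomial (Fin n) k))).comp
    (MvPolynomial.C)

/-- Given a function field `F` over `k` (via `c : k →+* F`), the canonical map
`k → Frac(F[t₁,…,t_m]) = F(t₁,…,t_m)`. -/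
def adjoinIndetsMap {k F : Type} [CommRing k] [CommRing F] (c : k →+* F) (m : ℕ) :
    k →+* FractionRing (MvPolynomial (Fin m) F) :=
  (algebraMap (MvPolynomial (Fin m) F) (FractionRing (MvPolynomial (Fin m) F))).comp
    ((MvPolynomial.C).comp c)

/-- A variety over `k` with function field `F` (via `c : k →+* F`) is rational iff
`F ≅ k(t₁,…,t_n)` as `k`-algebras for some `n`. -/
def IsRationalFunctionField {k F : Type} [Field k] [CommRing F] (c : k →+* F) : Prop :=
  ∃ (n : ℕ) (e : F ≃+* ratFuncField k n), (e : F →+* ratFuncField k n).comp c =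
    ratFuncFieldMap k n

/-- A variety over `k` with function field `F` (via `c : k →+* F`) is stably rational iff
`F(t₁,…,t_m) ≅ k(t₁,…,t_n)` as `k`-algebras for some `m, n`. -/
def IsStablyRationalFunctionField {k F : Type} [Field k] [CommRing F] (c : k →+* F) : Prop :=
  ∃ (m n : ℕ) (e : FractionRing (MvPolynomial (Fin m) F) ≃+* ratFuncField k n),
    (e : FractionRing (MvPolynomial (Fin m) F) →+* ratFuncField k n).comp
      (adjoinIndetsMap c m) = ratFuncFieldMap k n

/-- Two varieties over `K` with function fields `L₁, L₂` (via `i₁ : K →+* L₁`,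
`i₂ : K →+* L₂`) are stably birational over `K` iff `L₁(t₁,…,t_a) ≅ L₂(t₁,…,t_b)`
as `K`-algebras for some `a, b`. -/
def StablyBirationalOver {K L₁ L₂ : Type} [Field K] [CommRing L₁] [CommRing L₂]
    (i₁ : K →+* L₁) (i₂ : K →+* L₂) : Prop :=
  ∃ (a b : ℕ) (e : FractionRing (MvPolynomial (Fin a) L₁) ≃+*
      FractionRing (MvPolynomial (Fin b) L₂)),
    (e : FractionRing (MvPolynomial (Fin a) L₁) →+*
      FractionRing (MvPolynomial (Fin b) L₂)).comp (adjoinIndetsMap i₁ a) =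
      adjoinIndetsMap i₂ b

end

/-!
Very general members of linear families, and quadric surface bundles over `ℙ²` given by
symmetric matrices of homogeneous forms, described via affine charts and function fields.
-/

noncomputable section

/-- A polynomial function on a `ℂ`-vector space `P`: a function factoring through finitely
many linear coordinates via a polynomial. -/
def IsPolynomialFun {P : Type} [AddCommGroup P] [Module ℂ P] (f : P → ℂ) : Prop :=
  ∃ (N : ℕ) (l : Fin N → (P →ₗ[ℂ] ℂ)) (F : MvPolynomial (Fin N) ℂ),
    ∀ p : P, f p = MvPolynomial.eval (fun i => l i p) F

/-- A property `Q` holds for a very general member of the linear parameter space `P` if it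
holds away from a countable union of proper algebraic hypersurfaces, i.e. if there are
countably many nonzero polynomial functions on `P` such that `Q p` holds whenever none of
them vanishes at `p`. -/
def VeryGeneral {P : Type} [AddCommGroup P] [Module ℂ P] (Q : P → Prop) : Prop :=
  ∃ 𝒞 : Set (P → ℂ), 𝒞.Countable ∧ (∀ f ∈ 𝒞, IsPolynomialFun f ∧ f ≠ 0) ∧
    ∀ p : P, (∀ f ∈ 𝒞, f p ≠ 0) → Q p

/-- Dehomogenization `ℂ[x,y,z] → ℂ[x,y] ⊆ ℂ[x,y,z₁,z₂,z₃]` at the chart `z = 1` of `ℙ²`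
(the first two variables of `Fin 5` are the base coordinates). -/
def dehomP2 : MvPolynomial (Fin 3) ℂ →+* MvPolynomial (Fin 5) ℂ :=
  (MvPolynomial.aeval ![MvPolynomial.X 0, MvPolynomial.X 1, 1]).toRingHom

/-- Dehomogenization `ℂ[x,y,z] → ℂ[x,y]` at the chart `z = 1`. -/
def dehomP2' : MvPolynomial (Fin 3) ℂ →+* MvPolynomial (Fin 2) ℂ :=
  (MvPolynomial.aeval ![MvPolynomial.X 0, MvPolynomial.X 1, 1]).toRingHom

/-- The defining polynomial `∑_{i,j} a_{ij}(x,y,1) z_i z_j` (with `z₀ = 1`) of the affine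
chart of the quadric surface bundle `X = {∑ a_{ij} z_i z_j = 0} ⊆ ℙ(E)` over `ℙ²`. -/
def quadricBundleChartPoly (A : Fin 4 → Fin 4 → MvPolynomial (Fin 3) ℂ) :
    MvPolynomial (Fin 5) ℂ :=
  ∑ i : Fin 4, ∑ j : Fin 4, dehomP2 (A i j) *
    (![1, MvPolynomial.X 2, MvPolynomial.X 3, MvPolynomial.X 4] i) *
    (![1, MvPolynomial.X 2, MvPolynomial.X 3, MvPolynomial.X 4] j)

/-- The coordinate ring of the affine chart (`z = 1` on `ℙ²` and `z₀ = 1` on the fibre)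
of the quadric surface bundle `X ⊆ ℙ(E)` over `ℙ²` determined by the symmetric matrix
`(a_{ij})`. -/
def quadricBundleChartRing (A : Fin 4 → Fin 4 → MvPolynomial (Fin 3) ℂ) : Type :=
  MvPolynomial (Fin 5) ℂ ⧸ Ideal.span {quadricBundleChartPoly A}

instance (A : Fin 4 → Fin 4 → MvPolynomial (Fin 3) ℂ) :
    CommRing (quadricBundleChartRing A) :=
  Ideal.Quotient.commRing _

/-- The function field `ℂ(X)` of the quadric surface bundle `X` over `ℙ²` given by the
matrix `(a_{ij})`, as the fraction ring of the affine chart. -/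
def quadricBundleFunctionField (A : Fin 4 → Fin 4 → MvPolynomial (Fin 3) ℂ) : Type :=
  FractionRing (quadricBundleChartRing A)

instance (A : Fin 4 → Fin 4 → MvPolynomial (Fin 3) ℂ) :
    CommRing (quadricBundleFunctionField A) := by
  unfold quadricBundleFunctionField; infer_instance

/-- The canonical map `ℂ → ℂ(X)`. -/
def quadricBundleFFMap (A : Fin 4 → Fin 4 → MvPolynomial (Fin 3) ℂ) :
    ℂ →+* quadricBundleFunctionField A :=
  (algebraMap (quadricBundleChartRing A) (FractionRing (quadricBundleChartRing A))).comp
    ((Ideal.Quotient.mk _).comp (MvPolynomial.C))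

/-- The conditions for the symmetric matrix `(a_{ij})` of forms to define a quadric surface
bundle over `ℙ²`: the quadratic form is generically nondegenerate, and nonzero on every
fibre (so that `X → ℙ²` is flat). Homogeneity of the `a_{ij}` of the correct degrees is
part of the choice of parameter space. -/
def IsQuadricBundleP2 (A : Fin 4 → Fin 4 → MvPolynomial (Fin 3) ℂ) : Prop :=
  Matrix.det (Matrix.of fun i j => A i j + A j i) ≠ 0 ∧
  ∀ v : Fin 3 → ℂ, v ≠ 0 → ∃ i j, MvPolynomial.eval v (A i j + A j i) ≠ 0

/-- The quadric surface bundle over `ℙ²` given by `(a_{ij})` admits a rational section: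
there are rational functions `σ₀, …, σ₃` on `ℙ²`, not all zero, with
`∑ a_{ij} σ_i σ_j = 0`. -/
def HasRationalSectionP2 (A : Fin 4 → Fin 4 → MvPolynomial (Fin 3) ℂ) : Prop :=
  ∃ σ : Fin 4 → FractionRing (MvPolynomial (Fin 2) ℂ), σ ≠ 0 ∧
    ∑ i : Fin 4, ∑ j : Fin 4,
      (algebraMap (MvPolynomial (Fin 2) ℂ) (FractionRing (MvPolynomial (Fin 2) ℂ)))
        (dehomP2' (A i j)) * σ i * σ j = 0

end

/-!
STATEMENT 12: For every integer `d ≥ 2` with `d + 2` even, the double cover `X → ℙ⁴`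
branched along a very general complex hypersurface `Y ⊆ ℙ⁴` of degree `d + 2` having
multiplicity `d` along the fixed line `{x₂ = x₃ = x₄ = 0}` is not stably rational.
The function field of `X` is the fraction field of `ℂ[y₁,…,y₄][w]/(w² - F(1,y₁,…,y₄))`.
-/

noncomputable section

/-- Dehomogenization at the chart `x₀ = 1` of `ℙ⁴`, landing in the first four variables of
`ℂ[y₁,…,y₄,w]`. -/
def dehomP4 : MvPolynomial (Fin 5) ℂ →+* MvPolynomial (Fin 5) ℂ :=
  (MvPolynomial.aeval ![1, MvPolynomial.X 0, MvPolynomial.X 1, MvPolynomial.X 2,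
    MvPolynomial.X 3]).toRingHom

/-- The coordinate ring of the affine chart `w² = F(1,y₁,…,y₄)` of the double cover of
`ℙ⁴` branched along `{F = 0}` (here `w` is the last variable). -/
def doubleCoverChartRing (F : MvPolynomial (Fin 5) ℂ) : Type :=
  MvPolynomial (Fin 5) ℂ ⧸ Ideal.span {MvPolynomial.X 4 ^ 2 - dehomP4 F}

instance (F : MvPolynomial (Fin 5) ℂ) : CommRing (doubleCoverChartRing F) :=
  Ideal.Quotient.commRing _

/-- The canonical map `ℂ → ℂ(X)` for the double cover `X → ℙ⁴` branched along `{F = 0}`. -/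
def doubleCoverFFMap (F : MvPolynomial (Fin 5) ℂ) :
    ℂ →+* FractionRing (doubleCoverChartRing F) :=
  (algebraMap (doubleCoverChartRing F) (FractionRing (doubleCoverChartRing F))).comp
    ((Ideal.Quotient.mk _).comp (MvPolynomial.C))

/-- The reduced norm form of the quaternion algebra `(a, b)`. -/
def normForm {R : Type*} [CommRing R] (a b z x y w : R) : R :=
  z ^ 2 - a * x ^ 2 - b * y ^ 2 + a * b * w ^ 2

/-- Over the fraction field of the domain `R`, the norm form of `(a, b)` represents `n`
nontrivially. -/
def NormRep {R : Type*} [CommRing R] (a b n : R) : Prop :=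
  ∃ z x y w c : R, c ≠ 0 ∧ ¬(z = 0 ∧ x = 0 ∧ y = 0 ∧ w = 0) ∧ normForm a b z x y w = n * c ^ 2

/-- The pairs `(a, b)` and `(a', b')` have norm forms with the same represented values over every
domain extension. -/
def Sim {S : Type} [CommRing S] (a b a' b' : S) : Prop :=
  ∀ (R : Type) [CommRing R] [IsDomain R] [CharZero R] (φ : S →+* R), Function.Injective φ →
    ∀ n : R, NormRep (φ a) (φ b) n ↔ NormRep (φ a') (φ b') n

section NormRep

variable {R S : Type*} [CommRing R] [CommRing S]

theorem map_normForm (φ : R →+* S) (a b z x y w : R) :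
    φ (normForm a b z x y w) = normForm (φ a) (φ b) (φ z) (φ x) (φ y) (φ w) := by
  simp [normForm]

theorem NormRep.map {φ : R →+* S} (hφ : Function.Injective φ) {a b n : R} (h : NormRep a b n) :
    NormRep (φ a) (φ b) (φ n) := by
  obtain ⟨z, x, y, w, c, hc, hv, e⟩ := h
  refine ⟨φ z, φ x, φ y, φ w, φ c, (map_ne_zero_iff φ hφ).2 hc, ?_, ?_⟩
  · simpa only [map_eq_zero_iff φ hφ] using hv
  · rw [← map_normForm, e]; simp

theorem NormRep.symm {a b n : R} (h : NormRep a b n) : NormRep b a n := by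
  obtain ⟨z, x, y, w, c, hc, hv, e⟩ := h
  refine ⟨z, y, x, w, c, hc, by tauto, ?_⟩
  rw [← e]; simp only [normForm]; ring

theorem rep_comm {a b n : R} : NormRep a b n ↔ NormRep b a n := ⟨NormRep.symm, NormRep.symm⟩

variable [IsDomain R]

theorem rep_mul_sq_left {a b n p : R} (hp : p ≠ 0) : NormRep (a * p ^ 2) b n ↔ NormRep a b n := by
  constructor
  · rintro ⟨z, x, y, w, c, hc, hv, e⟩
    refine ⟨z, p * x, y, p * w, c, hc, ?_, ?_⟩
    · simpa [hp] using hv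
    · rw [← e]; simp only [normForm]; ring
  · rintro ⟨z, x, y, w, c, hc, hv, e⟩
    refine ⟨p * z, x, p * y, w, p * c, mul_ne_zero hp hc, ?_, ?_⟩
    · simpa [hp] using hv
    · rw [mul_pow, mul_left_comm, ← e]; simp only [normForm]; ring

theorem rep_mul_sq_right {a b n p : R} (hp : p ≠ 0) : NormRep a (b * p ^ 2) n ↔ NormRep a b n := by
  rw [rep_comm, rep_mul_sq_left hp, rep_comm]

theorem rep_sq [CharZero R] {e : R} (he : e ≠ 0) (b n : R) : NormRep (e ^ 2) b n := by
  refine ⟨e * (n + 1), n - 1, 0, 0, 2 * e, mul_ne_zero two_ne_zero he, ?_, ?_⟩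
  · rintro ⟨h1, h2, -, -⟩
    have h1 : n + 1 = 0 := (mul_eq_zero.1 h1).resolve_left he
    have : (2 : R) = 0 := by linear_combination h1 - h2
    exact two_ne_zero this
  · simp only [normForm]; ring

theorem NormRep.descent {a b b' c n : R} (hb : b ≠ 0) (hb' : b' ≠ 0)
    (h : c ^ 2 - a = b * b') (hr : NormRep a b' n) : NormRep a b n := by
  obtain ⟨z, x, y, w, e, he, hv, q⟩ := hr
  refine ⟨b * z, b * x, c * y + a * w, c * w + y, b * e, mul_ne_zero hb he, ?_, ?_⟩
  · rintro ⟨h1, h2, h3, h4⟩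
    have hbb : b * b' ≠ 0 := mul_ne_zero hb hb'
    refine hv ⟨by simpa [hb] using h1, by simpa [hb] using h2, ?_, ?_⟩
    · apply (mul_eq_zero.1 (_ : b * b' * y = 0)).resolve_left hbb
      rw [← h]; linear_combination c * h3 - a * h4
    · apply (mul_eq_zero.1 (_ : b * b' * w = 0)).resolve_left hbb
      rw [← h]; linear_combination c * h4 - h3
  · rw [mul_pow, mul_left_comm, ← q]; simp only [normForm]
    linear_combination (-b * y ^ 2 + a * b * w ^ 2) * h

theorem rep_descent {a b b' c n : R} (hb : b ≠ 0) (hb' : b' ≠ 0)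
    (h : c ^ 2 - a = b * b') : NormRep a b n ↔ NormRep a b' n :=
  ⟨fun h' => h'.descent hb' hb (h.trans (mul_comm _ _)), NormRep.descent hb hb' h⟩

/-- Clearing denominators. -/
theorem rep_zero_of_fraction {W : Type*} [CommRing W] [Algebra R W] [IsFractionRing R W] {a b : R}
    (h : NormRep (algebraMap R W a) (algebraMap R W b) 0) : NormRep a b 0 := by
  obtain ⟨z, x, y, w, c, hc, hv, e⟩ := h
  have hinj := IsFractionRing.injective R W
  classical
  obtain ⟨D, hD⟩ := IsLocalization.exist_integer_multiples_of_finset (nonZeroDivisors R)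
    (Finset.univ.image ![z, x, y, w])
  obtain ⟨z', hz⟩ := hD z (Finset.mem_image.2 ⟨0, by simp⟩)
  obtain ⟨x', hx⟩ := hD x (Finset.mem_image.2 ⟨1, by simp⟩)
  obtain ⟨y', hy⟩ := hD y (Finset.mem_image.2 ⟨2, by simp⟩)
  obtain ⟨w', hw⟩ := hD w (Finset.mem_image.2 ⟨3, by simp⟩)
  have hDr : ∀ t : W, ((D : R) • t = 0) → t = 0 := by
    intro t ht
    rw [Algebra.smul_def] at ht
    exact ((IsLocalization.map_units W D).mul_right_eq_zero).1 ht
  refine ⟨z', x', y', w', 1, one_ne_zero, ?_, ?_⟩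
  · rintro ⟨rfl, rfl, rfl, rfl⟩
    rw [map_zero] at hz hx hy hw
    exact hv ⟨hDr _ hz.symm, hDr _ hx.symm, hDr _ hy.symm, hDr _ hw.symm⟩
  · apply hinj
    rw [map_normForm, hz, hx, hy, hw]
    simp only [normForm, Algebra.smul_def] at e ⊢
    rw [zero_mul] at e
    simp only [zero_mul, map_zero]
    linear_combination (algebraMap R W D) ^ 2 * e

end NormRep

section Sim

variable {S : Type} [CommRing S]

theorem Sim.refl (a b : S) : Sim a b a b := fun _ _ _ _ _ _ _ => Iff.rfl

theorem Sim.trans {a b a' b' a'' b'' : S} (h : Sim a b a' b') (h' : Sim a' b' a'' b'') :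
    Sim a b a'' b'' := fun R _ _ _ φ hφ n => (h R φ hφ n).trans (h' R φ hφ n)

theorem Sim.swap {a b a' b' : S} (h : Sim a b a' b') : Sim b a b' a' :=
  fun R _ _ _ φ hφ n => by rw [rep_comm, h R φ hφ n, rep_comm]

theorem sim_mul_sq_left {a b p : S} (hp : p ≠ 0) : Sim (a * p ^ 2) b a b :=
  fun R _ _ _ φ hφ n => by
    rw [map_mul, map_pow, rep_mul_sq_left ((map_ne_zero_iff φ hφ).2 hp)]

theorem sim_descent {a b b' c : S} (hb : b ≠ 0) (hb' : b' ≠ 0) (h : c ^ 2 - a = b * b') :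
    Sim a b a b' := fun R _ _ _ φ hφ n =>
  rep_descent (c := φ c) ((map_ne_zero_iff φ hφ).2 hb) ((map_ne_zero_iff φ hφ).2 hb')
    (by rw [← map_pow, ← map_sub, h, map_mul])

theorem sim_sq {e b : S} (he : e ≠ 0) : Sim (e ^ 2) b 1 1 := fun R _ _ _ φ hφ n => by
  rw [map_pow, map_one]
  have h1 := rep_sq (one_ne_zero (α := R)) 1 n
  rw [one_pow] at h1
  exact iff_of_true (rep_sq ((map_ne_zero_iff φ hφ).2 he) _ n) h1

end Sim

section Primitive

variable {R : Type*} [CommRing R] {ι : Type*}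

theorem exists_primitive_scaling {t : R} (ht : ∀ r : R, r ≠ 0 → FiniteMultiplicity t r)
    {v : ι → R} (hv : v ≠ 0) :
    ∃ (j : ℕ) (v' : ι → R), (∀ i, v i = t ^ j * v' i) ∧ ∃ i, ¬ t ∣ v' i := by
  classical
  obtain ⟨i, hi⟩ := Function.ne_iff.1 hv
  have hex : ∃ j, ¬ ∀ i, t ^ (j + 1) ∣ v i := by
    obtain ⟨n, hn⟩ := ht _ hi
    exact ⟨n, fun h => hn (h i)⟩
  have h1 : ∀ i, t ^ Nat.find hex ∣ v i := by
    rcases hj : Nat.find hex with _ | j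
    · simp
    · exact not_not.1 (Nat.find_min hex (m := j) (by omega))
  choose v' hv' using h1
  refine ⟨_, v', hv', ?_⟩
  by_contra! h
  refine Nat.find_spec hex fun i => ?_
  rw [hv' i, pow_succ]
  exact mul_dvd_mul_left _ (h i)

theorem eq_zero_of_sq_sub_mul_sq [IsDomain R] {t r g : R} (htp : Prime t)
    (ht : ∀ r : R, r ≠ 0 → FiniteMultiplicity t r)
    (han : ∀ x y, t ∣ x ^ 2 - r * y ^ 2 → t ∣ x ∧ t ∣ y) (hg : ¬ t ∣ g) {x y z w : R}
    (h : x ^ 2 - r * y ^ 2 = t * g * (z ^ 2 - r * w ^ 2)) :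
    x = 0 ∧ y = 0 ∧ z = 0 ∧ w = 0 := by
  by_contra hne
  have hv : ![x, y, z, w] ≠ 0 := by
    intro h0
    exact hne ⟨congrFun h0 0, congrFun h0 1, congrFun h0 2, congrFun h0 3⟩
  obtain ⟨j, v', hv', i, hi⟩ := exists_primitive_scaling ht hv
  have hx : x = t ^ j * v' 0 := hv' 0
  have hy : y = t ^ j * v' 1 := hv' 1
  have hz : z = t ^ j * v' 2 := hv' 2
  have hw : w = t ^ j * v' 3 := hv' 3
  have h' : v' 0 ^ 2 - r * v' 1 ^ 2 = t * g * (v' 2 ^ 2 - r * v' 3 ^ 2) := by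
    apply mul_left_cancel₀ (pow_ne_zero 2 (pow_ne_zero j htp.ne_zero))
    rw [hx, hy, hz, hw] at h
    linear_combination h
  obtain ⟨⟨x1, hx1⟩, ⟨y1, hy1⟩⟩ := han _ _ (h' ▸ (dvd_mul_right t g).mul_right _)
  have h2 : t * (x1 ^ 2 - r * y1 ^ 2) = g * (v' 2 ^ 2 - r * v' 3 ^ 2) := by
    apply mul_left_cancel₀ htp.ne_zero
    rw [hx1, hy1] at h'
    linear_combination h'
  obtain ⟨hz1, hw1⟩ := han _ _ ((htp.dvd_or_dvd (h2 ▸ dvd_mul_right t _)).resolve_left hg)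
  fin_cases i
  exacts [hi ⟨_, hx1⟩, hi ⟨_, hy1⟩, hi hz1, hi hw1]

end Primitive

/-- The quadratic form cutting out the conic tangent to the coordinate lines. -/
def tangentConic {R : Type*} [CommRing R] (x y z : R) : R :=
  x ^ 2 + y ^ 2 + z ^ 2 - 2 * x * y - 2 * y * z - 2 * z * x

theorem map_tangentConic {R S : Type*} [CommRing R] [CommRing S] (φ : R →+* S) (x y z : R) :
    φ (tangentConic x y z) = tangentConic (φ x) (φ y) (φ z) := by
  simp [tangentConic, map_ofNat]

section PowerSeriesLemmas

open PowerSeries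

variable {κ : Type} [Field κ]

theorem finiteMultiplicity_X {r : κ⟦X⟧} (hr : r ≠ 0) : FiniteMultiplicity X r :=
  FiniteMultiplicity.of_not_isUnit X_prime.not_isUnit hr

theorem exists_primitive_vec {z x y w : κ⟦X⟧} (hv : ¬(z = 0 ∧ x = 0 ∧ y = 0 ∧ w = 0)) :
    ∃ (j : ℕ) (z' x' y' w' : κ⟦X⟧), z = X ^ j * z' ∧ x = X ^ j * x' ∧ y = X ^ j * y' ∧
      w = X ^ j * w' ∧ ¬(constantCoeff z' = 0 ∧ constantCoeff x' = 0 ∧ constantCoeff y' = 0 ∧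
        constantCoeff w' = 0) := by
  have hv : ![z, x, y, w] ≠ 0 := by
    intro h0
    exact hv ⟨congrFun h0 0, congrFun h0 1, congrFun h0 2, congrFun h0 3⟩
  obtain ⟨j, v', hv', i, hi⟩ := exists_primitive_scaling (fun r hr => finiteMultiplicity_X hr) hv
  refine ⟨j, v' 0, v' 1, v' 2, v' 3, hv' 0, hv' 1, hv' 2, hv' 3, ?_⟩
  simp only [← X_dvd_iff]
  rintro ⟨h0, h1, h2, h3⟩
  fin_cases i
  exacts [hi h0, hi h1, hi h2, hi h3]

theorem isSquare_of_rep_zero {a b : κ⟦X⟧} (hb : constantCoeff b ≠ 0)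
    (h : NormRep a (X * b) 0) : ∃ e, constantCoeff a = e ^ 2 := by
  by_contra! hns
  obtain ⟨z, x, y, w, c, hc, hv, e⟩ := h
  have key : ∀ p q : κ⟦X⟧, X ∣ p ^ 2 - a * q ^ 2 → X ∣ p ∧ X ∣ q := by
    intro p q hpq
    simp only [X_dvd_iff, map_sub, map_pow, map_mul] at hpq ⊢
    have hq : constantCoeff q = 0 := by
      by_contra hq
      apply hns (constantCoeff p / constantCoeff q)
      field_simp
      linear_combination -hpq
    rw [hq] at hpq ⊢
    simpa using hpq
  refine hv ?_
  obtain ⟨h1, h2, h3, h4⟩ := eq_zero_of_sq_sub_mul_sq (R := κ⟦X⟧) (t := X) (r := a) (g := b)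
    (x := z) (y := x) (z := y) (w := w)
    X_prime (fun r hr => finiteMultiplicity_X hr) key (by rwa [X_dvd_iff])
    (by simp only [normForm] at e; linear_combination e)
  exact ⟨h1, h2, h3, h4⟩

variable [CharZero κ]

instance : CharZero κ⟦X⟧ := charZero_of_injective_ringHom (C_injective (R := κ))

/-- A power series over a field of characteristic zero whose constant term is a nonzero square is
itself a square. -/
theorem exists_powerSeries_sqrt {f : κ⟦X⟧} {c : κ} (hc : c ≠ 0)
    (hf : constantCoeff f = c ^ 2) : ∃ g : κ⟦X⟧, g ^ 2 = f := by
  let : Algebra ℚ κ := DivisionRing.toRatAlgebra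
  set h : κ⟦X⟧ := C (c ^ 2)⁻¹ * f - 1 with hh
  have h0 : constantCoeff h = 0 := by
    simp [hh, hf, hc]
  have hs : HasSubst h := HasSubst.of_constantCoeff_zero' h0
  have hb : (binomialSeries κ (1 / 2 : ℚ)) ^ 2 = 1 + X := by
    rw [sq, ← binomialSeries_add]
    have := binomialSeries_nat (R := ℚ) (A := κ) 1
    norm_num at this ⊢
    exact this
  have hb' : (subst h (binomialSeries κ (1 / 2 : ℚ))) ^ 2 = 1 + h := by
    rw [← subst_pow hs, hb, ← coe_substAlgHom hs]
    rw [map_add, map_one, coe_substAlgHom hs, subst_X hs]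
  refine ⟨C c * subst h (binomialSeries κ (1 / 2 : ℚ)), ?_⟩
  rw [mul_pow, hb', hh, ← map_pow]
  rw [add_sub_cancel, ← mul_assoc, ← map_mul, mul_inv_cancel₀ (pow_ne_zero 2 hc)]
  simp

theorem rep_zero_of_constantCoeff {a b : κ⟦X⟧} (ha : constantCoeff a ≠ 0)
    (hb : constantCoeff b ≠ 0) (h : NormRep (constantCoeff a) (constantCoeff b) 0) :
    NormRep a b 0 := by
  obtain ⟨z, x, y, w, c, hc, hv, e⟩ := h
  rw [zero_mul] at e
  simp only [normForm] at e
  have ha' : a ≠ 0 := fun h => ha (by simp [h])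
  have hb' : b ≠ 0 := fun h => hb (by simp [h])
  have hC : ∀ {u : κ}, u ≠ 0 → (C u : κ⟦X⟧) ≠ 0 := fun hu => by simpa using hu
  by_cases hz : z = 0
  · by_cases hx : x = 0
    · by_cases hy : y = 0
      · have hw : w ≠ 0 := fun hw => hv ⟨hz, hx, hy, hw⟩
        exfalso
        subst hz hx hy
        have : constantCoeff a * constantCoeff b * w ^ 2 = 0 := by linear_combination e
        simp_all
      · obtain ⟨g, hg⟩ := exists_powerSeries_sqrt (κ := κ)
          (f := b * (C z ^ 2 - a * C x ^ 2 + a * b * C w ^ 2)) (c := constantCoeff b * y)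
          (mul_ne_zero hb hy) (by simp; linear_combination constantCoeff b * e)
        refine ⟨b * C z, b * C x, g, b * C w, 1, one_ne_zero, ?_, ?_⟩
        · rintro ⟨h1, h2, h3, h4⟩
          have := congrArg constantCoeff hg
          simp [h3] at this
          apply hb
          simp_all
        · simp only [normForm]
          linear_combination (-b) * hg
    · obtain ⟨g, hg⟩ := exists_powerSeries_sqrt (κ := κ)
          (f := a * (C z ^ 2 - b * C y ^ 2 + a * b * C w ^ 2)) (c := constantCoeff a * x)
          (mul_ne_zero ha hx) (by simp; linear_combination constantCoeff a * e)
      refine ⟨a * C z, g, a * C y, a * C w, 1, one_ne_zero, ?_, ?_⟩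
      · rintro ⟨h1, h2, h3, h4⟩
        have := congrArg constantCoeff hg
        simp_all
      · simp only [normForm]
        linear_combination (-a) * hg
  · obtain ⟨g, hg⟩ := exists_powerSeries_sqrt (κ := κ)
          (f := a * C x ^ 2 + b * C y ^ 2 - a * b * C w ^ 2) (c := z)
          hz (by simp; linear_combination -e)
    refine ⟨g, C x, C y, C w, 1, one_ne_zero, ?_, ?_⟩
    · rintro ⟨h1, h2, h3, h4⟩
      have := congrArg constantCoeff hg
      simp_all
    · simp only [normForm]
      linear_combination hg

theorem normForm_eq_even {a b : κ⟦X⟧} (h : ¬ NormRep (constantCoeff a) (constantCoeff b) 0)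
    {z x y w : κ⟦X⟧} (hv : ¬(z = 0 ∧ x = 0 ∧ y = 0 ∧ w = 0)) :
    ∃ (j : ℕ) (u : κ⟦X⟧), constantCoeff u ≠ 0 ∧ normForm a b z x y w = X ^ (2 * j) * u := by
  obtain ⟨j, z', x', y', w', rfl, rfl, rfl, rfl, hv'⟩ := exists_primitive_vec hv
  refine ⟨j, normForm a b z' x' y' w', ?_, ?_⟩
  · intro h0
    rw [map_normForm] at h0
    exact h ⟨_, _, _, _, 1, one_ne_zero, hv', by rw [h0, zero_mul]⟩
  · simp only [normForm]; ring

theorem constantCoeff_rep_zero {a b : κ⟦X⟧} (h : NormRep a b 0) :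
    NormRep (constantCoeff a) (constantCoeff b) 0 := by
  by_contra hn
  obtain ⟨z, x, y, w, c, hc, hv, e⟩ := h
  obtain ⟨j, u, hu, h'⟩ := normForm_eq_even hn hv
  rw [e, zero_mul, eq_comm, mul_eq_zero] at h'
  rcases h' with h' | rfl
  · exact pow_ne_zero _ X_ne_zero h'
  · simp at hu

theorem not_rep_X_mul {a b : κ⟦X⟧} (h : ¬ NormRep (constantCoeff a) (constantCoeff b) 0)
    {n : κ⟦X⟧} (hn : constantCoeff n ≠ 0) : ¬ NormRep a b (X * n) := by
  rintro ⟨z, x, y, w, c, hc, hv, e⟩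
  obtain ⟨j, u, hu, h'⟩ := normForm_eq_even h hv
  have hu0 : u.order = 0 := order_zero_of_unit (isUnit_iff_constantCoeff.2 hu.isUnit)
  have hn0 : n.order = 0 := order_zero_of_unit (isUnit_iff_constantCoeff.2 hn.isUnit)
  have := congrArg order (h'.symm.trans e)
  rw [order_mul, order_mul, order_mul, order_pow, order_pow, order_X, hu0, hn0] at this
  have hc' : c.order ≠ ⊤ := by simpa using hc
  lift c.order to ℕ using hc' with m
  simp only [nsmul_eq_mul] at this
  norm_cast at this
  omega

theorem rep_zero_or_forall_constantCoeff_ne_zero {i : κ} (hi : i ^ 2 = -1) {x y z : κ⟦X⟧}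
    (hx : x ≠ 0) (hy : y ≠ 0) (hz : z ≠ 0)
    (hs : ¬(constantCoeff x = 0 ∧ constantCoeff y = 0 ∧ constantCoeff z = 0))
    {e : ℕ} {w p q τ : κ⟦X⟧} (hv : ¬(w = 0 ∧ p = 0 ∧ q = 0 ∧ τ = 0))
    (h : w ^ 2 = (z ^ e) ^ 2 *
      (x * y * p ^ 2 + x * z * q ^ 2 + y * z * tangentConic x y z * τ ^ 2)) :
    NormRep (x * z) (y * z) 0 ∨
      (constantCoeff x ≠ 0 ∧ constantCoeff y ≠ 0 ∧ constantCoeff z ≠ 0) := by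
  have hI : (C i : κ⟦X⟧) ^ 2 = -1 := by rw [← map_pow, hi]; simp
  have hi0 : i ≠ 0 := by rintro rfl; simp at hi
  have hI0 : (C i : κ⟦X⟧) ≠ 0 := by simpa using hi0
  have main : ∀ c : κ, c ≠ 0 → constantCoeff (tangentConic x y z) = c ^ 2 →
      NormRep (x * z) (y * z) 0 := by
    intro c hc hcf
    obtain ⟨g, hg⟩ := exists_powerSeries_sqrt hc hcf
    have hg0 : g ≠ 0 := by
      rintro rfl
      rw [← hg] at hcf
      simp at hcf
      exact hc (pow_eq_zero_iff two_ne_zero |>.1 hcf.symm)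
    refine ⟨z * w, z * z ^ e * q, z * g * z ^ e * τ, C i * z ^ e * p, 1, one_ne_zero, ?_, ?_⟩
    · simpa [hz, hg0, hi0, and_assoc, and_left_comm, and_comm] using hv
    · simp only [normForm]
      linear_combination (z ^ 2) * h - y * z * z ^ 2 * (z ^ e) ^ 2 * τ ^ 2 * hg +
        x * z * (y * z) * (z ^ e * p) ^ 2 * hI
  have hcf : constantCoeff (tangentConic x y z) = tangentConic (constantCoeff x)
      (constantCoeff y) (constantCoeff z) := map_tangentConic _ _ _ _
  by_cases hx0 : constantCoeff x = 0
  · left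
    by_cases hyz : constantCoeff y = constantCoeff z
    · have hy0 : constantCoeff y ≠ 0 := fun h0 => hs ⟨hx0, h0, hyz ▸ h0⟩
      obtain ⟨g, hg⟩ := exists_powerSeries_sqrt (f := y * z) hy0 (by simp [← hyz, sq])
      rw [← hg, rep_comm]
      refine rep_sq ?_ _ _
      rintro rfl
      simp [eq_comm, hy, hz] at hg
    · refine main _ (sub_ne_zero.2 hyz) ?_
      rw [hcf, hx0]; simp only [tangentConic]; ring
  by_cases hy0 : constantCoeff y = 0
  · left
    by_cases hxz : constantCoeff x = constantCoeff z
    · obtain ⟨g, hg⟩ := exists_powerSeries_sqrt (f := x * z) hx0 (by simp [← hxz, sq])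
      rw [← hg]
      refine rep_sq ?_ _ _
      rintro rfl
      simp [eq_comm, hx, hz] at hg
    · refine main _ (sub_ne_zero.2 hxz) ?_
      rw [hcf, hy0]; simp only [tangentConic]; ring
  by_cases hz0 : constantCoeff z = 0
  · left
    by_cases hxy : constantCoeff x = constantCoeff y
    · obtain ⟨g, hg⟩ := exists_powerSeries_sqrt (f := x * y) hx0 (by simp [← hxy, sq])
      refine ⟨0, C i * g, x, 0, 1, one_ne_zero, by simp [hx], ?_⟩
      simp only [normForm]
      linear_combination (-x * z * g ^ 2) * hI + x * z * hg
    · refine main _ (sub_ne_zero.2 hxy) ?_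
      rw [hcf, hz0]; simp only [tangentConic]; ring
  exact .inr ⟨hx0, hy0, hz0⟩

end PowerSeriesLemmas

section Faddeev

open Polynomial

variable {E κ : Type} [Field E] [Field κ]

/-- The expansion at `θ` of a polynomial with coefficients in a subfield of `κ`. -/
noncomputable def taylorHom (ι : E →+* κ) (θ : κ) : E[X] →+* PowerSeries κ :=
  eval₂RingHom ((PowerSeries.C).comp ι) (PowerSeries.C θ + PowerSeries.X)

theorem taylorHom_eq (ι : E →+* κ) (θ : κ) (f : E[X]) :
    taylorHom ι θ f = ((taylor θ (f.map ι) : κ[X]) : PowerSeries κ) := by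
  have : taylorHom ι θ = (coeToPowerSeries.ringHom).comp
      ((taylorAlgHom θ : κ[X] →ₐ[κ] κ[X]).toRingHom.comp (mapRingHom ι)) := by
    ext <;> simp [taylorHom, add_comm]
  rw [this]; rfl

theorem taylorHom_injective (ι : E →+* κ) (θ : κ) : Function.Injective (taylorHom ι θ) := by
  intro f g h
  rw [taylorHom_eq, taylorHom_eq] at h
  exact map_injective ι ι.injective (taylor_injective θ (Polynomial.coe_injective _ h))

theorem constantCoeff_taylorHom (ι : E →+* κ) (θ : κ) (f : E[X]) :
    PowerSeries.constantCoeff (taylorHom ι θ f) = f.eval₂ ι θ := by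
  rw [taylorHom_eq, ← PowerSeries.coeff_zero_eq_constantCoeff_apply, Polynomial.coeff_coe,
    taylor_coeff_zero, eval_map]

theorem taylorHom_eq_X_mul (ι : E →+* κ) (θ : κ) {f : E[X]} (h0 : f.eval₂ ι θ = 0)
    (h1 : (derivative f).eval₂ ι θ ≠ 0) :
    ∃ β, PowerSeries.constantCoeff β ≠ 0 ∧ taylorHom ι θ f = PowerSeries.X * β := by
  have hd : PowerSeries.X ∣ taylorHom ι θ f := by
    rw [PowerSeries.X_dvd_iff, constantCoeff_taylorHom, h0]
  obtain ⟨β, hβ⟩ := hd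
  refine ⟨β, ?_, hβ⟩
  have h2 : PowerSeries.coeff 1 (taylorHom ι θ f) = (derivative f).eval₂ ι θ := by
    rw [taylorHom_eq, Polynomial.coeff_coe, taylor_coeff_one, derivative_map, eval_map]
  rw [← h2, hβ, ← zero_add 1, PowerSeries.coeff_succ_X_mul] at h1
  simpa using h1

/-- The quaternion algebra `(a, b)` is unramified at all closed points of the affine line. -/
def UnramifiedOnLine (a b : E[X]) : Prop :=
  ∀ (κ : Type) [Field κ] [CharZero κ] (ι : E →+* κ) (θ : κ),
    NormRep (taylorHom ι θ a) (taylorHom ι θ b) 0 ∨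
      ∀ n : PowerSeries κ, PowerSeries.constantCoeff n ≠ 0 →
        ¬ NormRep (taylorHom ι θ a) (taylorHom ι θ b) (PowerSeries.X * n)

theorem UnramifiedOnLine.of_sim {a b a' b' : E[X]} (h : UnramifiedOnLine a b)
    (hs : Sim a b a' b') : UnramifiedOnLine a' b' := fun κ _ _ ι θ => by
  have hs' := hs (PowerSeries κ) (taylorHom ι θ) (taylorHom_injective ι θ)
  rcases h κ ι θ with h | h
  · exact .inl ((hs' 0).1 h)
  · exact .inr fun n hn h' => h n hn ((hs' _).2 h')

theorem UnramifiedOnLine.swap {a b : E[X]} (h : UnramifiedOnLine a b) : UnramifiedOnLine b a :=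
  fun κ _ _ ι θ => by simpa only [rep_comm (R := PowerSeries κ)] using h κ ι θ

theorem exists_dvd_sq_sub_of_squarefree (a b : E[X]) (hb : b ≠ 0) (hsq : Squarefree b)
    (h : ∀ P, Irreducible P → P ∣ b → ∃ c, P ∣ c ^ 2 - a) : ∃ c, b ∣ c ^ 2 - a := by
  induction b using WfDvdMonoid.induction_on_irreducible with
  | zero => exact absurd rfl hb
  | unit u hu => exact ⟨0, hu.dvd⟩
  | mul b P hb0 hP ih =>
    obtain ⟨c, hc⟩ := ih hb0 (hsq.squarefree_of_dvd (dvd_mul_left _ _))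
      fun Q hQ hQb => h Q hQ (hQb.mul_left _)
    obtain ⟨e, he⟩ := h P hP (dvd_mul_right _ _)
    have hcop : IsCoprime P b := by
      refine (hP.coprime_iff_not_dvd).2 fun hd => hP.not_isUnit (hsq P (mul_dvd_mul_left P hd))
    obtain ⟨u, v, huv⟩ := id hcop
    refine ⟨e * (v * b) + c * (u * P), hcop.mul_dvd ?_ ?_⟩
    · obtain ⟨q, hq⟩ := he
      refine ⟨u * (c - e) * (e * (v * b) + c * (u * P) + e) + q, ?_⟩
      linear_combination hq + (e * (e * (v * b) + c * (u * P) + e)) * huv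
    · obtain ⟨q, hq⟩ := hc
      refine ⟨v * (e - c) * (e * (v * b) + c * (u * P) + c) + q, ?_⟩
      linear_combination hq + (c * (e * (v * b) + c * (u * P) + c)) * huv

variable [CharZero E]

theorem UnramifiedOnLine.exists_dvd_sq_sub {a b : E[X]} (h : UnramifiedOnLine a b) (hb : b ≠ 0)
    (hsq : Squarefree b) : ∃ c, b ∣ c ^ 2 - a := by
  refine exists_dvd_sq_sub_of_squarefree a b hb hsq fun P hP hPb => ?_
  by_cases hPa : P ∣ a
  · exact ⟨0, by simpa using hPa⟩
  have : Fact (Irreducible P) := ⟨hP⟩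
  have : CharZero (AdjoinRoot P) := charZero_of_injective_algebraMap (algebraMap E _).injective
  have hb0 : b.eval₂ (AdjoinRoot.of P) (AdjoinRoot.root P) = 0 := by
    obtain ⟨q, rfl⟩ := hPb
    simp
  obtain ⟨β, hβ, hbβ⟩ := taylorHom_eq_X_mul (AdjoinRoot.of P) (AdjoinRoot.root P) hb0
    ((PerfectField.separable_iff_squarefree.2 hsq).eval₂_derivative_ne_zero _ hb0)
  rcases h (AdjoinRoot P) (AdjoinRoot.of P) (AdjoinRoot.root P) with h | h
  · rw [hbβ] at h
    obtain ⟨e, he⟩ := isSquare_of_rep_zero hβ h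
    obtain ⟨c, rfl⟩ := AdjoinRoot.mk_surjective e
    refine ⟨c, ?_⟩
    rw [constantCoeff_taylorHom] at he
    rw [← AdjoinRoot.mk_eq_zero, map_sub, map_pow, ← he]
    simp [AdjoinRoot.aeval_eq, ← AdjoinRoot.algebraMap_eq, ← aeval_def]
  · exfalso
    refine h (-β) (by simpa using hβ) ⟨0, 0, 1, 0, 1, one_ne_zero, by simp, ?_⟩
    rw [hbβ]; simp only [normForm]; ring

/-- An everywhere unramified quaternion algebra on the affine line is constant. -/
theorem UnramifiedOnLine.exists_sim_C {a b : E[X]} (h : UnramifiedOnLine a b) (ha : a ≠ 0)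
    (hb : b ≠ 0) : ∃ a₀ b₀ : E, a₀ ≠ 0 ∧ b₀ ≠ 0 ∧ Sim a b (C a₀) (C b₀) := by
  induction hN : a.natDegree + b.natDegree using Nat.strong_induction_on generalizing a b with
  | _ N ih =>
  subst hN
  have red : ∀ {a b : E[X]}, (∀ m < a.natDegree + b.natDegree, ∀ {a b : E[X]},
      UnramifiedOnLine a b → a ≠ 0 → b ≠ 0 → a.natDegree + b.natDegree = m →
      ∃ a₀ b₀ : E, a₀ ≠ 0 ∧ b₀ ≠ 0 ∧ Sim a b (C a₀) (C b₀)) →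
      UnramifiedOnLine a b → a ≠ 0 → b ≠ 0 → ¬ Squarefree a →
      ∃ a₀ b₀ : E, a₀ ≠ 0 ∧ b₀ ≠ 0 ∧ Sim a b (C a₀) (C b₀) := by
    intro a b ih h ha hb hsq
    simp only [Squarefree, not_forall] at hsq
    obtain ⟨p, ⟨q, hq⟩, hp⟩ := hsq
    have hp0 : p ≠ 0 := by rintro rfl; simp at hq; exact ha hq
    have hq0 : q ≠ 0 := by rintro rfl; simp at hq; exact ha hq
    have hs : Sim a b q b := by
      rw [hq, mul_comm, ← sq]; exact sim_mul_sq_left hp0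
    have hpd : 0 < p.natDegree := 
      natDegree_pos_iff_degree_pos.2 (degree_pos_of_ne_zero_of_nonunit hp0 hp)
    obtain ⟨a₀, b₀, ha₀, hb₀, hs'⟩ := ih (q.natDegree + b.natDegree) (by
      rw [hq, natDegree_mul (mul_ne_zero hp0 hp0) hq0, natDegree_mul hp0 hp0]; omega)
      (h.of_sim hs) hq0 hb rfl
    exact ⟨a₀, b₀, ha₀, hb₀, hs.trans hs'⟩
  have main : ∀ {a b : E[X]}, (∀ m < a.natDegree + b.natDegree, ∀ {a b : E[X]},
      UnramifiedOnLine a b → a ≠ 0 → b ≠ 0 → a.natDegree + b.natDegree = m →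
      ∃ a₀ b₀ : E, a₀ ≠ 0 ∧ b₀ ≠ 0 ∧ Sim a b (C a₀) (C b₀)) →
      UnramifiedOnLine a b → a ≠ 0 → b ≠ 0 → Squarefree b → a.natDegree ≤ b.natDegree →
      ∃ a₀ b₀ : E, a₀ ≠ 0 ∧ b₀ ≠ 0 ∧ Sim a b (C a₀) (C b₀) := by
    intro a b ih h ha hb hsq hab
    rcases Nat.eq_zero_or_pos b.natDegree with hb0 | hbpos
    · have ha0 : a.natDegree = 0 := by omega
      obtain ⟨a₀, rfl⟩ := natDegree_eq_zero.1 ha0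
      obtain ⟨b₀, rfl⟩ := natDegree_eq_zero.1 hb0
      exact ⟨a₀, b₀, by simpa using ha, by simpa using hb, Sim.refl _ _⟩
    obtain ⟨c', hc'⟩ := h.exists_dvd_sq_sub hb hsq
    set c := c' % b with hcdef
    have hcdeg : c.natDegree < b.natDegree := by
      rcases eq_or_ne c 0 with h0 | h0
      · rwa [h0, natDegree_zero]
      · exact natDegree_lt_natDegree h0 (degree_mod_lt c' hb)
    have hc : b ∣ c ^ 2 - a := by
      have h1 : b ∣ c' - c := ⟨c' / b, by
        rw [hcdef]; linear_combination -EuclideanDomain.div_add_mod c' b⟩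
      have : c ^ 2 - a = (c' ^ 2 - a) - (c' - c) * (c' + c) := by ring
      rw [this]
      exact dvd_sub hc' (h1.mul_right _)
    obtain ⟨b', hbb⟩ := hc
    by_cases hb' : b' = 0
    · have hca : c ^ 2 = a := by rw [hb', mul_zero] at hbb; exact sub_eq_zero.1 hbb
      have hc0 : c ≠ 0 := by rintro h0; rw [h0] at hca; simp at hca; exact ha hca.symm
      exact ⟨1, 1, one_ne_zero, one_ne_zero, by rw [← hca, map_one]; exact sim_sq hc0⟩
    · have hs : Sim a b a b' := sim_descent hb hb' hbb
      have hlt : b'.natDegree < b.natDegree := by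
        have h1 := congrArg natDegree hbb
        rw [natDegree_mul hb hb'] at h1
        have h2 := natDegree_sub_le (c ^ 2) a
        rw [natDegree_pow] at h2
        rcases le_max_iff.1 h2 with h3 | h3 <;> omega
      obtain ⟨a₀, b₀, ha₀, hb₀, hs'⟩ := ih _ (by omega) (h.of_sim hs) ha hb' rfl
      exact ⟨a₀, b₀, ha₀, hb₀, hs.trans hs'⟩
  by_cases hsa : Squarefree a
  · by_cases hsb : Squarefree b
    · rcases le_total a.natDegree b.natDegree with hab | hab
      · exact main (fun m hm _ _ => ih m hm) h ha hb hsb hab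
      · obtain ⟨b₀, a₀, hb₀, ha₀, hs⟩ := main (fun m hm _ _ => ih m (by omega)) h.swap hb ha hsa hab
        exact ⟨a₀, b₀, ha₀, hb₀, hs.swap⟩
    · obtain ⟨b₀, a₀, hb₀, ha₀, hs⟩ := red (fun m hm _ _ => ih m (by omega)) h.swap hb ha hsb
      exact ⟨a₀, b₀, ha₀, hb₀, hs.swap⟩
  · exact red (fun m hm _ _ => ih m hm) h ha hb hsa

end Faddeev

/-- `V = (w, p, q, τ)` is a point over `s = (x, y, z)` of the quadric surface bundle
`w² = z ^ (2 e) * (x y p² + x z q² + y z f(x, y, z) τ²)`. -/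
def IsBundlePoint {R : Type*} [CommRing R] (e : ℕ) (s : Fin 3 → R) (V : Fin 4 → R) : Prop :=
  V 0 ^ 2 = (s 2 ^ e) ^ 2 * (s 0 * s 1 * V 1 ^ 2 + s 0 * s 2 * V 2 ^ 2 +
    s 1 * s 2 * tangentConic (s 0) (s 1) (s 2) * V 3 ^ 2)

/-- The point `s` of the plane lies off the coordinate lines and the quaternion algebra
`(x z, y z)` is not split there. -/
def NonSplitAt {R : Type*} [CommRing R] (s : Fin 3 → R) : Prop :=
  s 0 ≠ 0 ∧ s 1 ≠ 0 ∧ s 2 ≠ 0 ∧ ¬ NormRep (s 0 * s 2) (s 1 * s 2) 0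

section BundlePoint

variable {R S : Type*} [CommRing R] [CommRing S]

theorem IsBundlePoint.map {e : ℕ} {s : Fin 3 → R} {V : Fin 4 → R} (h : IsBundlePoint e s V)
    (φ : R →+* S) : IsBundlePoint e (fun k => φ (s k)) (fun k => φ (V k)) := by
  have := congrArg φ h
  simpa [IsBundlePoint, map_tangentConic] using this

theorem IsBundlePoint.of_map {e : ℕ} {s : Fin 3 → R} {V : Fin 4 → R} {φ : R →+* S}
    (hφ : Function.Injective φ)
    (h : IsBundlePoint e (fun k => φ (s k)) (fun k => φ (V k))) : IsBundlePoint e s V := by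
  apply hφ
  simpa [IsBundlePoint, map_tangentConic] using h

theorem isBundlePoint_smul_base {e : ℕ} {s : Fin 3 → R} {V : Fin 4 → R} (c : R) :
    IsBundlePoint e (fun k => c * s k) V ↔
      IsBundlePoint e s ![V 0, c ^ (e + 1) * V 1, c ^ (e + 1) * V 2, c ^ (e + 2) * V 3] := by
  have : ∀ A B : R, A = B → ∀ w : R, (w = A ↔ w = B) := by rintro A _ rfl w; rfl
  refine this _ _ ?_ _
  simp only [tangentConic, Matrix.cons_val]
  ring

theorem nonSplitAt_smul [IsDomain R] {s : Fin 3 → R} {c : R} (hc : c ≠ 0) :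
    NonSplitAt (fun k => c * s k) ↔ NonSplitAt s := by
  simp only [NonSplitAt, mul_ne_zero_iff, hc, true_and, ne_eq, not_false_eq_true]
  have h : NormRep (c * s 0 * (c * s 2)) (c * s 1 * (c * s 2)) 0 ↔
      NormRep (s 0 * s 2) (s 1 * s 2) 0 := by
    rw [← rep_mul_sq_left (a := s 0 * s 2) hc, ← rep_mul_sq_right (b := s 1 * s 2) hc]
    ring_nf
  rw [h]

end BundlePoint

section LocalSpecialization

open PowerSeries

variable {κ : Type} [Field κ]

theorem rep_local_scale {s s' : Fin 3 → κ⟦X⟧} {j : ℕ} (hs : s = fun k => X ^ j * s' k)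
    (n : κ⟦X⟧) : NormRep (s 0 * s 2) (s 1 * s 2) n ↔ NormRep (s' 0 * s' 2) (s' 1 * s' 2) n := by
  have hX : (X : κ⟦X⟧) ^ j ≠ 0 := pow_ne_zero _ X_ne_zero
  rw [← rep_mul_sq_left (a := s' 0 * s' 2) hX, ← rep_mul_sq_right (b := s' 1 * s' 2) hX, hs]
  ring_nf

variable [CharZero κ] {i : κ} {e : ℕ}

theorem IsBundlePoint.local_or (hi : i ^ 2 = -1) {s s' : Fin 3 → κ⟦X⟧} {V : Fin 4 → κ⟦X⟧} {j : ℕ}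
    (hs : s = fun k => X ^ j * s' k) (hne : ∀ k, s' k ≠ 0)
    (hs0 : (fun k => constantCoeff (s' k)) ≠ 0) (hV : V ≠ 0) (h : IsBundlePoint e s V) :
    NormRep (s' 0 * s' 2) (s' 1 * s' 2) 0 ∨ ∀ k, constantCoeff (s' k) ≠ 0 := by
  rw [hs, isBundlePoint_smul_base] at h
  have hX : ∀ n, (X : κ⟦X⟧) ^ n ≠ 0 := fun n => pow_ne_zero _ X_ne_zero
  have := rep_zero_or_forall_constantCoeff_ne_zero hi (hne 0) (hne 1) (hne 2) (e := e)
    (by rintro ⟨h0, h1, h2⟩; exact hs0 (funext fun k => by fin_cases k <;> assumption))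
    (by
      rintro ⟨h0, h1, h2, h3⟩
      refine hV (funext fun k => ?_)
      simp only [Matrix.cons_val, mul_eq_zero, pow_ne_zero _ (hX _), false_or] at h0 h1 h2 h3
      fin_cases k <;> assumption) h
  exact this.imp_right fun ⟨h0, h1, h2⟩ k => by fin_cases k <;> assumption

theorem IsBundlePoint.nonSplitAt_iff (hi : i ^ 2 = -1) {s s' : Fin 3 → κ⟦X⟧} {V : Fin 4 → κ⟦X⟧}
    {j : ℕ} (hs : s = fun k => X ^ j * s' k) (hne : ∀ k, s' k ≠ 0)
    (hs0 : (fun k => constantCoeff (s' k)) ≠ 0) (hV : V ≠ 0) (h : IsBundlePoint e s V) :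
    NonSplitAt (fun k => constantCoeff (s' k)) ↔ ¬ NormRep (s 0 * s 2) (s 1 * s 2) 0 := by
  rw [rep_local_scale hs]
  constructor
  · rintro ⟨-, -, -, h'⟩ hr
    exact h' (by simpa only [map_mul] using constantCoeff_rep_zero hr)
  · intro hr
    have hne0 := (h.local_or hi hs hne hs0 hV).resolve_left hr
    refine ⟨hne0 0, hne0 1, hne0 2, fun h' => hr (rep_zero_of_constantCoeff ?_ ?_ ?_)⟩
    · simp [hne0]
    · simp [hne0]
    · simpa only [map_mul] using h'

theorem IsBundlePoint.unramified (hi : i ^ 2 = -1) {s : Fin 3 → κ⟦X⟧} {V : Fin 4 → κ⟦X⟧}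
    (hne : ∀ k, s k ≠ 0) (hV : V ≠ 0) (h : IsBundlePoint e s V) :
    NormRep (s 0 * s 2) (s 1 * s 2) 0 ∨ ∀ n : κ⟦X⟧, constantCoeff n ≠ 0 →
      ¬ NormRep (s 0 * s 2) (s 1 * s 2) (X * n) := by
  obtain ⟨j, s', hs', k, hk⟩ := exists_primitive_scaling (t := (X : κ⟦X⟧))
    (fun r hr => finiteMultiplicity_X hr) (v := s) (fun h0 => hne 0 (congrFun h0 0))
  have hne' : ∀ k, s' k ≠ 0 := fun k h0 => hne k (by rw [hs', h0, mul_zero])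
  have hs0 : (fun k => constantCoeff (s' k)) ≠ 0 := fun h0 => hk (X_dvd_iff.2 (congrFun h0 k))
  rw [or_iff_not_imp_left]
  intro hr n hn
  rw [rep_local_scale (funext hs')]
  refine not_rep_X_mul ?_ hn
  simpa only [map_mul] using ((h.nonSplitAt_iff hi (funext hs') hne' hs0 hV).2 hr).2.2.2

end LocalSpecialization

section Line

open Polynomial

variable {E : Type} [Field E]

/-- The expansion at infinity. -/
noncomputable def infinityHom (E : Type) [Field E] : E[X] →+* FractionRing (PowerSeries E) :=
  eval₂RingHom ((algebraMap (PowerSeries E) _).comp PowerSeries.C)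
    (algebraMap (PowerSeries E) (FractionRing (PowerSeries E)) PowerSeries.X)⁻¹

theorem infinityHom_mul_pow {N : ℕ} {f : E[X]} (hf : f.natDegree ≤ N) :
    infinityHom E f * algebraMap (PowerSeries E) (FractionRing (PowerSeries E)) PowerSeries.X ^ N =
      algebraMap (PowerSeries E) _ ((reflect N f : E[X]) : PowerSeries E) := by
  have hT : algebraMap (PowerSeries E) (FractionRing (PowerSeries E)) PowerSeries.X ≠ 0 :=
    (map_ne_zero_iff _ (IsFractionRing.injective _ _)).2 PowerSeries.X_ne_zero
  let := invertibleOfNonzero hT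
  have h2 : (reflect N f).natDegree ≤ N := (natDegree_reflect_le).trans (by simp [hf])
  have := eval₂_reflect_mul_pow
    ((algebraMap (PowerSeries E) (FractionRing (PowerSeries E))).comp PowerSeries.C)
    (algebraMap (PowerSeries E) (FractionRing (PowerSeries E)) PowerSeries.X) N (reflect N f) h2
  rw [reflect_reflect, invOf_eq_inv] at this
  rw [infinityHom, coe_eval₂RingHom, this]
  have h3 : eval₂RingHom
      ((algebraMap (PowerSeries E) (FractionRing (PowerSeries E))).comp PowerSeries.C)
      (algebraMap (PowerSeries E) (FractionRing (PowerSeries E)) PowerSeries.X) =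
      (algebraMap (PowerSeries E) (FractionRing (PowerSeries E))).comp
        coeToPowerSeries.ringHom := by
    ext <;> simp
  exact congrArg (fun g => g (reflect N f)) h3

theorem infinityHom_injective : Function.Injective (infinityHom E) := by
  rw [injective_iff_map_eq_zero]
  intro f hf
  have := infinityHom_mul_pow (le_refl f.natDegree)
  rw [hf, zero_mul, eq_comm, map_eq_zero_iff _ (IsFractionRing.injective _ _),
    Polynomial.coe_eq_zero_iff, reflect_eq_zero_iff] at this
  exact this

variable [CharZero E] {i : E} {e : ℕ}

theorem IsBundlePoint.unramifiedOnLine (hi : i ^ 2 = -1) {s : Fin 3 → E[X]} {V : Fin 4 → E[X]}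
    (hne : ∀ k, s k ≠ 0) (hV : V ≠ 0) (h : IsBundlePoint e s V) :
    UnramifiedOnLine (s 0 * s 2) (s 1 * s 2) := by
  intro κ _ _ ι θ
  have hinj := taylorHom_injective ι θ
  have hV' : (fun k => taylorHom ι θ (V k)) ≠ 0 := fun h0 =>
    hV (funext fun k => (map_eq_zero_iff _ hinj).1 (congrFun h0 k))
  have := (h.map (taylorHom ι θ)).unramified (i := ι i) (by rw [← map_pow, hi]; simp)
    (fun k => (map_ne_zero_iff _ hinj).2 (hne k)) hV'
  rwa [map_mul, map_mul]

theorem rep_powerSeries_C {a b : E} (ha : a ≠ 0) (hb : b ≠ 0) :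
    NormRep (PowerSeries.C a) (PowerSeries.C b) 0 ↔ NormRep a b 0 :=
  ⟨fun h => by simpa using constantCoeff_rep_zero h,
    fun h => rep_zero_of_constantCoeff (by simpa) (by simpa) (by simpa)⟩

theorem IsBundlePoint.nonSplitAt_coeff_iff (hi : i ^ 2 = -1) {s : Fin 3 → E[X]} {V : Fin 4 → E[X]}
    (hV : V ≠ 0) (h : IsBundlePoint e s V) {lo top : ℕ}
    (hlo : ∀ j < lo, ∀ k, (s k).coeff j = 0) (hlo0 : (fun k => (s k).coeff lo) ≠ 0)
    (hhi : ∀ j > top, ∀ k, (s k).coeff j = 0) (hhi0 : (fun k => (s k).coeff top) ≠ 0) :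
    NonSplitAt (fun k => (s k).coeff lo) ↔ NonSplitAt (fun k => (s k).coeff top) := by
  by_cases hne : ∀ k, s k ≠ 0
  swap
  · push Not at hne
    obtain ⟨k, hk⟩ := hne
    have : ∀ n, ¬ NonSplitAt (fun k => (s k).coeff n) := by
      rintro n ⟨h0, h1, h2, -⟩
      fin_cases k
      exacts [h0 (by simp at hk; simp [hk]), h1 (by simp at hk; simp [hk]),
        h2 (by simp at hk; simp [hk])]
    exact iff_of_false (this _) (this _)
  obtain ⟨a₀, b₀, ha₀, hb₀, hsim⟩ := (h.unramifiedOnLine hi hne hV).exists_sim_C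
    (mul_ne_zero (hne 0) (hne 2)) (mul_ne_zero (hne 1) (hne 2))
  trans ¬ NormRep a₀ b₀ 0
  · -- expansion at the origin
    have hinj := taylorHom_injective (RingHom.id E) 0
    have hcoe : ∀ f : E[X], taylorHom (RingHom.id E) 0 f = (f : PowerSeries E) := by
      intro f; rw [taylorHom_eq]; simp
    have hdvd : ∀ k, ∃ g : PowerSeries E, (s k : PowerSeries E) = PowerSeries.X ^ lo * g := by
      intro k
      apply (PowerSeries.X_pow_dvd_iff).2
      intro m hm
      rw [Polynomial.coeff_coe, hlo m hm k]
    choose s' hs' using hdvd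
    have hc : ∀ k, PowerSeries.constantCoeff (s' k) = (s k).coeff lo := by
      intro k
      have := congrArg (PowerSeries.coeff lo) (hs' k)
      rw [Polynomial.coeff_coe] at this
      rw [this, ← PowerSeries.coeff_zero_eq_constantCoeff_apply]
      simpa using (PowerSeries.coeff_X_pow_mul (s' k) lo 0).symm
    have hb := h.map (taylorHom (RingHom.id E) 0)
    have := hb.nonSplitAt_iff hi (s' := s') (j := lo) (by funext k; rw [hcoe, hs'])
      (fun k h0 => hne k (by
        have := hs' k
        rwa [h0, mul_zero, Polynomial.coe_eq_zero_iff] at this))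
      (by simpa only [hc] using hlo0)
      (fun h0 => hV (funext fun k => (map_eq_zero_iff _ hinj).1 (congrFun h0 k)))
    simp only [hc] at this
    rw [this, ← map_mul, ← map_mul, hsim _ _ hinj, hcoe, hcoe, Polynomial.coe_C, Polynomial.coe_C,
      rep_powerSeries_C ha₀ hb₀]
  · -- expansion at infinity
    set T := algebraMap (PowerSeries E) (FractionRing (PowerSeries E)) PowerSeries.X with hTdef
    have hinjA := IsFractionRing.injective (PowerSeries E) (FractionRing (PowerSeries E))
    have hT : T ≠ 0 := (map_ne_zero_iff _ hinjA).2 PowerSeries.X_ne_zero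
    have hinj := infinityHom_injective (E := E)
    have hdeg : ∀ k, (s k).natDegree ≤ top := fun k =>
      natDegree_le_iff_coeff_eq_zero.2 fun N hN => hhi N hN k
    obtain ⟨M, hM⟩ : ∃ M, ∀ k, (V k).natDegree ≤ M :=
      ⟨∑ k, (V k).natDegree, fun k => Finset.single_le_sum (f := fun k => (V k).natDegree)
        (fun _ _ => Nat.zero_le _) (Finset.mem_univ k)⟩
    set s' : Fin 3 → PowerSeries E := fun k => ((reflect top (s k) : E[X]) : PowerSeries E) with hs'
    set V' : Fin 4 → PowerSeries E := fun k => ((reflect M (V k) : E[X]) : PowerSeries E) with hV'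
    have hss : ∀ k, algebraMap _ _ (s' k) = infinityHom E (s k) * T ^ top :=
      fun k => (infinityHom_mul_pow (hdeg k)).symm
    have hVV : ∀ k, algebraMap _ _ (V' k) = infinityHom E (V k) * T ^ M :=
      fun k => (infinityHom_mul_pow (hM k)).symm
    have hpt : IsBundlePoint e s' ![V' 0 * (PowerSeries.X ^ top) ^ (e + 2),
        V' 1 * PowerSeries.X ^ top, V' 2 * PowerSeries.X ^ top, V' 3] := by
      have h1 := (h.map (infinityHom E))
      apply IsBundlePoint.of_map hinjA
      simp only [IsBundlePoint, hss, Matrix.cons_val, map_mul, map_pow, hVV, ← hTdef,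
        tangentConic] at h1 ⊢
      generalize T ^ top = c
      linear_combination (T ^ M) ^ 2 * (c ^ (e + 2)) ^ 2 * h1
    have hc : ∀ k, PowerSeries.constantCoeff (s' k) = (s k).coeff top := by
      intro k
      rw [hs', ← PowerSeries.coeff_zero_eq_constantCoeff_apply, Polynomial.coeff_coe,
        coeff_reflect]
      simp
    have := hpt.nonSplitAt_iff hi (s' := s') (j := 0) (by simp)
      (fun k h0 => hne k (by
        have := hss k
        rw [h0, map_zero, eq_comm, mul_eq_zero, or_iff_left (pow_ne_zero _ hT)] at this
        exact (map_eq_zero_iff _ hinj).1 this))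
      (by simpa only [hc] using hhi0)
      (fun h0 => hV (funext fun k => (map_eq_zero_iff _ hinj).1 ?_))
    · simp only [hc] at this
      have hch : CharZero (FractionRing (PowerSeries E)) :=
        charZero_of_injective_ringHom hinjA
      have hfr : ∀ a b : PowerSeries E, NormRep a b 0 ↔ NormRep
          (algebraMap _ (FractionRing (PowerSeries E)) a) (algebraMap _ _ b) 0 := fun a b =>
        ⟨fun h => by simpa only [map_zero] using h.map hinjA, rep_zero_of_fraction⟩
      have h0 : algebraMap _ (FractionRing (PowerSeries E)) (s' 0 * s' 2) =
          infinityHom E (s 0 * s 2) * (T ^ top) ^ 2 := by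
        rw [map_mul, hss, hss, map_mul]; ring
      have h1 : algebraMap _ (FractionRing (PowerSeries E)) (s' 1 * s' 2) =
          infinityHom E (s 1 * s 2) * (T ^ top) ^ 2 := by
        rw [map_mul, hss, hss, map_mul]; ring
      have hψC : ∀ c : E, infinityHom E (C c) = algebraMap _ _ (PowerSeries.C c) := by
        intro c; simp [infinityHom]
      rw [this, hfr, h0, h1, rep_mul_sq_left (pow_ne_zero _ hT), rep_mul_sq_right
        (pow_ne_zero _ hT), hsim _ _ hinj, hψC, hψC, ← hfr, rep_powerSeries_C ha₀ hb₀]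
    · have hX : (PowerSeries.X : PowerSeries E) ^ top ≠ 0 := pow_ne_zero _ PowerSeries.X_ne_zero
      have hzero : V' k = 0 := by
        have := congrFun h0 k
        fin_cases k <;> simpa [hX] using this
      have := hVV k
      rw [hzero, map_zero, eq_comm, mul_eq_zero, or_iff_left (pow_ne_zero _ hT)] at this
      exact this

end Line

section Newton

section Weights

variable {Γ₀ : Type*} [LinearOrderedCommGroupWithZero Γ₀] {w x y : Γ₀}

theorem pow_add_div_le_iff (hw : 0 < w) (hx : 0 < x) (hy : 0 < y) (i k : ℕ) :
    w ^ (i + k) / x ≤ w ^ i / y ↔ w ^ k ≤ x / y := by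
  have h1 : w ^ i * (w ^ k * y) = w ^ (i + k) * y := by rw [pow_add, mul_assoc]
  rw [div_le_div_iff₀ hx hy, le_div_iff₀ hy, ← h1]
  exact mul_le_mul_iff_right₀ (pow_pos hw i)

theorem div_le_pow_add_div_iff (hw : 0 < w) (hx : 0 < x) (hy : 0 < y) (i k : ℕ) :
    w ^ i / y ≤ w ^ (i + k) / x ↔ x / y ≤ w ^ k := by
  have h1 : w ^ i * (w ^ k * y) = w ^ (i + k) * y := by rw [pow_add, mul_assoc]
  rw [div_le_div_iff₀ hy hx, div_le_iff₀ hy, ← h1]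
  exact mul_le_mul_iff_right₀ (pow_pos hw i)

end Weights

/-- Moving along the edges of a Newton polygon from its first to its last vertex. -/
theorem newton_polygon_induction {K Γ₀ : Type*} [Field K] [IsAlgClosed K]
    [LinearOrderedCommGroupWithZero Γ₀] (v : Valuation K Γ₀) (c : ℕ → K) (J : Finset ℕ)
    (hc : ∀ l ∈ J, c l ≠ 0) (Q : ℕ → Prop)
    (hQ : ∀ μ : K, μ ≠ 0 → ∀ lo ∈ J, ∀ hi ∈ J,
      (∀ l ∈ J, v (μ ^ l / c l) ≤ v (μ ^ lo / c lo)) → v (μ ^ hi / c hi) = v (μ ^ lo / c lo) →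
      (∀ l ∈ J, l < lo → v (μ ^ l / c l) < v (μ ^ lo / c lo)) →
      (∀ l ∈ J, hi < l → v (μ ^ l / c l) < v (μ ^ lo / c lo)) → (Q lo ↔ Q hi))
    {b : ℕ} (ha : 0 ∈ J) (hb : b ∈ J) (hab : ∀ l ∈ J, l ≤ b) : Q 0 ↔ Q b := by
  classical
  have hv0 : ∀ l ∈ J, 0 < v (c l) := fun l hl => zero_lt_iff.2 ((v.ne_zero_iff).2 (hc l hl))
  have step : ∀ n i, i ∈ J → b - i = n → (∃ γ : Γ₀, (i = 0 ∨ 0 < γ) ∧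
      (∀ l ∈ J, l < i → γ ^ l / v (c l) ≤ γ ^ i / v (c i)) ∧
      (∀ l ∈ J, i < l → γ ^ l / v (c l) < γ ^ i / v (c i))) → (Q i ↔ Q b) := by
    intro n
    induction n using Nat.strong_induction_on with
    | _ n ih =>
    rintro i hi hin ⟨γ, hγ0, hγ1, hγ2⟩
    rcases eq_or_lt_of_le (hab i hi) with rfl | hib
    · rfl
    have hroot : ∀ l, ∃ μ : K, l ∈ J → i < l → μ ≠ 0 ∧ μ ^ (l - i) = c l / c i := by
      intro l
      by_cases h : l ∈ J ∧ i < l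
      · obtain ⟨μ, hμ⟩ := IsAlgClosed.exists_pow_nat_eq (c l / c i) (n := l - i) (by omega)
        refine ⟨μ, fun _ _ => ⟨?_, hμ⟩⟩
        rintro rfl
        rw [zero_pow (by omega)] at hμ
        exact div_ne_zero (hc l h.1) (hc i hi) hμ.symm
      · exact ⟨0, fun h1 h2 => absurd ⟨h1, h2⟩ h⟩
    choose μ hμ using hroot
    obtain ⟨m, hm, hmin⟩ := (J.filter (i < ·)).exists_min_image (fun l => v (μ l))
      ⟨b, by simp [hb, hib]⟩
    simp only [Finset.mem_filter] at hm hmin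
    obtain ⟨hm0, hmr⟩ := hμ m hm.1 hm.2
    have hvm : 0 < v (μ m) := zero_lt_iff.2 ((v.ne_zero_iff).2 hm0)
    have hvl : ∀ l ∈ J, i < l → v (μ l) ^ (l - i) = v (c l) / v (c i) := by
      intro l hl hil
      rw [← map_pow, (hμ l hl hil).2, map_div₀]
    have hlate : ∀ l ∈ J, i < l → v (μ m) ^ l / v (c l) ≤ v (μ m) ^ i / v (c i) := by
      intro l hl hil
      have := pow_add_div_le_iff hvm (hv0 l hl) (hv0 i hi) i (l - i)
      rw [Nat.add_sub_cancel' hil.le] at this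
      rw [this, ← hvl l hl hil]
      exact pow_le_pow_left₀ zero_le (hmin l ⟨hl, hil⟩) _
    have hm_eq : v (μ m) ^ m / v (c m) = v (μ m) ^ i / v (c i) := by
      refine le_antisymm (hlate m hm.1 hm.2) ?_
      have := div_le_pow_add_div_iff hvm (hv0 m hm.1) (hv0 i hi) i (m - i)
      rw [Nat.add_sub_cancel' hm.2.le] at this
      rw [this, ← hvl m hm.1 hm.2]
    have hearly : ∀ l ∈ J, l < i → v (μ m) ^ l / v (c l) < v (μ m) ^ i / v (c i) := by
      intro l hl hli
      have hγ : 0 < γ := hγ0.resolve_left (by omega)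
      have h1 := div_le_pow_add_div_iff hγ (hv0 m hm.1) (hv0 i hi) i (m - i)
      rw [Nat.add_sub_cancel' hm.2.le, ← hvl m hm.1 hm.2] at h1
      have h2 : γ < v (μ m) := by
        by_contra! h
        exact absurd (h1.2 (pow_le_pow_left₀ zero_le h _)) (not_le.2 (hγ2 m hm.1 hm.2))
      have h3 := div_le_pow_add_div_iff hγ (hv0 i hi) (hv0 l hl) l (i - l)
      have h4 := pow_add_div_le_iff hvm (hv0 i hi) (hv0 l hl) l (i - l)
      rw [Nat.add_sub_cancel' hli.le] at h3 h4
      have h5 := h3.1 (hγ1 l hl hli)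
      by_contra! h
      exact absurd (h5.trans_lt (pow_lt_pow_left₀ h2 zero_le (by omega)))
        (not_lt.2 (h4.1 h))
    obtain ⟨hi', hhi', hmax⟩ := (J.filter
      (fun l => v (μ m) ^ l / v (c l) = v (μ m) ^ i / v (c i))).exists_max_image id
      ⟨m, by simp [hm.1, hm_eq]⟩
    simp only [Finset.mem_filter, id] at hhi' hmax
    have him : m ≤ hi' := hmax m ⟨hm.1, hm_eq⟩
    have hall : ∀ l ∈ J, v (μ m) ^ l / v (c l) ≤ v (μ m) ^ i / v (c i) := by
      intro l hl
      rcases lt_trichotomy l i with h | rfl | h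
      · exact (hearly l hl h).le
      · exact le_rfl
      · exact hlate l hl h
    have hlater : ∀ l ∈ J, hi' < l → v (μ m) ^ l / v (c l) < v (μ m) ^ i / v (c i) := by
      intro l hl hil
      refine lt_of_le_of_ne (hall l hl) fun h => ?_
      exact absurd (hmax l ⟨hl, h⟩) (by omega)
    have h1 : Q i ↔ Q hi' := by
      refine hQ (μ m) hm0 i hi hi' hhi'.1 ?_ ?_ ?_ ?_ <;> simp only [map_div₀, map_pow]
      exacts [hall, hhi'.2, hearly, hlater]
    have h2 := hab hi' hhi'.1
    refine h1.trans (ih (b - hi') (by omega) hi' hhi'.1 rfl ⟨v (μ m), Or.inr hvm, ?_, ?_⟩)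
    · intro l hl _
      rw [hhi'.2]
      exact hall l hl
    · intro l hl h
      rw [hhi'.2]
      exact hlater l hl h
  refine step _ 0 ha rfl ⟨0, Or.inl rfl, fun l hl h => absurd h (by omega), fun l hl h => ?_⟩
  rw [zero_pow (by omega), zero_div, pow_zero]
  exact div_pos one_pos (hv0 0 ha)

end Newton

/-- Elements of `A` have primitive scalings in `D` with respect to the valuation ring `B`. -/
structure PrimitiveScaling {K A D E : Type} [Field K] [CommRing A] [CommRing D] [CommRing E]
    (B : ValuationSubring K) (κ : K →+* A) (τ : B →+* D) (j : D →+* A) (ρ : D →+* E) : Prop where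
  injective : Function.Injective j
  comm : ∀ b, j (τ b) = κ b
  map_nonunit : ∀ b : B, ¬ IsUnit b → ρ (τ b) = 0
  exists_scaling : ∀ S : Finset A, (∃ a ∈ S, a ≠ 0) → ∃ c : K, c ≠ 0 ∧
    (∀ a ∈ S, ∃ δ, j δ = κ c * a) ∧ ∃ a ∈ S, ∃ δ, j δ = κ c * a ∧ ρ δ ≠ 0

namespace PrimitiveScaling

variable {K A D E : Type} [Field K] [CommRing A] [CommRing D] [CommRing E]
  {B : ValuationSubring K} {κ : K →+* A} {τ : B →+* D} {j : D →+* A} {ρ : D →+* E}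

theorem base (B : ValuationSubring K) : PrimitiveScaling B (RingHom.id K) (RingHom.id B) B.subtype
    (IsLocalRing.residue B) where
  injective := Subtype.val_injective
  comm _ := rfl
  map_nonunit b hb := (IsLocalRing.residue_eq_zero_iff b).2 hb
  exists_scaling S hS := by
    obtain ⟨a, ha, ha0⟩ := hS
    obtain ⟨m, hm, hmax⟩ := S.exists_max_image B.valuation ⟨a, ha⟩
    have hm0 : m ≠ 0 := by
      rintro rfl
      have := hmax a ha
      rw [map_zero, le_zero_iff, map_eq_zero] at this
      exact ha0 this
    refine ⟨m⁻¹, inv_ne_zero hm0, fun x hx => ?_, m, hm, 1, by simp [hm0], by simp⟩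
    refine ⟨⟨m⁻¹ * x, ?_⟩, rfl⟩
    rw [← B.valuation_le_one_iff, map_mul, map_inv₀]
    exact inv_mul_le_one_of_le₀ (hmax x hx) zero_le

theorem exists_family (h : PrimitiveScaling B κ τ j ρ) {ι : Type*} [Fintype ι] {v : ι → A}
    (hv : v ≠ 0) : ∃ c : K, c ≠ 0 ∧ ∃ δ : ι → D, (∀ i, j (δ i) = κ c * v i) ∧
      (fun i => ρ (δ i)) ≠ 0 := by
  classical
  obtain ⟨i, hi⟩ := Function.ne_iff.1 hv
  obtain ⟨c, hc, h1, a, ha, δa, h2, h3⟩ := h.exists_scaling (Finset.univ.image v)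
    ⟨v i, by simp, hi⟩
  have h1' : ∀ i, ∃ δ, j δ = κ c * v i := fun i => h1 _ (by simp)
  choose δ hδ using h1'
  refine ⟨c, hc, δ, hδ, fun h0 => h3 ?_⟩
  obtain ⟨k, -, rfl⟩ := Finset.mem_image.1 ha
  rw [h.injective (h2.trans (hδ k).symm)]
  exact congrFun h0 k

theorem comp_injective (h : PrimitiveScaling B κ τ j ρ) {E' : Type} [CommRing E'] {g : E →+* E'}
    (hg : Function.Injective g) : PrimitiveScaling B κ τ j (g.comp ρ) where
  injective := h.injective
  comm := h.comm
  map_nonunit b hb := by simp [h.map_nonunit b hb]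
  exists_scaling S hS := by
    obtain ⟨c, hc, h1, a, ha, δ, h2, h3⟩ := h.exists_scaling S hS
    exact ⟨c, hc, h1, a, ha, δ, h2, (map_ne_zero_iff g hg).2 h3⟩

open Polynomial in
theorem polynomial (h : PrimitiveScaling B κ τ j ρ) :
    PrimitiveScaling B ((C : A →+* A[X]).comp κ) ((C : D →+* D[X]).comp τ) (mapRingHom j)
      (mapRingHom ρ) where
  injective := map_injective j h.injective
  comm b := by simp [h.comm]
  map_nonunit b hb := by simp [h.map_nonunit b hb]
  exists_scaling S hS := by
    classical
    obtain ⟨P, hP, hP0⟩ := hS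
    obtain ⟨c, hc, h1, a, ha, δ, h2, h3⟩ := h.exists_scaling (S.biUnion fun P => P.coeffs)
      ⟨P.leadingCoeff, Finset.mem_biUnion.2 ⟨P, hP, coeff_mem_coeffs (by simpa using hP0)⟩,
        by simpa using hP0⟩
    have key : ∀ P ∈ S, ∃ Q : D[X], mapRingHom j Q = (C : A →+* A[X]).comp κ c * P := by
      intro P hP
      have : (C (κ c) * P) ∈ lifts j := by
        rw [lifts_iff_coeff_lifts]
        intro n
        rw [coeff_C_mul]
        by_cases h0 : P.coeff n = 0
        · exact ⟨0, by simp [h0]⟩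
        · exact h1 _ (Finset.mem_biUnion.2 ⟨P, hP, coeff_mem_coeffs h0⟩)
      simpa [mem_lifts] using this
    refine ⟨c, hc, key, ?_⟩
    obtain ⟨P, hP, haP⟩ := Finset.mem_biUnion.1 ha
    obtain ⟨n, hn, rfl⟩ := mem_coeffs_iff.1 haP
    obtain ⟨Q, hQ⟩ := key P hP
    refine ⟨P, hP, Q, hQ, fun h0 => h3 ?_⟩
    have hcoef := congrArg (coeff · n) hQ
    simp only [coe_mapRingHom, coeff_map, RingHom.comp_apply, coeff_C_mul] at hcoef
    rw [h.injective (h2.trans hcoef.symm)]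
    simpa using congrArg (coeff · n) h0

theorem isDomain [IsDomain E] (h : PrimitiveScaling B κ τ j ρ) [Nontrivial A] : IsDomain A := by
  have : NoZeroDivisors A := by
    refine ⟨fun {a b} hab => ?_⟩
    by_contra! hne
    obtain ⟨c, -, δ, h1, h2⟩ := h.exists_family (ι := Unit) (v := fun _ => a)
      (fun h0 => hne.1 (congrFun h0 ()))
    obtain ⟨c', -, δ', h1', h2'⟩ := h.exists_family (ι := Unit) (v := fun _ => b)
      (fun h0 => hne.2 (congrFun h0 ()))
    have h3 : δ () * δ' () = 0 := by
      apply h.injective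
      rw [map_mul, h1, h1', map_zero]
      linear_combination κ c * κ c' * hab
    have h4 : ρ (δ ()) * ρ (δ' ()) = 0 := by rw [← map_mul, h3, map_zero]
    rcases mul_eq_zero.1 h4 with h5 | h5
    · exact h2 (funext fun _ => h5)
    · exact h2' (funext fun _ => h5)
  exact NoZeroDivisors.to_isDomain A

section Compare

variable {ι : Type*} {v : ι → A} {c c' : K} {δ δ' : ι → D}

theorem valuation_le_one (h : PrimitiveScaling B κ τ j ρ) (hc' : c' ≠ 0)
    (hδ : ∀ i, j (δ i) = κ c * v i) (hprim : (fun i => ρ (δ i)) ≠ 0)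
    (hδ' : ∀ i, j (δ' i) = κ c' * v i) : B.valuation (c' / c) ≤ 1 := by
  by_contra! hlt
  have hm : B.valuation (c / c') < 1 := by
    rw [← inv_div, map_inv₀]; exact inv_lt_one_of_one_lt₀ hlt
  have hmem : c / c' ∈ B := (B.valuation_le_one_iff _).1 hm.le
  refine hprim (funext fun i => ?_)
  have : δ i = τ ⟨c / c', hmem⟩ * δ' i := by
    apply h.injective
    rw [map_mul, h.comm, hδ, hδ', ← mul_assoc, ← map_mul, div_mul_cancel₀ _ hc']
  rw [this, map_mul, h.map_nonunit, zero_mul]; · rfl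
  rw [B.valuation_eq_one_iff]
  exact hm.ne

theorem exists_smul (h : PrimitiveScaling B κ τ j ρ) (hc : c ≠ 0)
    (hδ : ∀ i, j (δ i) = κ c * v i) (hδ' : ∀ i, j (δ' i) = κ c' * v i)
    (hv : B.valuation (c' / c) ≤ 1) :
    ∃ b : B, (b : K) = c' / c ∧ ∀ i, ρ (δ' i) = ρ (τ b) * ρ (δ i) := by
  refine ⟨⟨c' / c, (B.valuation_le_one_iff _).1 hv⟩, rfl, fun i => ?_⟩
  rw [← map_mul]
  congr 1
  apply h.injective
  rw [map_mul, h.comm, hδ, hδ', ← mul_assoc, ← map_mul, div_mul_cancel₀ _ hc]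

end Compare

end PrimitiveScaling

/-- `G` has the homogeneities of the equation of the double cover of a quadric bundle. -/
structure IsBundleForm {B₀ : Type} [CommRing B₀] (e : ℕ) (G : MvPolynomial (Fin 6) B₀) : Prop where
  smul_fibre : ∀ (R : Type) [CommRing R] (φ : B₀ →+* R) (c p q t x y z : R),
    MvPolynomial.eval₂ φ ![c * p, c * q, c * t, x, y, z] G =
      c ^ 2 * MvPolynomial.eval₂ φ ![p, q, t, x, y, z] G
  smul_base : ∀ (R : Type) [CommRing R] (φ : B₀ →+* R) (c p q t x y z : R),
    MvPolynomial.eval₂ φ ![c * p, c * q, t, c * x, c * y, c * z] G =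
      (c ^ (e + 2)) ^ 2 * MvPolynomial.eval₂ φ ![p, q, t, x, y, z] G

/-- Over `E`, the form `G` is the equation of the reference quadric bundle. -/
def ReducesToReference {B₀ E : Type} [CommRing B₀] [CommRing E] (e : ℕ)
    (G : MvPolynomial (Fin 6) B₀) (ψ : B₀ →+* E) : Prop :=
  ∀ (R : Type) [CommRing R] (φ : E →+* R) (p q t x y z : R),
    MvPolynomial.eval₂ (φ.comp ψ) ![p, q, t, x, y, z] G =
      (z ^ e) ^ 2 * (x * y * p ^ 2 + x * z * q ^ 2 + y * z * tangentConic x y z * t ^ 2)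

/-- A primitive scaling of the vector `v` reduces to a point over which the bundle is nonsplit. -/
def ReducesToNonSplit {K A D E : Type} [CommRing K] [CommRing A] [CommRing D] [CommRing E]
    (κ : K →+* A) (j : D →+* A) (ρ : D →+* E) (v : Fin 3 → A) : Prop :=
  ∃ c : K, c ≠ 0 ∧ ∃ δ : Fin 3 → D, (∀ k, j (δ k) = κ c * v k) ∧ NonSplitAt (fun k => ρ (δ k))

namespace PrimitiveScaling

open Polynomial

variable {K A D E : Type} [Field K] [CommRing A] [CommRing D] [Field E]
  {B : ValuationSubring K} {κ : K →+* A} {τ : B →+* D} {j : D →+* A} {ρ : D →+* E}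

theorem reducesToNonSplit_iff (h : PrimitiveScaling B κ τ j ρ) {v : Fin 3 → A} {c : K}
    {δ : Fin 3 → D} (hc : c ≠ 0) (hδ : ∀ k, j (δ k) = κ c * v k)
    (hprim : (fun k => ρ (δ k)) ≠ 0) :
    ReducesToNonSplit κ j ρ v ↔ NonSplitAt (fun k => ρ (δ k)) := by
  refine ⟨?_, fun hns => ⟨c, hc, δ, hδ, hns⟩⟩
  rintro ⟨c', hc', δ', hδ', hns⟩
  obtain ⟨b, -, hb⟩ := h.exists_smul hc hδ hδ' (h.valuation_le_one hc' hδ hprim hδ')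
  have hb0 : ρ (τ b) ≠ 0 := by
    intro h0
    apply hns.1
    change ρ (δ' 0) = 0
    rw [hb, h0, zero_mul]
  simp only [hb] at hns
  exact (nonSplitAt_smul hb0).1 hns

theorem reducesToNonSplit_coeff_iff [IsAlgClosed K] [CharZero E] (h : PrimitiveScaling B κ τ j ρ)
    {i : E} (hi : i ^ 2 = -1) {e : ℕ} {G : MvPolynomial (Fin 6) B} (hG : IsBundleForm e G)
    (hred : ReducesToReference e G (ρ.comp τ)) {s : Fin 3 → A[X]} {V : Fin 4 → A[X]} (hV : V ≠ 0)
    (hVs : V 0 ^ 2 = MvPolynomial.eval₂ ((C : A →+* A[X]).comp (κ.comp B.subtype))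
      ![V 1, V 2, V 3, s 0, s 1, s 2] G) {b : ℕ}
    (h0 : (fun k => (s k).coeff 0) ≠ 0) (hb : (fun k => (s k).coeff b) ≠ 0)
    (hbt : ∀ l > b, ∀ k, (s k).coeff l = 0) :
    ReducesToNonSplit κ j ρ (fun k => (s k).coeff 0) ↔
      ReducesToNonSplit κ j ρ (fun k => (s k).coeff b) := by
  classical
  have hsc : ∀ l, ∃ c : K, ∃ δ : Fin 3 → D, (fun k => (s k).coeff l) ≠ 0 → c ≠ 0 ∧
      (∀ k, j (δ k) = κ c * (s k).coeff l) ∧ (fun k => ρ (δ k)) ≠ 0 := by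
    intro l
    by_cases hl : (fun k => (s k).coeff l) = 0
    · exact ⟨0, 0, fun h => absurd hl h⟩
    · obtain ⟨c, hc, δ, h1, h2⟩ := h.exists_family hl
      exact ⟨c, δ, fun _ => ⟨hc, h1, h2⟩⟩
  choose cc dd hcd using hsc
  set J : Finset ℕ := (Finset.range (b + 1)).filter fun l => (fun k => (s k).coeff l) ≠ 0 with hJ
  have memJ : ∀ l, l ∈ J ↔ (fun k => (s k).coeff l) ≠ 0 := by
    intro l
    simp only [hJ, Finset.mem_filter, Finset.mem_range, and_iff_right_iff_imp]
    intro hl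
    by_contra! hlt
    exact hl (funext fun k => hbt l (by omega) k)
  refine newton_polygon_induction B.valuation cc J (fun l hl => (hcd l ((memJ l).1 hl)).1)
    (fun l => ReducesToNonSplit κ j ρ (fun k => (s k).coeff l)) ?_ ((memJ 0).2 h0) ((memJ b).2 hb)
    (fun l hl => by simp only [hJ, Finset.mem_filter, Finset.mem_range] at hl; omega)
  intro μ hμ lo hlo hi' hhi hmax heq hlt hgt
  -- rescale the variable
  set θ : A[X] →+* A[X] := compRingHom (C (κ μ) * X) with hθ
  have θcoeff : ∀ (P : A[X]) n, (θ P).coeff n = P.coeff n * κ μ ^ n := fun P n => by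
    simp [hθ]
  have hθC : θ.comp ((C : A →+* A[X]).comp (κ.comp B.subtype)) =
      (C : A →+* A[X]).comp (κ.comp B.subtype) := by
    ext x; simp [hθ]
  have κu : ∀ x : K, x ≠ 0 → IsUnit (κ x) := fun x hx => (isUnit_iff_ne_zero.2 hx).map κ
  have θinj : ∀ P, θ P = 0 → P = 0 := by
    intro P hP
    ext n
    have := congrArg (coeff · n) hP
    simp only [θcoeff, coeff_zero] at this
    simpa using (((κu μ hμ).pow n).mul_left_eq_zero).1 this
  have hVs1 : θ (V 0) ^ 2 = MvPolynomial.eval₂ ((C : A →+* A[X]).comp (κ.comp B.subtype))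
      ![θ (V 1), θ (V 2), θ (V 3), θ (s 0), θ (s 1), θ (s 2)] G := by
    rw [← map_pow, hVs, MvPolynomial.hom_eval₂, hθC]
    congr 1
    funext k
    fin_cases k <;> rfl
  -- primitive scaling of the base point
  have hs1 : (fun k => θ (s k)) ≠ 0 := by
    intro h1
    apply h0
    funext k
    have := θinj _ (congrFun h1 k)
    simp [this]
  obtain ⟨c, hc, δ, hδ, hδ0⟩ := h.polynomial.exists_family hs1
  have hVs2 : ((C (κ c)) ^ (e + 2) * θ (V 0)) ^ 2 =
      MvPolynomial.eval₂ ((C : A →+* A[X]).comp (κ.comp B.subtype))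
      ![C (κ c) * θ (V 1), C (κ c) * θ (V 2), θ (V 3), C (κ c) * θ (s 0), C (κ c) * θ (s 1),
        C (κ c) * θ (s 2)] G := by
    rw [hG.smul_base, mul_pow, hVs1]
  set V' : Fin 4 → A[X] := ![C (κ c) ^ (e + 2) * θ (V 0), C (κ c) * θ (V 1), C (κ c) * θ (V 2),
    θ (V 3)] with hV'
  have hCu : IsUnit (C (κ c) : A[X]) := (κu c hc).map C
  have hV'0 : V' ≠ 0 := by
    intro h1
    apply hV
    funext k
    apply θinj
    have h2 := congrFun h1 k
    fin_cases k
    · exact ((hCu.pow (e + 2)).mul_right_eq_zero).1 h2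
    · exact (hCu.mul_right_eq_zero).1 h2
    · exact (hCu.mul_right_eq_zero).1 h2
    · exact h2
  obtain ⟨c2, hc2, ε, hε, hε0⟩ := h.polynomial.exists_family hV'0
  simp only [RingHom.comp_apply] at hδ hε
  have hD : ε 0 ^ 2 = MvPolynomial.eval₂ ((C : D →+* D[X]).comp τ)
      ![ε 1, ε 2, ε 3, δ 0, δ 1, δ 2] G := by
    apply h.polynomial.injective
    have hcomp : (mapRingHom j).comp ((C : D →+* D[X]).comp τ) =
        (C : A →+* A[X]).comp (κ.comp B.subtype) := by
      ext x; simp [h.comm]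
    have hvec : (fun k => mapRingHom j (![ε 1, ε 2, ε 3, δ 0, δ 1, δ 2] k)) =
        ![C (κ c2) * V' 1, C (κ c2) * V' 2, C (κ c2) * V' 3, C (κ c) * θ (s 0), C (κ c) * θ (s 1),
          C (κ c) * θ (s 2)] := by
      rw [← hε 1, ← hε 2, ← hε 3, ← hδ 0, ← hδ 1, ← hδ 2]
      funext k
      fin_cases k <;> rfl
    rw [map_pow, hε 0, MvPolynomial.hom_eval₂, hcomp, hvec, hG.smul_fibre, mul_pow]
    congr 1
  have hE : IsBundlePoint e (fun k => mapRingHom ρ (δ k)) (fun k => mapRingHom ρ (ε k)) := by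
    have h1 := congrArg (mapRingHom ρ) hD
    have hcomp : (mapRingHom ρ).comp ((C : D →+* D[X]).comp τ) =
        (C : E →+* E[X]).comp (ρ.comp τ) := by
      ext x; simp
    have hvec : (fun k => mapRingHom ρ (![ε 1, ε 2, ε 3, δ 0, δ 1, δ 2] k)) =
        ![mapRingHom ρ (ε 1), mapRingHom ρ (ε 2), mapRingHom ρ (ε 3), mapRingHom ρ (δ 0),
          mapRingHom ρ (δ 1), mapRingHom ρ (δ 2)] := by
      funext k
      fin_cases k <;> rfl
    rw [map_pow, MvPolynomial.hom_eval₂, hcomp, hvec, hred] at h1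
    exact h1
  -- coefficients of the reduction
  have hcoef : ∀ l k, j ((δ k).coeff l) = κ (c * μ ^ l) * (s k).coeff l := by
    intro l k
    have := congrArg (coeff · l) (hδ k)
    simp only [coe_mapRingHom, coeff_map, coeff_C_mul, θcoeff] at this
    rw [this, map_mul, map_pow]
    ring
  have hprop : ∀ l ∈ J, B.valuation (c * μ ^ l / cc l) ≤ 1 ∧ ∃ b : B,
      (b : K) = c * μ ^ l / cc l ∧ ∀ k, ρ ((δ k).coeff l) = ρ (τ b) * ρ (dd l k) := by
    intro l hl
    obtain ⟨h1, h2, h3⟩ := hcd l ((memJ l).1 hl)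
    have hle := h.valuation_le_one (mul_ne_zero hc (pow_ne_zero l hμ)) h2 h3 (hcoef l)
    exact ⟨hle, h.exists_smul h1 h2 (hcoef l) hle⟩
  have hnJ : ∀ l, l ∉ J → ∀ k, ρ ((δ k).coeff l) = 0 := by
    intro l hl k
    rw [memJ, not_not] at hl
    have h2 : (δ k).coeff l = 0 := by
      apply h.injective
      rw [hcoef, map_zero, congrFun hl k]
      simp
    rw [h2, map_zero]
  have hsmall : ∀ l ∈ J, B.valuation (c * μ ^ l / cc l) < 1 → ∀ k, ρ ((δ k).coeff l) = 0 := by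
    intro l hl hlt k
    obtain ⟨-, b, hb, h1⟩ := hprop l hl
    rw [h1, h.map_nonunit, zero_mul]
    rw [B.valuation_eq_one_iff, hb]
    exact hlt.ne
  have hval : ∀ l, B.valuation (c * μ ^ l / cc l) = B.valuation c * B.valuation (μ ^ l / cc l) :=
    fun l => by rw [mul_div_assoc, map_mul]
  have hvc : 0 < B.valuation c := zero_lt_iff.2 ((B.valuation.ne_zero_iff).2 hc)
  have hlo1 : B.valuation (c * μ ^ lo / cc lo) = 1 := by
    refine le_antisymm (hprop lo hlo).1 ?_
    obtain ⟨k, hk⟩ := Function.ne_iff.1 hδ0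
    obtain ⟨l, hl⟩ : ∃ l, (mapRingHom ρ (δ k)).coeff l ≠ 0 := by
      by_contra! hall
      exact hk (Polynomial.ext hall)
    simp only [coe_mapRingHom, coeff_map] at hl
    have hlJ : l ∈ J := by
      by_contra hl'
      exact hl (hnJ l hl' k)
    by_contra! hlt1
    refine hl (hsmall l hlJ (lt_of_le_of_lt ?_ hlt1) k)
    rw [hval, hval]
    exact mul_le_mul_right (hmax l hlJ) _
  have hlt1 : ∀ l, B.valuation (μ ^ l / cc l) < B.valuation (μ ^ lo / cc lo) →
      B.valuation (c * μ ^ l / cc l) < 1 := by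
    intro l hl
    rw [← hlo1, hval, hval]
    exact (mul_lt_mul_iff_right₀ hvc).2 hl
  have hhi1 : B.valuation (c * μ ^ hi' / cc hi') = 1 := by
    rw [hval, heq, ← hval, hlo1]
  have hone : ∀ l ∈ J, B.valuation (c * μ ^ l / cc l) = 1 →
      (fun k => (mapRingHom ρ (δ k)).coeff l) ≠ 0 ∧
      (ReducesToNonSplit κ j ρ (fun k => (s k).coeff l) ↔
        NonSplitAt (fun k => (mapRingHom ρ (δ k)).coeff l)) := by
    intro l hl h1
    simp only [coe_mapRingHom, coeff_map]
    obtain ⟨h2, h3, h4⟩ := hcd l ((memJ l).1 hl)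
    obtain ⟨-, b, hb, h5⟩ := hprop l hl
    have hbu : IsUnit b := by rw [B.valuation_eq_one_iff, hb, h1]
    have hb0 : ρ (τ b) ≠ 0 := ((hbu.map τ).map ρ).ne_zero
    have hne : (fun k => ρ ((δ k).coeff l)) ≠ 0 := by
      intro h6
      apply h4
      funext k
      have := congrFun h6 k
      simp only [h5] at this
      exact (mul_eq_zero.1 this).resolve_left hb0
    exact ⟨hne, h.reducesToNonSplit_iff (mul_ne_zero hc (pow_ne_zero l hμ)) (hcoef l) hne⟩
  rw [(hone lo hlo hlo1).2, (hone hi' hhi hhi1).2]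
  refine IsBundlePoint.nonSplitAt_coeff_iff hi hε0 hE ?_ (hone lo hlo hlo1).1 ?_
    (hone hi' hhi hhi1).1
  · intro l hl k
    simp only [coe_mapRingHom, coeff_map]
    by_cases hlJ : l ∈ J
    · exact hsmall l hlJ (hlt1 l (hlt l hlJ hl)) k
    · exact hnJ l hlJ k
  · intro l hl k
    simp only [coe_mapRingHom, coeff_map]
    by_cases hlJ : l ∈ J
    · exact hsmall l hlJ (hlt1 l (hgt l hlJ hl)) k
    · exact hnJ l hlJ k

end PrimitiveScaling

section Ternary

open Polynomial

/-- The conic `a x² + b y² = z²` has no nontrivial solution. -/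
def ConicAnisotropic {S : Type} [CommRing S] (a b : S) : Prop :=
  ∀ x y z : S, a * x ^ 2 + b * y ^ 2 = z ^ 2 → x = 0 ∧ y = 0 ∧ z = 0

/-- The norm form on pure quaternions of `(a, b)`. -/
def pureForm {S : Type} [CommRing S] (a b x y z : S) : S := a * x ^ 2 + b * y ^ 2 - a * b * z ^ 2

theorem map_pureForm {S S' : Type} [CommRing S] [CommRing S'] (φ : S →+* S') (a b x y z : S) :
    φ (pureForm a b x y z) = pureForm (φ a) (φ b) (φ x) (φ y) (φ z) := by
  simp [pureForm]

theorem eq_zero_of_sq_eq_prime_mul_sq {R : Type} [CommRing R] [IsDomain R] {t g x y : R}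
    (htp : Prime t) (ht : ∀ r : R, r ≠ 0 → FiniteMultiplicity t r) (hg : ¬ t ∣ g)
    (h : x ^ 2 = t * g * y ^ 2) : x = 0 ∧ y = 0 := by
  by_contra hne
  have hv : (![x, y] : Fin 2 → R) ≠ 0 := fun h0 => hne ⟨congrFun h0 0, congrFun h0 1⟩
  obtain ⟨j, v', hv', i, hi⟩ := exists_primitive_scaling ht hv
  have hx := hv' 0
  have hy := hv' 1
  simp only [Matrix.cons_val_zero, Matrix.cons_val_one] at hx hy
  have h1 : v' 0 ^ 2 = t * g * v' 1 ^ 2 := by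
    apply mul_left_cancel₀ (pow_ne_zero 2 (pow_ne_zero j htp.ne_zero))
    rw [hx, hy] at h
    linear_combination h
  have h2 : t ∣ v' 0 := htp.dvd_of_dvd_pow (n := 2) ⟨g * v' 1 ^ 2, by rw [h1]; ring⟩
  obtain ⟨u, hu⟩ := h2
  have h3 : g * v' 1 ^ 2 = t * u ^ 2 := by
    apply mul_left_cancel₀ htp.ne_zero
    rw [hu] at h1
    linear_combination -h1
  have h4 : t ∣ v' 1 :=
    htp.dvd_of_dvd_pow ((htp.dvd_or_dvd (Dvd.intro _ h3.symm)).resolve_left hg)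
  fin_cases i
  · exact hi ⟨u, hu⟩
  · exact hi h4

namespace ConicAnisotropic

variable {S : Type} [CommRing S] [IsDomain S] {a b : S}

theorem left_ne_zero (h : ConicAnisotropic a b) : a ≠ 0 := by
  rintro rfl
  exact one_ne_zero (h 1 0 0 (by ring)).1

theorem right_ne_zero (h : ConicAnisotropic a b) : b ≠ 0 := by
  rintro rfl
  exact one_ne_zero (h 0 1 0 (by ring)).2.1

theorem pureForm (h : ConicAnisotropic a b) {x y z : S} (h0 : pureForm a b x y z = 0) :
    x = 0 ∧ y = 0 ∧ z = 0 := by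
  have ha := h.left_ne_zero
  have hb := h.right_ne_zero
  unfold _root_.pureForm at h0
  obtain ⟨h1, h2, h3⟩ := h (b * y) (a * x) (a * b * z) (by linear_combination a * b * h0)
  simpa [ha, hb] using And.intro h2 (And.intro h1 h3)

theorem polynomial (h : ConicAnisotropic a b) : ConicAnisotropic (C a : S[X]) (C b) := by
  intro x y z hxyz
  by_contra hne
  have hv : (![x, y, z] : Fin 3 → S[X]) ≠ 0 :=
    fun h0 => hne ⟨congrFun h0 0, congrFun h0 1, congrFun h0 2⟩
  have ht : ∀ r : S[X], r ≠ 0 → FiniteMultiplicity X r := fun r hr =>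
    Polynomial.finiteMultiplicity_of_degree_pos_of_monic (by simp) monic_X hr
  obtain ⟨j, v', hv', i, hi⟩ := exists_primitive_scaling ht hv
  have hx := hv' 0
  have hy := hv' 1
  have hz := hv' 2
  simp only [Matrix.cons_val_zero, Matrix.cons_val_one, Matrix.cons_val] at hx hy hz
  have h1 : C a * v' 0 ^ 2 + C b * v' 1 ^ 2 = v' 2 ^ 2 := by
    apply mul_left_cancel₀ (pow_ne_zero 2 (pow_ne_zero j (X_ne_zero (R := S))))
    rw [hx, hy, hz] at hxyz
    linear_combination hxyz
  have h2 := congrArg (eval 0) h1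
  simp only [eval_add, eval_mul, eval_C, eval_pow] at h2
  obtain ⟨h3, h4, h5⟩ := h _ _ _ h2
  apply hi
  rw [X_dvd_iff, coeff_zero_eq_eval_zero]
  fin_cases i
  exacts [h3, h4, h5]

theorem fractionRing (h : ConicAnisotropic a b) (F : Type) [Field F] [Algebra S F]
    [IsFractionRing S F] : ConicAnisotropic (algebraMap S F a) (algebraMap S F b) := by
  intro x y z hxyz
  obtain ⟨d, hd⟩ := IsLocalization.exist_integer_multiples_of_finite (nonZeroDivisors S)
    (![x, y, z] : Fin 3 → F)
  obtain ⟨x', hx⟩ := hd 0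
  obtain ⟨y', hy⟩ := hd 1
  obtain ⟨z', hz⟩ := hd 2
  simp only [Algebra.smul_def, Matrix.cons_val_zero, Matrix.cons_val_one, Matrix.cons_val] at hx hy hz
  change _ = algebraMap S F d * _ at hx hy hz
  have hd0 : algebraMap S F d ≠ 0 := by
    simp [nonZeroDivisors.ne_zero d.2]
  have h1 : a * x' ^ 2 + b * y' ^ 2 = z' ^ 2 := by
    apply IsFractionRing.injective S F
    simp only [map_add, map_mul, map_pow, hx, hy, hz]
    linear_combination algebraMap S F d ^ 2 * hxyz
  obtain ⟨rfl, rfl, rfl⟩ := h _ _ _ h1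
  simpa [hd0] using And.intro hx (And.intro hy hz)

end ConicAnisotropic

/-- The Cassels–Pfister theorem for the pure part of a quaternion norm form. -/
theorem exists_pureForm_polynomial {F : Type} [Field F] {a b : F} (hab : ConicAnisotropic a b)
    {h g x y z : F[X]} (hg : g ≠ 0) (hh : h * g ^ 2 = pureForm (C a) (C b) x y z) :
    ∃ x y z : F[X], h = pureForm (C a) (C b) x y z := by
  induction hn : g.natDegree using Nat.strong_induction_on generalizing g x y z with
  | _ n ih =>
  set x1 := x / g
  set x2 := x % g
  set y1 := y / g
  set y2 := y % g
  set z1 := z / g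
  set z2 := z % g
  have hx : g * x1 + x2 = x := EuclideanDomain.div_add_mod x g
  have hy : g * y1 + y2 = y := EuclideanDomain.div_add_mod y g
  have hz : g * z1 + z2 = z := EuclideanDomain.div_add_mod z g
  by_cases h2 : x2 = 0 ∧ y2 = 0 ∧ z2 = 0
  · obtain ⟨h2, h3, h4⟩ := h2
    refine ⟨x1, y1, z1, ?_⟩
    apply mul_right_cancel₀ (pow_ne_zero 2 hg)
    rw [hh, ← hx, ← hy, ← hz, h2, h3, h4]
    simp only [pureForm]
    ring
  · have hr : pureForm (C a) (C b) x2 y2 z2 ≠ 0 := fun h0 => h2 (hab.polynomial.pureForm h0)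
    -- reflect `(g, x, y, z)` along `(1, x1, y1, z1)`
    set N := h - pureForm (C a) (C b) x1 y1 z1 with hN
    set P := h * g - (C a * x * x1 + C b * y * y1 - C a * C b * z * z1) with hP
    set g' := N * g - 2 * P with hg'
    have key : g * g' = - pureForm (C a) (C b) x2 y2 z2 := by
      have e1 : x2 = x - g * x1 := by rw [← hx]; ring
      have e2 : y2 = y - g * y1 := by rw [← hy]; ring
      have e3 : z2 = z - g * z1 := by rw [← hz]; ring
      rw [hg', hP, hN, e1, e2, e3]
      simp only [pureForm] at hh ⊢
      linear_combination -hh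
    have hg'0 : g' ≠ 0 := by
      rintro h0
      rw [h0, mul_zero] at key
      exact hr (neg_eq_zero.1 key.symm)
    have hdeg : g'.natDegree < n := by
      by_cases hg0 : g.natDegree = 0
      · exfalso
        obtain ⟨c, hc⟩ := natDegree_eq_zero.1 hg0
        have hu : IsUnit g := by
          rw [← hc, isUnit_C, isUnit_iff_ne_zero]
          rintro rfl
          exact hg (by rw [← hc, C_0])
        exact h2 ⟨(EuclideanDomain.mod_eq_zero).2 hu.dvd, (EuclideanDomain.mod_eq_zero).2 hu.dvd,
          (EuclideanDomain.mod_eq_zero).2 hu.dvd⟩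
      have hlt : ∀ u : F[X], (u % g).natDegree < g.natDegree := fun u =>
        natDegree_mod_lt u hg0
      have h3 := congrArg natDegree key
      rw [natDegree_mul hg hg'0, natDegree_neg] at h3
      have hsq : ∀ (c : F) (u : F[X]), (C c * (u % g) ^ 2).natDegree ≤ 2 * (g.natDegree - 1) := by
        intro c u
        refine (natDegree_C_mul_le _ _).trans (natDegree_pow_le.trans ?_)
        have := hlt u
        gcongr
        omega
      have h4 : (pureForm (C a) (C b) x2 y2 z2).natDegree ≤ 2 * (g.natDegree - 1) := by
        refine (natDegree_sub_le _ _).trans (max_le ((natDegree_add_le _ _).trans (max_le ?_ ?_)) ?_)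
        · exact hsq a x
        · exact hsq b y
        · rw [← C_mul]; exact hsq (a * b) z
      omega
    refine ih g'.natDegree hdeg (x := N * x - 2 * P * x1) (y := N * y - 2 * P * y1)
      (z := N * z - 2 * P * z1) hg'0 ?_ rfl
    have hNP : N = h - pureForm (C a) (C b) x1 y1 z1 := hN
    simp only [pureForm] at hh hNP ⊢
    rw [hg']
    linear_combination N ^ 2 * hh + (4 * P ^ 2) * (-hNP) + 4 * P * N * hP
end Ternary

section Nonsplit

open Polynomial

theorem pureForm_polynomial_linear {F : Type} [Field F] [CharZero F] {a b p r : F}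
    (hab : ConicAnisotropic a b) {x y z : F[X]}
    (h : C p + C r * X ^ 2 = pureForm (C a) (C b) x y z) :
    ∃ x0 x1 y0 y1 z0 z1 : F, pureForm a b x0 y0 z0 = p ∧ pureForm a b x1 y1 z1 = r ∧
      a * x0 * x1 + b * y0 * y1 - a * b * z0 * z1 = 0 := by
  set N := max (max x.natDegree y.natDegree) z.natDegree with hN
  have hx : x.natDegree ≤ N := by omega
  have hy : y.natDegree ≤ N := by omega
  have hz : z.natDegree ≤ N := by omega
  have hN1 : N ≤ 1 := by
    by_contra! hlt
    have h1 := congrArg (coeff · (2 * N)) h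
    simp only [pureForm, coeff_add, coeff_sub, ← C_mul, coeff_C_mul,
      coeff_pow_of_natDegree_le hx, coeff_pow_of_natDegree_le hy,
      coeff_pow_of_natDegree_le hz] at h1
    rw [coeff_C_of_ne_zero (by omega), coeff_X_pow, if_neg (by omega), mul_zero, zero_add] at h1
    obtain ⟨h2, h3, h4⟩ := hab.pureForm h1.symm
    rcases max_choice (max x.natDegree y.natDegree) z.natDegree with h5 | h5
    · rcases max_choice x.natDegree y.natDegree with h6 | h6
      · rw [hN, h5, h6, coeff_natDegree, leadingCoeff_eq_zero] at h2
        rw [hN, h5, h6, h2, natDegree_zero] at hlt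
        omega
      · rw [hN, h5, h6, coeff_natDegree, leadingCoeff_eq_zero] at h3
        rw [hN, h5, h6, h3, natDegree_zero] at hlt
        omega
    · rw [hN, h5, coeff_natDegree, leadingCoeff_eq_zero] at h4
      rw [hN, h5, h4, natDegree_zero] at hlt
      omega
  have lin : ∀ u : F[X], u.natDegree ≤ N → u = C (u.coeff 1) * X + C (u.coeff 0) := fun u hu =>
    eq_X_add_C_of_natDegree_le_one (hu.trans hN1)
  rw [lin x hx, lin y hy, lin z hz] at h
  generalize x.coeff 0 = x0, x.coeff 1 = x1, y.coeff 0 = y0, y.coeff 1 = y1, z.coeff 0 = z0,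
    z.coeff 1 = z1 at h
  have h' : C p + C 0 * X + C r * X ^ 2 = C (pureForm a b x0 y0 z0) +
      C (2 * (a * x0 * x1 + b * y0 * y1 - a * b * z0 * z1)) * X +
      C (pureForm a b x1 y1 z1) * X ^ 2 := by
    rw [C_0, zero_mul, add_zero, h]
    simp only [pureForm, C_add, C_mul, C_sub, C_pow, C_ofNat]
    ring
  have e0 := congrArg (coeff · 0) h'
  have e1 := congrArg (coeff · 1) h'
  have e2 := congrArg (coeff · 2) h'
  simp [coeff_X, coeff_C] at e0 e1 e2
  exact ⟨x0, x1, y0, y1, z0, z1, e0.symm, e2.symm, e1⟩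

theorem exists_orthogonal_pair {S : Type} [CommRing S] [IsDomain S] [CharZero S] {a b p r : S}
    (hab : ConicAnisotropic a b) {g x y z : S[X]} (hg : g ≠ 0)
    (hh : (C p + C r * X ^ 2) * g ^ 2 = pureForm (C a) (C b) x y z) :
    ∃ D x0 x1 y0 y1 z0 z1 : S, D ≠ 0 ∧ pureForm a b x0 y0 z0 = D ^ 2 * p ∧
      pureForm a b x1 y1 z1 = D ^ 2 * r ∧ a * x0 * x1 + b * y0 * y1 - a * b * z0 * z1 = 0 := by
  obtain ⟨F, hF, hSF, hfr⟩ : ∃ (F : Type) (_ : Field F) (_ : Algebra S F), IsFractionRing S F :=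
    ⟨FractionRing S, inferInstance, inferInstance, inferInstance⟩
  have ιinj : Function.Injective (algebraMap S F) := IsFractionRing.injective S _
  have hab' := hab.fractionRing F
  have : CharZero F := charZero_of_injective_algebraMap ιinj
  have h1 := congrArg (mapRingHom (algebraMap S F)) hh
  rw [map_pureForm] at h1
  simp only [map_mul, map_add, map_pow, coe_mapRingHom, map_C, map_X] at h1
  obtain ⟨x', y', z', h2⟩ := exists_pureForm_polynomial hab' (g := g.map (algebraMap S F))
    ((Polynomial.map_ne_zero_iff ιinj).2 hg) h1
  obtain ⟨x0, x1, y0, y1, z0, z1, h3, h4, h5⟩ := pureForm_polynomial_linear hab' h2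
  obtain ⟨d, hd⟩ := IsLocalization.exist_integer_multiples_of_finite (nonZeroDivisors S)
    (![x0, x1, y0, y1, z0, z1] : Fin 6 → F)
  have hd' : ∀ i, ∃ s, algebraMap S F s = algebraMap S F d *
      (![x0, x1, y0, y1, z0, z1] : Fin 6 → F) i := by
    intro i
    obtain ⟨s, hs⟩ := hd i
    exact ⟨s, hs.trans (Algebra.smul_def _ _)⟩
  choose s hs using hd'
  have hX0 : algebraMap S F (s 0) = algebraMap S F d * x0 := hs 0
  have hX1 : algebraMap S F (s 1) = algebraMap S F d * x1 := hs 1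
  have hY0 : algebraMap S F (s 2) = algebraMap S F d * y0 := hs 2
  have hY1 : algebraMap S F (s 3) = algebraMap S F d * y1 := hs 3
  have hZ0 : algebraMap S F (s 4) = algebraMap S F d * z0 := hs 4
  have hZ1 : algebraMap S F (s 5) = algebraMap S F d * z1 := hs 5
  refine ⟨d, s 0, s 1, s 2, s 3, s 4, s 5, nonZeroDivisors.ne_zero d.2, ?_, ?_, ?_⟩ <;> apply ιinj
  · rw [map_pureForm, map_mul, map_pow, hX0, hY0, hZ0, ← h3]
    simp only [pureForm]
    ring
  · rw [map_pureForm, map_mul, map_pow, hX1, hY1, hZ1, ← h4]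
    simp only [pureForm]
    ring
  · simp only [map_add, map_sub, map_mul, map_zero, hX0, hY0, hZ0, hX1, hY1, hZ1]
    linear_combination algebraMap S F d ^ 2 * h5

theorem exists_conic_of_normRep_zero {R : Type} [CommRing R] {a b : R}
    (h : NormRep a b 0) : ∃ x y z : R, a * x ^ 2 + b * y ^ 2 = z ^ 2 ∧ ¬ (x = 0 ∧ y = 0 ∧ z = 0) := by
  obtain ⟨z, x, y, w, c, -, hne, h⟩ := h
  unfold normForm at h
  by_cases h1 : y ^ 2 - a * w ^ 2 = 0
  · by_cases h2 : y = 0 ∧ w = 0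
    · refine ⟨x, 0, z, ?_, fun h3 => hne ⟨h3.2.2, h3.1, h2⟩⟩
      rw [h2.1, h2.2] at h
      linear_combination -h
    · exact ⟨w, 0, y, by linear_combination -h1, fun h3 => h2 ⟨h3.2.2, h3.1⟩⟩
  · refine ⟨z * w + x * y, y ^ 2 - a * w ^ 2, z * y + a * x * w, ?_, fun h3 => h1 h3.2.1⟩
    linear_combination -(y ^ 2 - a * w ^ 2) * h

theorem exists_pureForm_of_quadraticAlgebra {T : Type} [CommRing T] [IsDomain T] [CharZero T]
    {a b h : T} (hab : ConicAnisotropic a b) {x y z : QuadraticAlgebra T h 0}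
    (hxyz : algebraMap T (QuadraticAlgebra T h 0) a * x ^ 2 +
      algebraMap T (QuadraticAlgebra T h 0) b * y ^ 2 = z ^ 2) (hne : ¬ (x = 0 ∧ y = 0 ∧ z = 0)) :
    ∃ g x y z : T, g ≠ 0 ∧ h * g ^ 2 = pureForm a b x y z := by
  have hre := congrArg QuadraticAlgebra.re hxyz
  have him := congrArg QuadraticAlgebra.im hxyz
  obtain ⟨x0, x1⟩ := x
  obtain ⟨y0, y1⟩ := y
  obtain ⟨z0, z1⟩ := z
  simp [pow_two] at hre him
  have h2 : a * x0 * x1 + b * y0 * y1 - z0 * z1 = 0 := by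
    have : (2 : T) * (a * x0 * x1 + b * y0 * y1 - z0 * z1) = 0 := by linear_combination him
    simpa using this
  refine ⟨a * x1 ^ 2 + b * y1 ^ 2 - z1 ^ 2, x0 * z1 - z0 * x1, y0 * z1 - z0 * y1,
    x0 * y1 - x1 * y0, ?_, ?_⟩
  · intro h3
    obtain ⟨rfl, rfl, rfl⟩ := hab x1 y1 z1 (by linear_combination h3)
    obtain ⟨rfl, rfl, rfl⟩ := hab x0 y0 z0 (by linear_combination hre)
    exact hne ⟨rfl, rfl, rfl⟩
  · simp only [pureForm]
    linear_combination (a * x1 ^ 2 + b * y1 ^ 2 - z1 ^ 2) * hre -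
      (a * x0 * x1 + b * y0 * y1 - z0 * z1) * h2

end Nonsplit

noncomputable section Generic

open Polynomial

theorem finiteMultiplicity_X_sub_C {R : Type} [CommRing R] [IsDomain R] (a : R) :
    ∀ r : R[X], r ≠ 0 → FiniteMultiplicity (X - C a) r := fun _ hr =>
  finiteMultiplicity_of_degree_pos_of_monic (by rw [degree_X_sub_C]; exact one_pos)
    (monic_X_sub_C a) hr

theorem conicAnisotropic_indeterminates (k : Type) [Field k] :
    ConicAnisotropic (X : k[X][X]) (C X) := by
  have hX : ∀ u v : k[X], u ^ 2 = X * v ^ 2 → u = 0 ∧ v = 0 := by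
    intro u v h
    refine eq_zero_of_sq_eq_prime_mul_sq (g := 1) (prime_X_sub_C (0 : k))
      (finiteMultiplicity_X_sub_C 0) ?_ (by rw [C_0, sub_zero, mul_one]; exact h)
    rw [dvd_iff_isRoot]
    simp
  intro x y z h
  have := eq_zero_of_sq_sub_mul_sq (t := (X : k[X][X]) - C 0) (r := C X) (g := 1) (x := z) (y := y)
    (z := x) (w := 0) (prime_X_sub_C 0) (finiteMultiplicity_X_sub_C 0) ?_ ?_ ?_
  · exact ⟨this.2.2.1, this.2.1, this.1⟩
  · intro u v huv
    simp only [dvd_iff_isRoot, IsRoot, eval_sub, eval_pow, eval_mul, eval_C] at huv ⊢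
    exact hX _ _ (by linear_combination huv)
  · rw [dvd_iff_isRoot]
    simp
  · rw [C_0]
    linear_combination -h

theorem not_isSquare_tangentConic {k : Type} [Field k] [CharZero k] (u v : k[X][X])
    (h : u ^ 2 = C X ^ 2 * tangentConic (X : k[X][X]) (C X ^ 2) 1 * v ^ 2) : u = 0 ∧ v = 0 := by
  refine eq_zero_of_sq_eq_prime_mul_sq (t := (X : k[X][X]) - C ((X + 1) ^ 2))
    (g := C X ^ 2 * (X - C ((X - 1) ^ 2))) (prime_X_sub_C _) (finiteMultiplicity_X_sub_C _) ?_ ?_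
  · rw [dvd_iff_isRoot]
    simp only [IsRoot, eval_mul, eval_pow, eval_C, eval_sub, eval_X]
    have : (X : k[X]) ^ 2 * ((X + 1) ^ 2 - (X - 1) ^ 2) = C 4 * X ^ 3 := by
      rw [C_ofNat]
      ring
    rw [this]
    exact mul_ne_zero (C_ne_zero.2 (by norm_num)) (pow_ne_zero _ X_ne_zero)
  · rw [h]
    simp only [tangentConic, map_pow, map_add, map_sub, map_one]
    ring

theorem eq_zero_of_orthogonal_pair {R : Type} [CommRing R] [IsDomain R]
    {t g p r x η D x0 x1 y0 y1 z0 z1 : R} (htp : Prime t)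
    (ht : ∀ a : R, a ≠ 0 → FiniteMultiplicity t a)
    (han : ∀ u v : R, t ∣ u ^ 2 - r * v ^ 2 → t ∣ u ∧ t ∣ v) (hg : ¬ t ∣ g) (hp : p = t * g)
    (hη0 : η ≠ 0) (hx0 : x ≠ 0) (hD : D ≠ 0)
    (h0 : pureForm x (η ^ 2) x0 y0 z0 = D ^ 2 * p) (h1 : pureForm x (η ^ 2) x1 y1 z1 = D ^ 2 * r)
    (h2 : x * x0 * x1 + η ^ 2 * y0 * y1 - x * η ^ 2 * z0 * z1 = 0) : p = 0 ∨ r = 0 := by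
  simp only [pureForm] at h0 h1
  have e2 : (x * η * (x1 - η * z1)) ^ 2 * (D ^ 2 * p) + (x * η * (x0 - η * z0)) ^ 2 * (D ^ 2 * r) =
      (x * η ^ 2 * (y0 * x1 - x0 * y1 + η * (z0 * y1 - y0 * z1))) ^ 2 := by
    rw [← h0, ← h1]
    linear_combination (2 * x ^ 2 * η ^ 2 * (x0 - η * z0) * (x1 - η * z1)) * h2
  have key := eq_zero_of_sq_sub_mul_sq (r := r)
    (x := x * η ^ 2 * (y0 * x1 - x0 * y1 + η * (z0 * y1 - y0 * z1)))
    (y := D * (x * η * (x0 - η * z0))) (z := D * (x * η * (x1 - η * z1))) (w := 0) htp ht han hg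
    (by rw [← hp]; linear_combination -e2)
  obtain ⟨-, h3, h4, -⟩ := key
  have h5 : x0 = η * z0 := by
    have := (mul_eq_zero.1 h3).resolve_left hD
    exact sub_eq_zero.1 ((mul_eq_zero.1 this).resolve_left (mul_ne_zero hx0 hη0))
  have h6 : x1 = η * z1 := by
    have := (mul_eq_zero.1 h4).resolve_left hD
    exact sub_eq_zero.1 ((mul_eq_zero.1 this).resolve_left (mul_ne_zero hx0 hη0))
  rw [h5, h6] at h2
  have h7 : η ^ 2 * (y0 * y1) = 0 := by linear_combination h2
  have h8 := (mul_eq_zero.1 h7).resolve_left (pow_ne_zero 2 hη0)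
  rcases mul_eq_zero.1 h8 with h9 | h9
  · left
    refine (mul_eq_zero.1 (?_ : D ^ 2 * p = 0)).resolve_left (pow_ne_zero 2 hD)
    rw [← h0, h5, h9]
    ring
  · right
    refine (mul_eq_zero.1 (?_ : D ^ 2 * r = 0)).resolve_left (pow_ne_zero 2 hD)
    rw [← h1, h6, h9]
    ring

theorem not_exists_orthogonal_pair {k : Type} [Field k] [CharZero k] {i : k} (hi : i ^ 2 = -1)
    {η x D x0 x1 y0 y1 z0 z1 : k[X][X][X]} (hη : η = C (C X)) (hx : x = C X) (hD : D ≠ 0)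
    (h0 : pureForm x (η ^ 2) x0 y0 z0 = D ^ 2 * (x * (η ^ 2 + X ^ 2)))
    (h1 : pureForm x (η ^ 2) x1 y1 z1 = D ^ 2 * (η ^ 2 * tangentConic x (η ^ 2) 1))
    (h2 : x * x0 * x1 + η ^ 2 * y0 * y1 - x * η ^ 2 * z0 * z1 = 0) : False := by
  have hη0 : η ≠ 0 := hη ▸ C_ne_zero.2 (C_ne_zero.2 X_ne_zero)
  have hx0 : x ≠ 0 := hx ▸ C_ne_zero.2 X_ne_zero
  obtain ⟨I, hI⟩ : ∃ I : k[X][X], I = C (C i * X) := ⟨_, rfl⟩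
  have hI2 : (C I) ^ 2 = - η ^ 2 := by
    rw [hI, hη]
    simp only [← C_pow, mul_pow, hi]
    simp
  have han : ∀ u v : k[X][X][X], X - C I ∣ u ^ 2 - η ^ 2 * tangentConic x (η ^ 2) 1 * v ^ 2 →
      X - C I ∣ u ∧ X - C I ∣ v := by
    intro u v huv
    simp only [dvd_iff_isRoot, IsRoot, eval_sub, eval_pow, eval_mul] at huv ⊢
    apply not_isSquare_tangentConic
    rw [hx, hη] at huv
    simp only [tangentConic, eval_C, eval_sub, eval_add, eval_mul, eval_pow, eval_one,
      eval_ofNat] at huv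
    simp only [tangentConic]
    linear_combination huv
  have hg : ¬ X - C I ∣ x * (X + C I) := by
    rw [dvd_iff_isRoot]
    simp only [IsRoot, eval_mul, eval_add, eval_X, hx, eval_C]
    refine mul_ne_zero X_ne_zero ?_
    rw [hI, ← two_mul]
    refine mul_ne_zero two_ne_zero (C_ne_zero.2 (mul_ne_zero (C_ne_zero.2 ?_) X_ne_zero))
    rintro rfl
    norm_num at hi
  rcases eq_zero_of_orthogonal_pair (prime_X_sub_C I) (finiteMultiplicity_X_sub_C I) han hg
    (by linear_combination x * hI2) hη0 hx0 hD h0 h1 h2 with h | h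
  · refine mul_ne_zero hx0 (fun h9 => ?_) h
    have := congrArg (eval 0) h9
    simp [hη] at this
  · refine mul_ne_zero (pow_ne_zero 2 hη0) (fun h9 => ?_) h
    have := congrArg (fun u => eval 0 (eval 0 (eval 0 u))) h9
    simp [hx, hη, tangentConic] at this

theorem exists_orthogonal_pair_of_normRep {S : Type} [CommRing S] [IsDomain S] [CharZero S]
    {a b p r : S} {h : S[X]} (hh : h = C p + C r * X ^ 2) (hab : ConicAnisotropic a b)
    (hrep : NormRep (algebraMap S[X] (QuadraticAlgebra S[X] h 0) (C a))
      (algebraMap S[X] (QuadraticAlgebra S[X] h 0) (C b)) 0) :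
    ∃ D x0 x1 y0 y1 z0 z1 : S, D ≠ 0 ∧ pureForm a b x0 y0 z0 = D ^ 2 * p ∧
      pureForm a b x1 y1 z1 = D ^ 2 * r ∧ a * x0 * x1 + b * y0 * y1 - a * b * z0 * z1 = 0 := by
  obtain ⟨x, y, z, h1, h2⟩ := exists_conic_of_normRep_zero hrep
  obtain ⟨g, x, y, z, hg, h3⟩ := exists_pureForm_of_quadraticAlgebra hab.polynomial h1 h2
  rw [hh] at h3
  exact exists_orthogonal_pair hab hg h3

theorem leadingCoeff_C_mul_tangentConic (k : Type) [Field k] :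
    (C X * tangentConic (X : k[X][X]) (C X) 1).leadingCoeff = X := by
  have h1 : C X * tangentConic (X : k[X][X]) (C X) 1 =
      C X * X ^ 2 + C (X * (-2 * X - 2)) * X + C (X * (X - 1) ^ 2) := by
    simp only [tangentConic, map_mul, map_sub, map_pow, map_one, map_neg, map_ofNat]
    ring
  rw [h1, leadingCoeff_quadratic X_ne_zero]

theorem eq_zero_of_sq_eq_C_mul_tangentConic_mul_sq {k : Type} [Field k] {u v : k[X][X]}
    (h : u ^ 2 = C X * tangentConic (X : k[X][X]) (C X) 1 * v ^ 2) : v = 0 := by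
  have h1 := congrArg leadingCoeff h
  rw [leadingCoeff_mul, leadingCoeff_pow, leadingCoeff_pow, leadingCoeff_C_mul_tangentConic] at h1
  refine leadingCoeff_eq_zero.1 (eq_zero_of_sq_eq_prime_mul_sq (g := 1) (prime_X_sub_C (0 : k))
    (finiteMultiplicity_X_sub_C 0) ?_ (by rw [C_0, sub_zero, mul_one]; exact h1)).2
  rw [dvd_iff_isRoot]
  simp

theorem eq_zero_of_sq_eq_mul_tangentConic_mul_sq {k : Type} [Field k] {x y u v : k[X][X][X]}
    (hx : x = C X) (hy : y = C (C X)) (h : u ^ 2 = y * tangentConic x y 1 * v ^ 2) : v = 0 := by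
  have h1 := congrArg leadingCoeff h
  have h2 : y * tangentConic x y 1 = C (C X * tangentConic (X : k[X][X]) (C X) 1) := by
    rw [map_mul, hx, hy]
    simp only [tangentConic, map_mul, map_add, map_sub, map_pow, map_one, map_ofNat]
  rw [h2, leadingCoeff_mul, leadingCoeff_pow, leadingCoeff_pow, leadingCoeff_C] at h1
  exact leadingCoeff_eq_zero.1 (eq_zero_of_sq_eq_C_mul_tangentConic_mul_sq h1)

/-- Coordinates `x`, `y` on a chart of `ℙ²` and `b` on the fibre. -/
def CoordRing (R : Type) [CommRing R] : Type := R[X][X][X]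

namespace CoordRing

instance (R : Type) [CommRing R] : CommRing (CoordRing R) := inferInstanceAs (CommRing R[X][X][X])

instance (R : Type) [CommRing R] [IsDomain R] : IsDomain (CoordRing R) :=
  inferInstanceAs (IsDomain R[X][X][X])

instance (R : Type) [CommRing R] [CharZero R] : CharZero (CoordRing R) :=
  inferInstanceAs (CharZero R[X][X][X])

/-- The constants. -/
def const (R : Type) [CommRing R] : R →+* CoordRing R :=
  ((C : R[X][X] →+* R[X][X][X]).comp (C : R[X] →+* R[X][X])).comp (C : R →+* R[X])

/-- The first coordinate on the base. -/
def x (R : Type) [CommRing R] : CoordRing R := (C X : R[X][X][X])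

/-- The second coordinate on the base. -/
def y (R : Type) [CommRing R] : CoordRing R := (C (C X) : R[X][X][X])

/-- The coordinate on the fibre. -/
def b (R : Type) [CommRing R] : CoordRing R := (X : R[X][X][X])

/-- Functoriality in the ring of constants. -/
def map {R R' : Type} [CommRing R] [CommRing R'] (φ : R →+* R') : CoordRing R →+* CoordRing R' :=
  (mapRingHom (mapRingHom (mapRingHom φ)) : R[X][X][X] →+* R'[X][X][X])

variable {R R' : Type} [CommRing R] [CommRing R'] (φ : R →+* R')

theorem map_const (r : R) : map φ (const R r) = const R' (φ r) := by
  have h : (mapRingHom (mapRingHom (mapRingHom φ)) : R[X][X][X] →+* R'[X][X][X]) (C (C (C r))) =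
      C (C (C (φ r))) := by simp
  exact h

theorem map_x : map φ (x R) = x R' := by
  have h : (mapRingHom (mapRingHom (mapRingHom φ)) : R[X][X][X] →+* R'[X][X][X]) (C X) = C X := by
    simp
  exact h

theorem map_y : map φ (y R) = y R' := by
  have h : (mapRingHom (mapRingHom (mapRingHom φ)) : R[X][X][X] →+* R'[X][X][X]) (C (C X)) = C (C X) := by
    simp
  exact h

theorem map_b : map φ (b R) = b R' := by
  have h : (mapRingHom (mapRingHom (mapRingHom φ)) : R[X][X][X] →+* R'[X][X][X]) (X) = X := by
    simp
  exact h

variable {k : Type} [Field k]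

theorem conicAnisotropic : ConicAnisotropic (x k) (y k) :=
  (conicAnisotropic_indeterminates k).polynomial

theorem exists_map_y_eq_sq : ∃ φ : CoordRing k →+* CoordRing k, Function.Injective φ ∧
    φ (x k) = x k ∧ φ (y k) = y k ^ 2 ∧ φ (b k) = b k := by
  obtain ⟨φ, hφ⟩ : ∃ φ : k[X][X][X] →+* k[X][X][X],
      φ = mapRingHom (mapRingHom (expand k 2).toRingHom) := ⟨_, rfl⟩
  have hinj : Function.Injective φ := by
    rw [hφ]
    exact map_injective _ (map_injective _ (expand_injective two_pos))
  have hφx : φ (C X) = C X := by simp [hφ]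
  have hφy : φ (C (C X)) = C (C X) ^ 2 := by simp [hφ]
  have hφb : φ X = X := by simp [hφ]
  exact ⟨φ, hinj, hφx, hφy, hφb⟩

theorem no_orthogonal_pair [CharZero k] {i : k} (hi : i ^ 2 = -1)
    {D x0 x1 y0 y1 z0 z1 : CoordRing k} (hD : D ≠ 0)
    (h0 : pureForm (x k) (y k ^ 2) x0 y0 z0 = D ^ 2 * (x k * (y k ^ 2 + b k ^ 2)))
    (h1 : pureForm (x k) (y k ^ 2) x1 y1 z1 = D ^ 2 * (y k ^ 2 * tangentConic (x k) (y k ^ 2) 1))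
    (h2 : x k * x0 * x1 + y k ^ 2 * y0 * y1 - x k * y k ^ 2 * z0 * z1 = 0) : False :=
  not_exists_orthogonal_pair hi (η := (C (C X) : k[X][X][X])) (x := (C X : k[X][X][X])) rfl rfl hD
    h0 h1 h2

theorem not_normRep [CharZero k] {i : k} (hi : i ^ 2 = -1) {h : (CoordRing k)[X]}
    (hh : h = C (x k * (y k + b k ^ 2)) + C (y k * tangentConic (x k) (y k) 1) * X ^ 2) :
    ¬ NormRep (algebraMap _ (QuadraticAlgebra (CoordRing k)[X] h 0) (C (x k)))
      (algebraMap _ (QuadraticAlgebra (CoordRing k)[X] h 0) (C (y k))) 0 := by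
  intro hrep
  obtain ⟨D, x0, x1, y0, y1, z0, z1, hD, h0, h1, h2⟩ :=
    exists_orthogonal_pair_of_normRep hh conicAnisotropic hrep
  obtain ⟨φ, hinj, hφx, hφy, hφb⟩ := exists_map_y_eq_sq (k := k)
  replace h0 := congrArg φ h0
  replace h1 := congrArg φ h1
  replace h2 := congrArg φ h2
  rw [map_pureForm] at h0 h1
  simp only [map_mul, map_add, map_sub, map_pow, map_zero, map_tangentConic, map_one, hφx, hφy,
    hφb] at h0 h1 h2
  exact no_orthogonal_pair hi ((map_ne_zero_iff φ hinj).2 hD) h0 h1 h2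

theorem y_mul_tangentConic_ne_zero : y k * tangentConic (x k) (y k) 1 ≠ 0 := by
  have h : (C (C X * tangentConic (X : k[X][X]) (C X) 1) : k[X][X][X]) ≠ 0 := by
    rw [C_ne_zero, ← leadingCoeff_ne_zero, leadingCoeff_C_mul_tangentConic]
    exact X_ne_zero
  simp only [tangentConic, map_mul, map_add, map_sub, map_pow, map_one, map_ofNat] at h
  exact h

theorem sq_eq_y_mul_tangentConic_mul_sq {u v : CoordRing k}
    (h : u ^ 2 = y k * tangentConic (x k) (y k) 1 * v ^ 2) : v = 0 :=
  eq_zero_of_sq_eq_mul_tangentConic_mul_sq (k := k) (u := u) (v := v) (x := x k) (y := y k) rfl rfl h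

theorem not_isSquare {h : (CoordRing k)[X]}
    (hh : h = C (x k * (y k + b k ^ 2)) + C (y k * tangentConic (x k) (y k) 1) * X ^ 2)
    {u v : (CoordRing k)[X]} (huv : u ^ 2 = h * v ^ 2) : v = 0 := by
  have hr : y k * tangentConic (x k) (y k) 1 ≠ 0 := y_mul_tangentConic_ne_zero
  have h1 := congrArg leadingCoeff huv
  have hl : h.leadingCoeff = y k * tangentConic (x k) (y k) 1 := by
    rw [hh, add_comm, leadingCoeff_add_of_degree_lt', leadingCoeff_C_mul_X_pow]
    rw [degree_C_mul_X_pow _ hr]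
    exact degree_C_le.trans_lt (by norm_num)
  rw [leadingCoeff_mul, leadingCoeff_pow, leadingCoeff_pow, hl] at h1
  exact leadingCoeff_eq_zero.1 (sq_eq_y_mul_tangentConic_mul_sq h1)

end CoordRing

end Generic

noncomputable section DoubleCover

/-- The homomorphism between quadratic algebras given by a homomorphism of base rings. -/
def quadraticMap {T T' : Type} [CommRing T] [CommRing T'] (φ : T →+* T') {h : T} {h' : T'}
    (hφ : φ h = h') : QuadraticAlgebra T h 0 →+* QuadraticAlgebra T' h' 0 where
  toFun q := ⟨φ q.re, φ q.im⟩
  map_zero' := by ext <;> simp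
  map_one' := by
    ext
    · exact map_one φ
    · exact map_zero φ
  map_add' p q := by ext <;> simp
  map_mul' p q := by ext <;> simp [hφ]

theorem isDomain_quadraticAlgebra {T : Type} [CommRing T] [IsDomain T] {h : T}
    (hsq : ∀ u v : T, u ^ 2 = h * v ^ 2 → v = 0) : IsDomain (QuadraticAlgebra T h 0) := by
  have hnorm : ∀ q : QuadraticAlgebra T h 0, q.norm = 0 → q = 0 := by
    intro q hq
    rw [QuadraticAlgebra.norm_def] at hq
    have h2 : q.re ^ 2 = h * q.im ^ 2 := by linear_combination hq
    have h3 := hsq _ _ h2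
    have h4 : q.re = 0 := by simpa [h3] using h2
    ext
    · exact h4
    · exact h3
  have : NoZeroDivisors (QuadraticAlgebra T h 0) := ⟨fun {a b} hab => by
    have := congrArg QuadraticAlgebra.norm hab
    rw [map_mul, QuadraticAlgebra.norm_zero, mul_eq_zero] at this
    exact this.imp (hnorm a) (hnorm b)⟩
  exact NoZeroDivisors.to_isDomain _

theorem eq_zero_of_algebraMap_add_mul_omega {T : Type} [CommRing T] {h p q : T}
    (hpq : algebraMap T (QuadraticAlgebra T h 0) p + algebraMap T (QuadraticAlgebra T h 0) q *
      ⟨0, 1⟩ = 0) : p = 0 ∧ q = 0 :=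
  ⟨by simpa using congrArg QuadraticAlgebra.re hpq, by simpa using congrArg QuadraticAlgebra.im hpq⟩

namespace PrimitiveScaling

variable {K A D E : Type} [Field K] [CommRing A] [CommRing D] [CommRing E]
  {B : ValuationSubring K} {κ : K →+* A} {τ : B →+* D} {j : D →+* A} {ρ : D →+* E}

theorem quadraticMap (h : PrimitiveScaling B κ τ j ρ) {a : A} {b : D} {c : E} (hj : j b = a)
    (hρ : ρ b = c) : PrimitiveScaling B ((algebraMap A (QuadraticAlgebra A a 0)).comp κ)
      ((algebraMap D (QuadraticAlgebra D b 0)).comp τ) (_root_.quadraticMap j hj)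
      (_root_.quadraticMap ρ hρ) where
  injective p q hpq := by
    have h1 := congrArg QuadraticAlgebra.re hpq
    have h2 := congrArg QuadraticAlgebra.im hpq
    ext
    · exact h.injective h1
    · exact h.injective h2
  comm b := by
    ext
    · simp [_root_.quadraticMap, h.comm]
    · simp [_root_.quadraticMap]
  map_nonunit b hb := by
    ext
    · simp [_root_.quadraticMap, h.map_nonunit b hb]
    · simp [_root_.quadraticMap]
  exists_scaling S hS := by
    classical
    obtain ⟨q, hq, hq0⟩ := hS
    obtain ⟨c, hc, h1, r, hr, δ, h2, h3⟩ := h.exists_scaling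
      (S.image QuadraticAlgebra.re ∪ S.image QuadraticAlgebra.im) (by
        by_contra! hne
        apply hq0
        ext
        · exact hne _ (Finset.mem_union_left _ (Finset.mem_image_of_mem _ hq))
        · exact hne _ (Finset.mem_union_right _ (Finset.mem_image_of_mem _ hq)))
    have key : ∀ q ∈ S, ∃ p, _root_.quadraticMap j hj p =
        (algebraMap A (QuadraticAlgebra A a 0)).comp κ c * q := by
      intro q hq
      obtain ⟨δ1, hδ1⟩ := h1 _ (Finset.mem_union_left _ (Finset.mem_image_of_mem _ hq))
      obtain ⟨δ2, hδ2⟩ := h1 _ (Finset.mem_union_right _ (Finset.mem_image_of_mem _ hq))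
      refine ⟨⟨δ1, δ2⟩, ?_⟩
      ext
      · simp [_root_.quadraticMap, hδ1]
      · simp [_root_.quadraticMap, hδ2]
    refine ⟨c, hc, key, ?_⟩
    rcases Finset.mem_union.1 hr with hr | hr
    · obtain ⟨q, hq, rfl⟩ := Finset.mem_image.1 hr
      obtain ⟨p, hp⟩ := key q hq
      refine ⟨q, hq, p, hp, fun h0 => h3 ?_⟩
      have h4 := congrArg QuadraticAlgebra.re hp
      simp [_root_.quadraticMap] at h4
      rw [h.injective (h2.trans h4.symm)]
      simpa [_root_.quadraticMap] using congrArg QuadraticAlgebra.re h0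
    · obtain ⟨q, hq, rfl⟩ := Finset.mem_image.1 hr
      obtain ⟨p, hp⟩ := key q hq
      refine ⟨q, hq, p, hp, fun h0 => h3 ?_⟩
      have h4 := congrArg QuadraticAlgebra.im hp
      simp [_root_.quadraticMap] at h4
      rw [h.injective (h2.trans h4.symm)]
      simpa [_root_.quadraticMap] using congrArg QuadraticAlgebra.im h0

open Polynomial in
theorem coordRing (h : PrimitiveScaling B κ τ j ρ) :
    PrimitiveScaling B ((CoordRing.const A).comp κ) ((CoordRing.const D).comp τ) (CoordRing.map j)
      (CoordRing.map ρ) :=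
  h.polynomial.polynomial.polynomial

end PrimitiveScaling

namespace CoordRing

open Polynomial

variable {R S : Type} [CommRing R] [CommRing S]

theorem exists_lift (φ : R →+* S) (sx sy sb : S) : ∃ f : CoordRing R →+* S,
    f.comp (const R) = φ ∧ f (x R) = sx ∧ f (y R) = sy ∧ f (b R) = sb := by
  obtain ⟨f, hf⟩ : ∃ f : R[X][X][X] →+* S,
      f = eval₂RingHom (eval₂RingHom (eval₂RingHom φ sy) sx) sb := ⟨_, rfl⟩
  have h1 : ∀ r, f (C (C (C r))) = φ r := by simp [hf]
  have h2 : f (C X) = sx := by simp [hf]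
  have h3 : f (C (C X)) = sy := by simp [hf]
  have h4 : f X = sb := by simp [hf]
  exact ⟨f, RingHom.ext h1, h2, h3, h4⟩

end CoordRing

theorem map_eval₂_six {R S T : Type*} [CommRing R] [CommRing S] [CommRing T] (f : S →+* T)
    (φ : R →+* S) (a b c x y z : S) (G : MvPolynomial (Fin 6) R) :
    f (MvPolynomial.eval₂ φ ![a, b, c, x, y, z] G) =
      MvPolynomial.eval₂ (f.comp φ) ![f a, f b, f c, f x, f y, f z] G := by
  rw [MvPolynomial.hom_eval₂]
  congr 1
  ext i
  fin_cases i <;> rfl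

theorem map_eval₂_four {R S T : Type*} [CommRing R] [CommRing S] [CommRing T] (f : S →+* T)
    (φ : R →+* S) (a b c d : S) (G : MvPolynomial (Fin 4) R) :
    f (MvPolynomial.eval₂ φ ![a, b, c, d] G) =
      MvPolynomial.eval₂ (f.comp φ) ![f a, f b, f c, f d] G := by
  rw [MvPolynomial.hom_eval₂]
  congr 1
  ext i
  fin_cases i <;> rfl

section Model

open Polynomial

variable {B₀ R R' : Type} [CommRing B₀] [CommRing R] [CommRing R']

/-- The restriction of the form `G` to the chart given by the coordinates `x`, `y` on the base
and `b`, `X` on the fibre. -/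
def chartForm (φ : B₀ →+* R) (G : MvPolynomial (Fin 6) B₀) : (CoordRing R)[X] :=
  MvPolynomial.eval₂ (C.comp ((CoordRing.const R).comp φ))
    ![1, C (CoordRing.b R), X, C (CoordRing.x R), C (CoordRing.y R), 1] G

theorem map_chartForm (φ : B₀ →+* R) (ψ : R →+* R') (G : MvPolynomial (Fin 6) B₀) :
    mapRingHom (CoordRing.map ψ) (chartForm φ G) = chartForm (ψ.comp φ) G := by
  rw [chartForm, chartForm, map_eval₂_six]
  congr 1
  · ext r
    simp [CoordRing.map_const]
  · simp [CoordRing.map_x, CoordRing.map_y, CoordRing.map_b]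

theorem chartForm_of_reducesToReference {e : ℕ} {φ : B₀ →+* R} {G : MvPolynomial (Fin 6) B₀}
    (h : ReducesToReference e G φ) : chartForm φ G =
      C (CoordRing.x R * (CoordRing.y R + CoordRing.b R ^ 2)) +
      C (CoordRing.y R * tangentConic (CoordRing.x R) (CoordRing.y R) 1) * X ^ 2 := by
  have h1 := h (CoordRing R)[X] (C.comp (CoordRing.const R)) 1 (C (CoordRing.b R)) X
    (C (CoordRing.x R)) (C (CoordRing.y R)) 1
  rw [RingHom.comp_assoc] at h1
  rw [chartForm, h1]
  simp only [tangentConic, map_mul, map_add, map_sub, map_pow, map_one, map_ofNat]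
  ring

theorem eq_zero_of_eval₂_chart (K : Type) [Field K] {P : MvPolynomial (Fin 4) K}
    (h : MvPolynomial.eval₂ ((C : CoordRing K →+* (CoordRing K)[X]).comp (CoordRing.const K))
      ![C (CoordRing.b K), X * C (CoordRing.x K), X * C (CoordRing.y K), X] P = 0) : P = 0 := by
  obtain ⟨a, ha⟩ : ∃ a : MvPolynomial (Fin 4) K →+* FractionRing (MvPolynomial (Fin 4) K),
    a = algebraMap _ _ := ⟨_, rfl⟩
  have hinj : Function.Injective a := ha ▸ IsFractionRing.injective _ _
  have h3 : a (MvPolynomial.X 3) ≠ 0 :=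
    (map_ne_zero_iff a hinj).2 (MvPolynomial.X_ne_zero 3)
  obtain ⟨f, hf, hx, hy, hb⟩ := CoordRing.exists_lift (a.comp MvPolynomial.C)
    (a (MvPolynomial.X 1) / a (MvPolynomial.X 3)) (a (MvPolynomial.X 2) / a (MvPolynomial.X 3))
    (a (MvPolynomial.X 0))
  have h4 := congrArg (eval₂RingHom f (a (MvPolynomial.X 3))) h
  rw [map_eval₂_four, map_zero] at h4
  apply hinj
  rw [map_zero, ← h4]
  conv_lhs => rw [← MvPolynomial.eval₂_eta P]
  rw [MvPolynomial.hom_eval₂]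
  congr 1
  · ext r
    simpa using (RingHom.congr_fun hf r).symm
  · ext i
    fin_cases i
    · simp [hb]
    · simp [hx, h3]
    · simp [hy, h3]
    · simp

theorem nonSplitAt_chart {k : Type} [Field k] [CharZero k] {i : k} (hi : i ^ 2 = -1)
    {h : (CoordRing k)[X]} (hh : h = C (CoordRing.x k * (CoordRing.y k + CoordRing.b k ^ 2)) +
      C (CoordRing.y k * tangentConic (CoordRing.x k) (CoordRing.y k) 1) * X ^ 2) {E : Type}
    [Field E] [IsDomain (QuadraticAlgebra (CoordRing k)[X] h 0)]
    [Algebra (QuadraticAlgebra (CoordRing k)[X] h 0) E]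
    [IsFractionRing (QuadraticAlgebra (CoordRing k)[X] h 0) E]
    [CharZero (QuadraticAlgebra (CoordRing k)[X] h 0)] :
    NonSplitAt ![algebraMap (QuadraticAlgebra (CoordRing k)[X] h 0) E
        (algebraMap _ _ (C (CoordRing.x k))),
      algebraMap (QuadraticAlgebra (CoordRing k)[X] h 0) E (algebraMap _ _ (C (CoordRing.y k))),
      1] := by
  have hinj := IsFractionRing.injective (QuadraticAlgebra (CoordRing k)[X] h 0) E
  have hne : ∀ r : CoordRing k, r ≠ 0 → algebraMap (QuadraticAlgebra (CoordRing k)[X] h 0) E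
      (algebraMap _ _ (C r)) ≠ 0 := by
    intro r hr
    rw [map_ne_zero_iff _ hinj]
    intro h0
    exact hr (C_eq_zero.1 (by simpa using congrArg QuadraticAlgebra.re h0))
  refine ⟨hne _ CoordRing.conicAnisotropic.left_ne_zero,
    hne _ CoordRing.conicAnisotropic.right_ne_zero, one_ne_zero, fun hrep => ?_⟩
  refine CoordRing.not_normRep hi hh (rep_zero_of_fraction (W := E) ?_)
  simpa using hrep

end Model

open Polynomial in
/-- The function field of the double cover, together with its reduction modulo the maximal ideal
of a valuation ring of the field of constants. -/
theorem exists_doubleCover_model {K : Type} [Field K] (B : ValuationSubring K)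
    [CharZero (IsLocalRing.ResidueField B)] {i : IsLocalRing.ResidueField B} (hi : i ^ 2 = -1)
    {e : ℕ} {G : MvPolynomial (Fin 6) B}
    (hred : ReducesToReference e G (IsLocalRing.residue B)) :
    ∃ (A D E : Type) (_ : CommRing A) (_ : CommRing D) (_ : Field E) (κ : K →+* A) (τ : B →+* D)
      (j : D →+* A) (ρ : D →+* E), CharZero E ∧ IsDomain A ∧ PrimitiveScaling B κ τ j ρ ∧
      (∃ i : E, i ^ 2 = -1) ∧ ReducesToReference e G (ρ.comp τ) ∧
      ∃ (x y : D) (z b w : A), NonSplitAt ![ρ x, ρ y, 1] ∧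
      w ^ 2 = MvPolynomial.eval₂ (κ.comp B.subtype) ![1, b, z, j x, j y, 1] G ∧
      ∀ P Q : MvPolynomial (Fin 4) K, MvPolynomial.eval₂ κ ![b, z * j x, z * j y, z] P +
        MvPolynomial.eval₂ κ ![b, z * j x, z * j y, z] Q * w = 0 → P = 0 ∧ Q = 0 := by
  obtain ⟨hK, hhK⟩ : ∃ h, h = chartForm B.subtype G := ⟨_, rfl⟩
  obtain ⟨hB, hhB⟩ : ∃ h, h = chartForm (RingHom.id B) G := ⟨_, rfl⟩
  obtain ⟨hk, hhk⟩ : ∃ h, h = chartForm (IsLocalRing.residue B) G := ⟨_, rfl⟩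
  have hj : mapRingHom (CoordRing.map B.subtype) hB = hK := by rw [hhB, map_chartForm, hhK]; rfl
  have hρ : mapRingHom (CoordRing.map (IsLocalRing.residue B)) hB = hk := by
    rw [hhB, map_chartForm, hhk]; rfl
  have hps := (PrimitiveScaling.base B).coordRing.polynomial.quadraticMap hj hρ
  have hk' := hhk.trans (chartForm_of_reducesToReference hred)
  have hdom := isDomain_quadraticAlgebra fun u v => CoordRing.not_isSquare hk'
  have hdomK : IsDomain (QuadraticAlgebra (CoordRing K)[X] hK 0) := hps.isDomain
  have hchar : CharZero (QuadraticAlgebra (CoordRing (IsLocalRing.ResidueField B))[X] hk 0) := by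
    refine charZero_of_injective_algebraMap
      (R := (CoordRing (IsLocalRing.ResidueField B))[X]) fun p q hpq => ?_
    simpa using congrArg QuadraticAlgebra.re hpq
  obtain ⟨g, hg⟩ : ∃ g : QuadraticAlgebra (CoordRing (IsLocalRing.ResidueField B))[X] hk 0 →+*
    FractionRing (QuadraticAlgebra (CoordRing (IsLocalRing.ResidueField B))[X] hk 0),
    g = algebraMap _ _ := ⟨_, rfl⟩
  obtain ⟨c, hc⟩ : ∃ c : IsLocalRing.ResidueField B →+*
    QuadraticAlgebra (CoordRing (IsLocalRing.ResidueField B))[X] hk 0,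
    c = (algebraMap _ _).comp ((C : CoordRing _ →+* (CoordRing _)[X]).comp
      (CoordRing.const (IsLocalRing.ResidueField B))) := ⟨_, rfl⟩
  have hginj : Function.Injective g := hg ▸ IsFractionRing.injective _ _
  have hcharE := charZero_of_injective_ringHom hginj
  refine ⟨_, _, _, _, _, _, _, _, _, _, hcharE, hdomK, hps.comp_injective hginj, ?_, ?_,
    algebraMap (CoordRing B)[X] _ (C (CoordRing.x B)),
    algebraMap (CoordRing B)[X] _ (C (CoordRing.y B)),
    algebraMap (CoordRing K)[X] _ X, algebraMap (CoordRing K)[X] _ (C (CoordRing.b K)), ⟨0, 1⟩, ?_, ?_, ?_⟩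
  · refine ⟨g (c i), ?_⟩
    rw [← map_pow, ← map_pow, hi, map_neg, map_one, map_neg, map_one]
  · have hcomp : (g.comp (quadraticMap (mapRingHom (CoordRing.map (IsLocalRing.residue B))) hρ)).comp
        ((algebraMap (CoordRing B)[X] (QuadraticAlgebra (CoordRing B)[X] hB 0)).comp
          ((C : CoordRing B →+* (CoordRing B)[X]).comp ((CoordRing.const B).comp (RingHom.id B)))) =
        (g.comp c).comp
          (IsLocalRing.residue B) := by
      ext r
      simp only [RingHom.comp_apply]
      congr 1
      ext
      · simp [hc, quadraticMap, CoordRing.map_const]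
      · simp [hc, quadraticMap]
    rw [hcomp]
    intro R _ φ p q t x y z
    rw [← RingHom.comp_assoc]
    exact hred R _ p q t x y z
  · have h1 := nonSplitAt_chart hi hk' (E := FractionRing
      (QuadraticAlgebra (CoordRing (IsLocalRing.ResidueField B))[X] hk 0))
    rw [← hg] at h1
    have h2 : ∀ c, quadraticMap (mapRingHom (CoordRing.map (IsLocalRing.residue B))) hρ
        (algebraMap _ _ (C c)) = algebraMap _ _ (C (CoordRing.map (IsLocalRing.residue B) c)) := by
      intro c
      ext
      · simp [quadraticMap]
      · simp [quadraticMap]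
    rw [RingHom.comp_apply, RingHom.comp_apply, h2, h2, CoordRing.map_x, CoordRing.map_y]
    exact h1
  · have h2 : ∀ c, quadraticMap (mapRingHom (CoordRing.map B.subtype)) hj
        (algebraMap _ _ (C c)) = algebraMap _ _ (C (CoordRing.map B.subtype c)) := by
      intro c
      ext
      · simp [quadraticMap]
      · simp [quadraticMap]
    have h3 : (⟨0, 1⟩ : QuadraticAlgebra (CoordRing K)[X] hK 0) ^ 2 = algebraMap _ _ hK := by
      rw [pow_two]
      ext
      · simp
      · simp
    rw [h3, h2, h2, CoordRing.map_x, CoordRing.map_y]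
    refine (congrArg (algebraMap _ (QuadraticAlgebra (CoordRing K)[X] hK 0)) hhK).trans ?_
    rw [chartForm, map_eval₂_six, map_one]
    rfl
  · have h2 : ∀ c, quadraticMap (mapRingHom (CoordRing.map B.subtype)) hj
        (algebraMap _ _ (C c)) = algebraMap _ _ (C (CoordRing.map B.subtype c)) := by
      intro c
      ext
      · simp [quadraticMap]
      · simp [quadraticMap]
    intro P Q h
    rw [h2, h2, CoordRing.map_x, CoordRing.map_y, ← map_mul, ← map_mul, ← map_eval₂_four,
      ← map_eval₂_four] at h
    obtain ⟨hre, him⟩ := eq_zero_of_algebraMap_add_mul_omega h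
    exact ⟨eq_zero_of_eval₂_chart K hre, eq_zero_of_eval₂_chart K him⟩

end DoubleCover

noncomputable section BundleForm

open MvPolynomial

theorem eval₂_five_map {R S T : Type*} [CommRing R] [CommRing S] [CommRing T] (f : S →+* T)
    (φ : R →+* S) (a b c d e : S) (G : MvPolynomial (Fin 5) R) :
    f (eval₂ φ ![a, b, c, d, e] G) = eval₂ (f.comp φ) ![f a, f b, f c, f d, f e] G := by
  rw [hom_eval₂]
  congr 1
  ext i
  fin_cases i <;> rfl

theorem eval₂_smul_of_isHomogeneous {σ R S : Type*} [CommRing R] [CommRing S] {F : MvPolynomial σ R}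
    {n : ℕ} (hF : F.IsHomogeneous n) (φ : R →+* S) (v : σ → S) (c : S) :
    eval₂ φ (fun i => c * v i) F = c ^ n * eval₂ φ v F := by
  rw [eval₂_eq, eval₂_eq, Finset.mul_sum]
  refine Finset.sum_congr rfl fun m hm => ?_
  have h1 := hF (mem_support_iff.1 hm)
  rw [Finset.prod_congr rfl (fun i _ => mul_pow c (v i) (m i)), Finset.prod_mul_distrib,
    Finset.prod_pow_eq_pow_sum]
  have h2 : ∑ i ∈ m.support, m i = n := by
    rw [← h1, Finsupp.weight_apply, Finsupp.sum]
    simp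
  rw [h2]
  ring

theorem eval₂_five_smul {R S : Type*} [CommRing R] [CommRing S] {F : MvPolynomial (Fin 5) R}
    {n : ℕ} (hF : F.IsHomogeneous n) (φ : R →+* S) (x0 x1 x2 x3 x4 c : S) :
    eval₂ φ ![c * x0, c * x1, c * x2, c * x3, c * x4] F =
      c ^ n * eval₂ φ ![x0, x1, x2, x3, x4] F := by
  rw [← eval₂_smul_of_isHomogeneous hF]
  congr 1
  ext i
  fin_cases i <;> rfl

theorem eval₂_five_mem {R S : Type*} [CommRing R] [CommRing S] {F : MvPolynomial (Fin 5) R} {n : ℕ}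
    (hF : F ∈ (Ideal.span {X 2, X 3, X 4} : Ideal (MvPolynomial (Fin 5) R)) ^ n) (φ : R →+* S)
    (p q t x y z : S) : t ^ n ∣ eval₂ φ ![p, q, t * x, t * y, t * z] F := by
  have h1 := Ideal.mem_map_of_mem (eval₂Hom φ ![p, q, t * x, t * y, t * z]) hF
  rw [Ideal.map_pow, Ideal.map_span] at h1
  rw [← Ideal.mem_span_singleton, ← Ideal.span_singleton_pow]
  refine Ideal.pow_right_mono (Ideal.span_le.2 ?_) n h1
  rintro _ ⟨_, (rfl | rfl | rfl), rfl⟩ <;>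
    simp [Ideal.mem_span_singleton]

theorem monomial_dvd_of_monomial_dvd_map {σ R S : Type*} [CommRing R] [CommRing S] {f : R →+* S}
    (hf : Function.Injective f) {i : σ →₀ ℕ} {p : MvPolynomial σ R}
    (h : monomial i 1 ∣ map f p) : monomial i 1 ∣ p := by
  rw [monomial_one_dvd_iff_modMonomial_eq_zero] at h ⊢
  ext m
  by_cases hm : i ≤ m
  · rw [coeff_modMonomial_of_le _ hm, coeff_zero]
  · have := congrArg (coeff m) h
    rw [coeff_modMonomial_of_not_le _ hm, coeff_map, coeff_zero] at this
    rw [coeff_modMonomial_of_not_le _ hm, coeff_zero]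
    exact (map_eq_zero_iff f hf).1 this

/-- `G` is the equation of the double cover on the blow-up of the line `x₂ = x₃ = x₄ = 0`. -/
def IsStrictTransform {R : Type} [CommRing R] (n : ℕ) (F : MvPolynomial (Fin 5) R)
    (G : MvPolynomial (Fin 6) R) : Prop :=
  ∀ (S : Type) [CommRing S] (φ : R →+* S) (p q t x y z : S),
    eval₂ φ ![p, q, t * x, t * y, t * z] F = t ^ n * eval₂ φ ![p, q, t, x, y, z] G

theorem exists_isStrictTransform {R K : Type} [CommRing R] [CommRing K] {ι : R →+* K}
    (hι : Function.Injective ι) {n : ℕ} {F : MvPolynomial (Fin 5) R}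
    (hF : map ι F ∈ (Ideal.span {X 2, X 3, X 4} : Ideal (MvPolynomial (Fin 5) K)) ^ n) :
    ∃ G, IsStrictTransform n F G := by
  obtain ⟨G, hG⟩ : X 2 ^ n ∣ eval₂ (C : R →+* MvPolynomial (Fin 6) R)
      ![X 0, X 1, X 2 * X 3, X 2 * X 4, X 2 * X 5] F := by
    rw [X_pow_eq_monomial]
    apply monomial_dvd_of_monomial_dvd_map hι
    rw [eval₂_five_map, ← X_pow_eq_monomial]
    have := eval₂_five_mem hF (C : K →+* MvPolynomial (Fin 6) K) (X 0) (X 1) (X 2) (X 3) (X 4) (X 5)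
    rw [eval₂_map] at this
    convert this using 2
    · ext; simp
    · simp
  refine ⟨G, fun S _ φ p q t x y z => ?_⟩
  have h1 := congrArg (eval₂Hom φ ![p, q, t, x, y, z]) hG
  rw [eval₂_five_map] at h1
  simp only [map_mul, map_pow, coe_eval₂Hom, eval₂_X] at h1
  have hφ : (eval₂Hom φ ![p, q, t, x, y, z]).comp C = φ := by ext; simp
  rw [hφ] at h1
  exact h1

namespace IsStrictTransform

variable {R : Type} [CommRing R] [IsDomain R] {e : ℕ} {F : MvPolynomial (Fin 5) R}
  {G : MvPolynomial (Fin 6) R}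

theorem isBundleForm (h : IsStrictTransform (2 * e + 2) F G) (hF : F.IsHomogeneous (2 * e + 2 + 2)) :
    IsBundleForm e G where
  smul_fibre S _ φ c p q t x y z := by
    have key : eval₂ (C : R →+* MvPolynomial (Fin 7) R)
        ![X 6 * X 0, X 6 * X 1, X 6 * X 2, X 3, X 4, X 5] G =
        X 6 ^ 2 * eval₂ (C : R →+* MvPolynomial (Fin 7) R) ![X 0, X 1, X 2, X 3, X 4, X 5] G := by
      have h1 := h _ (C : R →+* MvPolynomial (Fin 7) R) (X 6 * X 0) (X 6 * X 1) (X 6 * X 2) (X 3)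
        (X 4) (X 5)
      have h2 := h _ (C : R →+* MvPolynomial (Fin 7) R) (X 0) (X 1) (X 2) (X 3) (X 4) (X 5)
      simp only [mul_assoc] at h1
      rw [eval₂_five_smul hF, h2] at h1
      refine mul_left_cancel₀ (pow_ne_zero (2 * e + 2) (mul_ne_zero (X_ne_zero 6) (X_ne_zero 2))) ?_
      rw [← h1]
      ring
    have h3 := congrArg (eval₂Hom φ ![p, q, t, x, y, z, c]) key
    rw [map_eval₂_six] at h3
    simp only [map_mul, map_pow] at h3
    rw [map_eval₂_six] at h3
    have h4 : (eval₂Hom φ ![p, q, t, x, y, z, c]).comp C = φ := by ext; simp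
    rw [h4] at h3
    simpa using h3
  smul_base S _ φ c p q t x y z := by
    have key : eval₂ (C : R →+* MvPolynomial (Fin 7) R)
        ![X 6 * X 0, X 6 * X 1, X 2, X 6 * X 3, X 6 * X 4, X 6 * X 5] G =
        (X 6 ^ (e + 2)) ^ 2 *
          eval₂ (C : R →+* MvPolynomial (Fin 7) R) ![X 0, X 1, X 2, X 3, X 4, X 5] G := by
      have h1 := h _ (C : R →+* MvPolynomial (Fin 7) R) (X 6 * X 0) (X 6 * X 1) (X 2) (X 6 * X 3)
        (X 6 * X 4) (X 6 * X 5)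
      have hX : ∀ i, (X 2 * (X 6 * X i) : MvPolynomial (Fin 7) R) = X 6 * (X 2 * X i) :=
        fun i => mul_left_comm _ _ _
      have h2 := h _ (C : R →+* MvPolynomial (Fin 7) R) (X 0) (X 1) (X 2) (X 3) (X 4) (X 5)
      simp only [hX] at h1
      rw [eval₂_five_smul hF, h2] at h1
      refine mul_left_cancel₀ (pow_ne_zero (2 * e + 2) (X_ne_zero 2)) ?_
      rw [← h1]
      ring
    have h3 := congrArg (eval₂Hom φ ![p, q, t, x, y, z, c]) key
    rw [map_eval₂_six] at h3
    simp only [map_mul, map_pow] at h3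
    rw [map_eval₂_six] at h3
    have h4 : (eval₂Hom φ ![p, q, t, x, y, z, c]).comp C = φ := by ext; simp
    rw [h4] at h3
    simpa using h3

end IsStrictTransform

/-- The reference hypersurface of degree `2 * e + 4`. -/
def referenceForm (e : ℕ) (R : Type) [CommRing R] : MvPolynomial (Fin 5) R :=
  (X 4 ^ e) ^ 2 * (X 2 * X 3 * X 0 ^ 2 + X 2 * X 4 * X 1 ^ 2 +
    X 3 * X 4 * tangentConic (X 2) (X 3) (X 4))

theorem map_referenceForm (e : ℕ) {R S : Type} [CommRing R] [CommRing S] (φ : R →+* S) :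
    map φ (referenceForm e R) = referenceForm e S := by
  simp [referenceForm, tangentConic]

theorem isHomogeneous_referenceForm (e : ℕ) (R : Type) [CommRing R] :
    (referenceForm e R).IsHomogeneous (2 * e + 2 + 2) := by
  have hX := isHomogeneous_X R (σ := Fin 5)
  have h2 : (C 2 : MvPolynomial (Fin 5) R).IsHomogeneous 0 := isHomogeneous_C _ _
  have hq : (tangentConic (X 2 : MvPolynomial (Fin 5) R) (X 3) (X 4)).IsHomogeneous 2 := by
    have hm : ∀ i j, (2 * X i * X j : MvPolynomial (Fin 5) R).IsHomogeneous 2 := fun i j => by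
      have := (h2.mul (hX i)).mul (hX j)
      rwa [map_ofNat] at this
    exact (((((hX 2).pow 2).add ((hX 3).pow 2)).add ((hX 4).pow 2)).sub (hm 2 3)).sub (hm 3 4)
      |>.sub (hm 4 2)
  have h1 : (X 2 * X 3 * X 0 ^ 2 + X 2 * X 4 * X 1 ^ 2 + X 3 * X 4 * tangentConic (X 2) (X 3) (X 4) :
      MvPolynomial (Fin 5) R).IsHomogeneous 4 :=
    ((((hX 2).mul (hX 3)).mul ((hX 0).pow 2)).add (((hX 2).mul (hX 4)).mul ((hX 1).pow 2))).add
      (((hX 3).mul (hX 4)).mul hq)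
  rw [show 2 * e + 2 + 2 = 1 * e * 2 + 4 by ring]
  exact (((hX 4).pow e).pow 2).mul h1

theorem referenceForm_mem (e : ℕ) (R : Type) [CommRing R] : referenceForm e R ∈
    (Ideal.span {X 2, X 3, X 4} : Ideal (MvPolynomial (Fin 5) R)) ^ (2 * e + 2) := by
  have h2 : (X 2 : MvPolynomial (Fin 5) R) ∈ Ideal.span {X 2, X 3, X 4} :=
    Ideal.subset_span (by simp)
  have h3 : (X 3 : MvPolynomial (Fin 5) R) ∈ Ideal.span {X 2, X 3, X 4} :=
    Ideal.subset_span (by simp)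
  have h4 : (X 4 : MvPolynomial (Fin 5) R) ∈ Ideal.span {X 2, X 3, X 4} :=
    Ideal.subset_span (by simp)
  rw [pow_add, referenceForm, ← pow_mul, mul_comm e 2]
  refine Ideal.mul_mem_mul (Ideal.pow_mem_pow h4 _) ?_
  rw [pow_two]
  exact add_mem (add_mem (Ideal.mul_mem_right _ _ (Ideal.mul_mem_mul h2 h3))
    (Ideal.mul_mem_right _ _ (Ideal.mul_mem_mul h2 h4)))
    (Ideal.mul_mem_right _ _ (Ideal.mul_mem_mul h3 h4))

theorem IsStrictTransform.reducesToReference {R k : Type} [CommRing R] [Field k] {e : ℕ}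
    {F : MvPolynomial (Fin 5) R} {G : MvPolynomial (Fin 6) R}
    (h : IsStrictTransform (2 * e + 2) F G) {ψ : R →+* k} (hF : map ψ F = referenceForm e k) :
    ReducesToReference e G ψ := by
  intro S _ φ p q t x y z
  have key : eval₂ ((C : k →+* MvPolynomial (Fin 6) k).comp ψ) ![X 0, X 1, X 2, X 3, X 4, X 5] G =
      (X 5 ^ e) ^ 2 * (X 3 * X 4 * X 0 ^ 2 + X 3 * X 5 * X 1 ^ 2 +
        X 4 * X 5 * tangentConic (X 3) (X 4) (X 5) * X 2 ^ 2) := by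
    have h1 := h _ ((C : k →+* MvPolynomial (Fin 6) k).comp ψ) (X 0) (X 1) (X 2) (X 3) (X 4) (X 5)
    rw [← eval₂_map, hF] at h1
    refine mul_left_cancel₀ (pow_ne_zero (2 * e + 2) (X_ne_zero 2)) (h1.symm.trans ?_)
    simp [referenceForm, tangentConic]
    ring
  have h3 := congrArg (eval₂Hom φ ![p, q, t, x, y, z]) key
  rw [map_eval₂_six] at h3
  have h4 : (eval₂Hom φ ![p, q, t, x, y, z]).comp (C.comp ψ) = φ.comp ψ := by ext; simp
  rw [h4] at h3
  simpa [tangentConic] using h3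

end BundleForm

section Specialization

open MvPolynomial

theorem isPolynomialFun_aeval_coeff (P : Submodule ℂ (MvPolynomial (Fin 5) ℂ))
    (G : MvPolynomial (Fin 5 →₀ ℕ) ℚ) :
    IsPolynomialFun fun F : P => aeval (fun m => coeff m (F : MvPolynomial (Fin 5) ℂ)) G := by
  obtain ⟨n, f, -, q, rfl⟩ := exists_fin_rename G
  refine ⟨n, fun i => (lcoeff ℂ (f i)).comp P.subtype, map (algebraMap ℚ ℂ) q, fun F => ?_⟩
  change aeval _ (rename f q) = _
  rw [aeval_rename, eval_map, aeval_def]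
  rfl

theorem veryGeneral_of_specialization (P : Submodule ℂ (MvPolynomial (Fin 5) ℂ)) {Q : P → Prop}
    (F₀ : P) (h : ∀ F : P, (∀ G : MvPolynomial (Fin 5 →₀ ℕ) ℚ,
      aeval (fun m => coeff m (F : MvPolynomial (Fin 5) ℂ)) G = 0 →
      aeval (fun m => coeff m (F₀ : MvPolynomial (Fin 5) ℂ)) G = 0) → Q F) : VeryGeneral Q := by
  refine ⟨{f | f ≠ 0 ∧ ∃ G : MvPolynomial (Fin 5 →₀ ℕ) ℚ, f =
    fun F : P => aeval (fun m => coeff m (F : MvPolynomial (Fin 5) ℂ)) G}, ?_, ?_, fun F hF => ?_⟩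
  · have : Countable (MvPolynomial (Fin 5 →₀ ℕ) ℚ) := by
      rw [← Cardinal.mk_le_aleph0_iff]
      exact cardinalMk_le_max.trans (by simp)
    refine (Set.countable_range fun (G : MvPolynomial (Fin 5 →₀ ℕ) ℚ) (F : P) =>
      aeval (fun m => coeff m (F : MvPolynomial (Fin 5) ℂ)) G).mono ?_
    rintro _ ⟨-, G, rfl⟩
    exact ⟨G, rfl⟩
  · rintro _ ⟨h0, G, rfl⟩
    exact ⟨isPolynomialFun_aeval_coeff P G, h0⟩
  · refine h F fun G hG => ?_
    by_contra hne
    exact hF _ ⟨fun h0 => hne (congrFun h0 F₀), G, rfl⟩ hG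

theorem exists_valuationSubring_of_specialization {σ K : Type*} [Field K] [CharZero K] {a : σ → K}
    {q : σ → ℚ} (h : ∀ G : MvPolynomial σ ℚ, aeval a G = 0 → aeval q G = 0) :
    ∃ B : ValuationSubring K, (∀ r : ℚ, (r : K) ∈ B) ∧ ∀ m, a m - q m ∈ B.nonunits := by
  obtain ⟨A, hA⟩ : ∃ A, A = (aeval a : MvPolynomial σ ℚ →ₐ[ℚ] K).toRingHom.rangeRestrict := ⟨_, rfl⟩
  obtain ⟨I, hI⟩ : ∃ I, I = (RingHom.ker (aeval q : MvPolynomial σ ℚ →ₐ[ℚ] ℚ)).map A := ⟨_, rfl⟩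
  have hsurj : Function.Surjective A := hA ▸ RingHom.rangeRestrict_surjective _
  have hcoe : ∀ G, (A G : K) = aeval a G := fun G => by rw [hA]; rfl
  have hne : I ≠ ⊤ := by
    rw [hI, Ne, Ideal.eq_top_iff_one]
    intro h1
    obtain ⟨G, hG, hG1⟩ := (Ideal.mem_map_iff_of_surjective A hsurj).1 h1
    have h2 := h (G - 1) (by
      have := congrArg Subtype.val hG1
      rw [hcoe] at this
      rw [map_sub, this]
      simp)
    rw [RingHom.mem_ker] at hG
    rw [map_sub, hG] at h2
    simp at h2
  obtain ⟨B, hB1, hB2⟩ := Ideal.image_subset_nonunits_valuationSubring I hne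
  refine ⟨B, fun r => hB1 ⟨C r, by simp⟩, fun m => hB2 ⟨A (X m - C (q m)), ?_, ?_⟩⟩
  · rw [hI]
    exact Ideal.mem_map_of_mem _ (by simp [RingHom.mem_ker])
  · change (A _ : K) = _
    rw [hcoe]
    simp

end Specialization

section IntegralModel

open MvPolynomial

theorem charZero_residueField_of_ratCast_mem {K : Type*} [Field K] [CharZero K]
    {B : ValuationSubring K} (hB : ∀ r : ℚ, (r : K) ∈ B) :
    CharZero (IsLocalRing.ResidueField B) := by
  have hle : ∀ x ∈ (algebraMap ℚ K).range, x ∈ B.toSubring := by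
    rintro _ ⟨r, rfl⟩
    simpa using hB r
  exact charZero_of_injective_ringHom ((IsLocalRing.residue B).comp
    ((Subring.inclusion hle).comp (algebraMap ℚ K).rangeRestrict)).injective

theorem ValuationSubring.exists_sq_eq {K : Type*} [Field K] [IsAlgClosed K]
    (B : ValuationSubring K) (a : B) : ∃ b : B, b ^ 2 = a := by
  obtain ⟨z, hz⟩ := IsAlgClosed.exists_pow_nat_eq (a : K) (n := 2) (by norm_num)
  have hm : z ∈ B := by
    rw [← B.valuation_le_one_iff]
    have h1 := (B.valuation_le_one_iff _).2 a.2
    rw [← hz, map_pow] at h1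
    exact (pow_le_one_iff two_ne_zero).1 h1
  exact ⟨⟨z, hm⟩, Subtype.ext hz⟩

theorem exists_bundle_model {K : Type} [Field K] [IsAlgClosed K] [CharZero K]
    {F : MvPolynomial (Fin 5) K} {e : ℕ} (hF : F.IsHomogeneous (2 * e + 2 + 2))
    (hmem : F ∈ (Ideal.span {X 2, X 3, X 4} : Ideal (MvPolynomial (Fin 5) K)) ^ (2 * e + 2))
    {B : ValuationSubring K} (hB : ∀ r : ℚ, (r : K) ∈ B)
    (hFB : ∀ m, coeff m F - (coeff m (referenceForm e ℚ) : ℚ) ∈ B.nonunits) :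
    ∃ G : MvPolynomial (Fin 6) B, IsBundleForm e G ∧
      ReducesToReference e G (IsLocalRing.residue B) ∧
      ∀ (S : Type) [CommRing S] (φ : K →+* S) (p q t x y z : S),
        eval₂ φ ![p, q, t * x, t * y, t * z] F =
          t ^ (2 * e + 2) * eval₂ (φ.comp B.subtype) ![p, q, t, x, y, z] G := by
  have hinj : Function.Injective B.subtype := Subtype.val_injective
  have hcoef : ∀ m, coeff m F ∈ B := fun m => by
    have h1 := B.toSubring.add_mem (B.nonunits_le (hFB m)) (hB (coeff m (referenceForm e ℚ)))
    simpa using h1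
  obtain ⟨F', hF'⟩ : ∃ F', map B.subtype F' = F := by
    change F ∈ Set.range (map B.subtype)
    rw [mem_range_map_iff_coeffs_subset]
    intro c hc
    obtain ⟨m, -, rfl⟩ := mem_coeffs_iff.1 hc
    exact ⟨⟨_, hcoef m⟩, rfl⟩
  have hcF' : ∀ m, ((coeff m F' : B) : K) = coeff m F := fun m => by
    rw [← hF', coeff_map]; rfl
  have hres : map (IsLocalRing.residue B) F' = referenceForm e (IsLocalRing.ResidueField B) := by
    rw [← map_referenceForm e ((IsLocalRing.residue B).comp (Int.castRingHom B)), ← map_map]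
    ext m
    rw [coeff_map, coeff_map, ← sub_eq_zero, ← map_sub, IsLocalRing.residue_eq_zero_iff,
      ← ValuationSubring.coe_mem_nonunits_iff]
    convert hFB m using 1
    rw [← map_referenceForm e (Int.castRingHom ℚ), coeff_map, coeff_map]
    push_cast
    rw [hcF']
    simp
  rw [← hF'] at hmem hF
  obtain ⟨G, hG⟩ := exists_isStrictTransform hinj hmem
  refine ⟨G, hG.isBundleForm (hF.of_map hinj), hG.reducesToReference hres, ?_⟩
  intro S _ φ p q t x y z
  rw [← hF', eval₂_map]
  exact hG S _ p q t x y z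

end IntegralModel

noncomputable section ChartRing

open MvPolynomial

theorem exists_normalForm_doubleCoverChart (F p : MvPolynomial (Fin 5) ℂ) :
    ∃ P Q : MvPolynomial (Fin 4) ℂ,
      p - (rename Fin.castSucc P + rename Fin.castSucc Q * X 4) ∈
        Ideal.span {X 4 ^ 2 - dehomP4 F} := by
  have hdehom : dehomP4 F = rename Fin.castSucc
      (aeval ![1, X 0, X 1, X 2, X 3] F : MvPolynomial (Fin 4) ℂ) := by
    have h1 : (rename Fin.castSucc : MvPolynomial (Fin 4) ℂ →ₐ[ℂ] _).comp
        (aeval ![1, X 0, X 1, X 2, X 3]) = aeval ![1, X 0, X 1, X 2, X 3] := by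
      ext i
      fin_cases i <;> simp
    exact (DFunLike.congr_fun h1 F).symm
  induction p using MvPolynomial.induction_on with
  | C a => exact ⟨C a, 0, by simp⟩
  | add p q hp hq =>
    obtain ⟨P, Q, h1⟩ := hp
    obtain ⟨P', Q', h2⟩ := hq
    refine ⟨P + P', Q + Q', ?_⟩
    convert Ideal.add_mem _ h1 h2 using 1
    simp only [map_add]
    ring
  | mul_X p i hp =>
    obtain ⟨P, Q, h1⟩ := hp
    induction i using Fin.lastCases with
    | last =>
      refine ⟨Q * aeval ![1, X 0, X 1, X 2, X 3] F, P, ?_⟩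
      have h2 := Ideal.add_mem _ (Ideal.mul_mem_right (X 4) _ h1)
        (Ideal.mul_mem_left _ (rename Fin.castSucc Q) (Ideal.mem_span_singleton_self
          (X 4 ^ 2 - dehomP4 F)))
      convert h2 using 1
      rw [map_mul, ← hdehom]
      change p * X 4 - _ = _
      ring
    | cast i =>
      refine ⟨P * X i, Q * X i, ?_⟩
      convert Ideal.mul_mem_right (X i.castSucc) _ h1 using 1
      simp only [map_mul, rename_X]
      ring

/-- The quotient map onto the affine chart. -/
def doubleCoverChartMk (F : MvPolynomial (Fin 5) ℂ) :
    MvPolynomial (Fin 5) ℂ →+* doubleCoverChartRing F :=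
  Ideal.Quotient.mk _

/-- A ring containing a generic solution of the affine equation contains the chart ring. -/
theorem exists_injective_doubleCoverChartRing {A : Type} [CommRing A] (F : MvPolynomial (Fin 5) ℂ)
    {κ : ℂ →+* A} {y : Fin 4 → A} {v : A} (hv : v ^ 2 = eval₂ κ ![1, y 0, y 1, y 2, y 3] F)
    (hind : ∀ P Q : MvPolynomial (Fin 4) ℂ, eval₂ κ y P + eval₂ κ y Q * v = 0 → P = 0 ∧ Q = 0) :
    ∃ Φ : doubleCoverChartRing F →+* A, Function.Injective Φ ∧
      (∀ a, Φ (doubleCoverChartMk F (C a)) = κ a) ∧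
      (∀ i : Fin 4, Φ (doubleCoverChartMk F (X i.castSucc)) = y i) ∧
      Φ (doubleCoverChartMk F (X 4)) = v := by
  obtain ⟨ψ, hψ⟩ : ∃ ψ : MvPolynomial (Fin 5) ℂ →+* A,
    ψ = eval₂Hom κ ![y 0, y 1, y 2, y 3, v] := ⟨_, rfl⟩
  have hψC : ∀ a, ψ (C a) = κ a := fun a => by simp [hψ]
  have hψi : ∀ i : Fin 4, ψ (X i.castSucc) = y i := fun i => by
    fin_cases i <;> simp [hψ]
  have hψ4 : ψ (X 4) = v := by simp [hψ]
  have hψren : ∀ P : MvPolynomial (Fin 4) ℂ, ψ (rename Fin.castSucc P) = eval₂ κ y P := by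
    intro P
    have h1 : ψ.comp (rename Fin.castSucc : MvPolynomial (Fin 4) ℂ →ₐ[ℂ] _).toRingHom =
        eval₂Hom κ y := by
      ext i
      · simp [hψC]
      · simp [hψi]
    exact DFunLike.congr_fun h1 P
  have hψdehom : ψ (dehomP4 F) = v ^ 2 := by
    rw [hv]
    have h1 : ψ.comp dehomP4 = eval₂Hom κ ![1, y 0, y 1, y 2, y 3] := by
      ext i
      · simp [dehomP4, hψC]
      · fin_cases i <;> simp [dehomP4, hψ]
    exact DFunLike.congr_fun h1 F
  have hker : ∀ a ∈ Ideal.span {X 4 ^ 2 - dehomP4 F}, ψ a = 0 := by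
    intro a ha
    obtain ⟨q, rfl⟩ := Ideal.mem_span_singleton'.1 ha
    simp [hψdehom, hψ4]
  refine ⟨Ideal.Quotient.lift _ ψ hker, ?_, hψC, hψi, hψ4⟩
  refine RingHom.lift_injective_of_ker_le_ideal _ hker fun p hp => ?_
  obtain ⟨P, Q, hPQ⟩ := exists_normalForm_doubleCoverChart F p
  have h1 := hker _ hPQ
  rw [map_sub, RingHom.mem_ker.1 hp, map_add, map_mul, hψren, hψren, hψ4, zero_sub,
    neg_eq_zero] at h1
  obtain ⟨rfl, rfl⟩ := hind P Q h1
  simpa using hPQ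

end ChartRing

section Specialize

open MvPolynomial

theorem FractionRing.exists_common_denominator (R : Type*) [CommRing R] [IsDomain R] {ι : Type*}
    [Finite ι] (r : ι → FractionRing R) : ∃ D : R, D ≠ 0 ∧
      ∃ N : ι → R, ∀ k, algebraMap R (FractionRing R) D * r k = algebraMap R _ (N k) := by
  obtain ⟨b, hb⟩ := IsLocalization.exist_integer_multiples_of_finite (nonZeroDivisors R) r
  choose N hN using hb
  exact ⟨b, nonZeroDivisors.ne_zero b.2, N, fun k => by rw [hN, Algebra.smul_def]⟩

theorem exists_polynomial_ratFuncField (K : Type) [Field K] (n : ℕ) :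
    ∃ α : MvPolynomial (Fin n) K →+* ratFuncField K n, Function.Injective α ∧
      (∀ a, α (C a) = ratFuncFieldMap K n a) ∧
      ∀ (ι : Type) [Finite ι] (r : ι → ratFuncField K n), ∃ D, D ≠ 0 ∧
        ∃ N : ι → MvPolynomial (Fin n) K, ∀ k, α D * r k = α (N k) := by
  have h : ∃ α : MvPolynomial (Fin n) K →+* FractionRing (MvPolynomial (Fin n) K),
      Function.Injective α ∧ (∀ a, α (C a) = algebraMap (MvPolynomial (Fin n) K) _ (C a)) ∧
      ∀ (ι : Type) [Finite ι] (r : ι → FractionRing (MvPolynomial (Fin n) K)), ∃ D, D ≠ 0 ∧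
        ∃ N : ι → MvPolynomial (Fin n) K, ∀ k, α D * r k = α (N k) :=
    ⟨algebraMap _ _, IsFractionRing.injective _ _, fun _ => rfl,
      fun _ _ r => FractionRing.exists_common_denominator _ r⟩
  exact h

/-- A relation among fractions survives at a point where the denominators do not vanish. -/
theorem exists_specialization_of_fractionRing {K L : Type} [Field K] [Field L] [Infinite L]
    {c : K →+* L} {m n : ℕ}
    {g : MvPolynomial (Fin n) K →+* FractionRing (MvPolynomial (Fin m) L)}
    (hgC : ∀ a, g (C a) = algebraMap (MvPolynomial (Fin m) L) _ (C (c a))) {ι : Type} {y : ι → L}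
    {D : MvPolynomial (Fin n) K} {N : ι → MvPolynomial (Fin n) K} (hD : g D ≠ 0)
    (hN : ∀ k, g (N k) = g D * algebraMap (MvPolynomial (Fin m) L) _ (C (y k))) :
    ∃ S : Fin n → L, eval₂ c S D ≠ 0 ∧ ∀ k, eval₂ c S (N k) = y k * eval₂ c S D := by
  obtain ⟨q, hq⟩ : ∃ q : Option (Fin n) → FractionRing (MvPolynomial (Fin m) L),
    q = fun o => o.elim (g D)⁻¹ fun i => g (X i) := ⟨_, rfl⟩
  obtain ⟨⟨U, hU⟩, hUq⟩ := IsLocalization.exist_integer_multiples_of_finite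
    (nonZeroDivisors (MvPolynomial (Fin m) L)) q
  choose Z hZ using hUq
  have hU0 : U ≠ 0 := nonZeroDivisors.ne_zero hU
  obtain ⟨t, ht⟩ : ∃ t, eval t U ≠ 0 := by
    by_contra! h
    exact hU0 (MvPolynomial.funext fun t => by simp [h t])
  have hinjQ : Function.Injective (algebraMap (MvPolynomial (Fin m) L)
    (FractionRing (MvPolynomial (Fin m) L))) := IsFractionRing.injective _ _
  have hUQ : algebraMap (MvPolynomial (Fin m) L) (FractionRing (MvPolynomial (Fin m) L)) U ≠ 0 :=
    (map_ne_zero_iff _ hinjQ).2 hU0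
  obtain ⟨ψ, hψ⟩ : ∃ ψ : Localization.Away U →+* FractionRing (MvPolynomial (Fin m) L),
    ψ = IsLocalization.Away.lift U (isUnit_iff_ne_zero.2 hUQ) := ⟨_, rfl⟩
  obtain ⟨ev, hev⟩ : ∃ ev : Localization.Away U →+* L,
    ev = IsLocalization.Away.lift U (g := eval t) (isUnit_iff_ne_zero.2 ht) := ⟨_, rfl⟩
  have hψa : ∀ a, ψ (algebraMap _ _ a) = algebraMap _ _ a := fun a => by
    rw [hψ, IsLocalization.Away.lift_eq]
  have heva : ∀ a, ev (algebraMap _ _ a) = eval t a := fun a => by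
    rw [hev, IsLocalization.Away.lift_eq]
  have hinj : Function.Injective ψ := by
    rw [injective_iff_map_eq_zero]
    intro x hx
    obtain ⟨k, a, ha⟩ := IsLocalization.Away.surj U x
    have h1 := congrArg ψ ha
    rw [map_mul, hx, zero_mul, hψa] at h1
    rw [(map_eq_zero_iff _ hinjQ).1 h1.symm, map_zero] at ha
    exact (((IsLocalization.Away.algebraMap_isUnit U).pow k).mul_left_eq_zero).1 ha
  obtain ⟨p, hp⟩ : ∃ p : Option (Fin n) → Localization.Away U,
    p = fun o => IsLocalization.Away.invSelf U * algebraMap _ _ (Z o) := ⟨_, rfl⟩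
  have hψp : ∀ o, ψ (p o) = q o := by
    intro o
    have h1 := congrArg ψ (IsLocalization.Away.mul_invSelf (S := Localization.Away U) U)
    rw [map_mul, hψa, map_one] at h1
    apply mul_left_cancel₀ hUQ
    rw [hp, map_mul, ← mul_assoc, h1, one_mul, hψa, hZ, Algebra.smul_def]
  obtain ⟨E, hE⟩ : ∃ E : MvPolynomial (Fin n) K →+* Localization.Away U,
    E = eval₂Hom ((algebraMap (MvPolynomial (Fin m) L) _).comp (C.comp c)) (fun i => p (some i)) :=
    ⟨_, rfl⟩
  have hψE : ∀ a, ψ (E a) = g a := by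
    have h1 : ψ.comp E = g := by
      ext i
      · simp [hE, hψa, hgC]
      · simp [hE, hψp, hq]
    exact DFunLike.congr_fun h1
  have hevE : ∀ a, ev (E a) = eval₂ c (fun i => ev (p (some i))) a := by
    have h1 : ev.comp E = eval₂Hom c (fun i => ev (p (some i))) := by
      ext i
      · simp [hE, heva]
      · simp [hE]
    exact DFunLike.congr_fun h1
  refine ⟨fun i => ev (p (some i)), ?_, fun k => ?_⟩
  · have h1 : E D * p none = 1 := hinj (by rw [map_mul, hψE, hψp, hq, map_one]; simp [hD])
    have h2 := congrArg ev h1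
    rw [map_mul, map_one, hevE] at h2
    exact left_ne_zero_of_mul_eq_one h2
  · have h1 : E (N k) = E D * algebraMap _ _ (C (y k)) :=
      hinj (by rw [map_mul, hψE, hψE, hψa, hN])
    have h2 := congrArg ev h1
    rw [map_mul, hevE, hevE, heva, eval_C] at h2
    rw [h2, mul_comm]

theorem IsStablyRationalFunctionField.exists_specialization {K L : Type} [Field K] [Field L]
    [Infinite L] {c : K →+* L} (h : IsStablyRationalFunctionField c) {ι : Type} [Finite ι]
    (y : ι → L) : ∃ (n : ℕ) (D : MvPolynomial (Fin n) K) (N : ι → MvPolynomial (Fin n) K)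
      (S : Fin n → L) (α : MvPolynomial (Fin n) K →+* ratFuncField K n) (f : L →+* ratFuncField K n),
      eval₂ c S D ≠ 0 ∧ (∀ k, eval₂ c S (N k) = y k * eval₂ c S D) ∧ Function.Injective α ∧
      f.comp c = α.comp C ∧ ∀ k, α D * f (y k) = α (N k) := by
  obtain ⟨m, n, e, he⟩ := h
  obtain ⟨α, hα, hαC, hαr⟩ := exists_polynomial_ratFuncField K n
  obtain ⟨f, hf⟩ : ∃ f : L →+* ratFuncField K n,
    f = (e : FractionRing (MvPolynomial (Fin m) L) →+* ratFuncField K n).comp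
      ((algebraMap (MvPolynomial (Fin m) L) _).comp C) := ⟨_, rfl⟩
  obtain ⟨D, hD, N, hN⟩ := hαr ι (fun k => f (y k))
  have hfc : f.comp c = α.comp C := by
    ext a
    rw [RingHom.comp_apply, RingHom.comp_apply, hαC, ← he, hf]
    rfl
  have hef : ∀ a, e.symm (f a) = algebraMap (MvPolynomial (Fin m) L) _ (C a) := fun a => by
    rw [hf]
    exact e.symm_apply_apply _
  obtain ⟨S, hS1, hS2⟩ := exists_specialization_of_fractionRing (c := c) (D := D) (N := N) (y := y)
    (g := (e.symm : ratFuncField K n →+* FractionRing (MvPolynomial (Fin m) L)).comp α)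
    (fun a => by
      have h1 := DFunLike.congr_fun hfc a
      simp only [RingHom.comp_apply] at h1
      simp only [RingHom.comp_apply, ← h1]
      exact hef _)
    (by
      refine (map_ne_zero_iff _ ?_).2 hD
      exact e.symm.injective.comp hα)
    (fun k => by
      rw [RingHom.comp_apply, ← hN, map_mul]
      congr 1
      exact hef _)
  exact ⟨n, D, N, S, α, f, hS1, hS2, hα, hfc, hN⟩

end Specialize

namespace PrimitiveScaling

open Polynomial

variable {K A D E : Type} [Field K] [CommRing A] [CommRing D] [Field E]
  {B : ValuationSubring K} {κ : K →+* A} {τ : B →+* D} {j : D →+* A} {ρ : D →+* E}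

theorem reducesToNonSplit_smul [IsDomain A] (h : PrimitiveScaling B κ τ j ρ) {g : A} (hg : g ≠ 0)
    {v : Fin 3 → A} (hv : v ≠ 0) :
    ReducesToNonSplit κ j ρ (fun k => g * v k) ↔ ReducesToNonSplit κ j ρ v := by
  obtain ⟨c, hc, δ, hδ, hδ0⟩ := h.exists_family hv
  obtain ⟨c', hc', γ, hγ, hγ0⟩ := h.exists_family (ι := Unit) (v := fun _ => g)
    (fun h0 => hg (congrFun h0 ()))
  have hγ1 : ρ (γ ()) ≠ 0 := fun h0 => hγ0 (funext fun _ => h0)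
  rw [h.reducesToNonSplit_iff hc hδ hδ0,
    h.reducesToNonSplit_iff (mul_ne_zero hc' hc) (δ := fun k => γ () * δ k)]
  · simp only [map_mul]
    exact nonSplitAt_smul hγ1
  · intro k
    rw [map_mul, map_mul, hγ, hδ]
    ring
  · obtain ⟨k, hk⟩ := Function.ne_iff.1 hδ0
    refine Function.ne_iff.2 ⟨k, ?_⟩
    rw [map_mul]
    exact mul_ne_zero hγ1 hk

theorem not_reducesToNonSplit_const [IsAlgClosed K] [CharZero E] (h : PrimitiveScaling B κ τ j ρ)
    {a : Fin 3 → K} (ha : a ≠ 0) : ¬ ReducesToNonSplit κ j ρ (fun k => κ (a k)) := by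
  obtain ⟨c, hc, b, hb, hb0⟩ := (PrimitiveScaling.base B).exists_family ha
  rw [h.reducesToNonSplit_iff hc (δ := fun k => τ (b k))]
  · rintro ⟨h0, -, h2, hns⟩
    obtain ⟨r, hr⟩ := B.exists_sq_eq (b 0 * b 2)
    refine hns ?_
    have h1 : ρ (τ (b 0)) * ρ (τ (b 2)) = ρ (τ r) ^ 2 := by
      rw [← map_mul, ← map_mul, ← map_pow, ← map_pow, hr]
    rw [h1]
    refine rep_sq ?_ _ _
    intro h3
    rw [h3, zero_pow two_ne_zero] at h1
    exact mul_ne_zero h0 h2 h1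
  · intro k
    rw [h.comm, ← map_mul]
    exact congrArg κ (hb k)
  · obtain ⟨k, hk⟩ := Function.ne_iff.1 hb0
    refine Function.ne_iff.2 ⟨k, ?_⟩
    have hu : IsUnit (b k) := by
      by_contra h1
      exact hk ((PrimitiveScaling.base B).map_nonunit _ h1)
    exact ((hu.map τ).map ρ).ne_zero

theorem reducesToNonSplit_eval_zero_iff [IsAlgClosed K] [CharZero E]
    (h : PrimitiveScaling B κ τ j ρ) {i : E} (hi : i ^ 2 = -1) {e : ℕ} {G : MvPolynomial (Fin 6) B}
    (hG : IsBundleForm e G) (hred : ReducesToReference e G (ρ.comp τ)) {s : Fin 3 → A[X]}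
    {V : Fin 4 → A[X]} (hV : V ≠ 0)
    (hVs : V 0 ^ 2 = MvPolynomial.eval₂ ((C : A →+* A[X]).comp (κ.comp B.subtype))
      ![V 1, V 2, V 3, s 0, s 1, s 2] G) (h0 : (fun k => (s k).eval 0) ≠ 0)
    (h1 : (fun k => (s k).eval 1) ≠ 0) :
    ReducesToNonSplit κ j ρ (fun k => (s k).eval 0) ↔
      ReducesToNonSplit κ j ρ (fun k => (s k).eval 1) := by
  obtain ⟨b, hb⟩ : ∃ b, b = Finset.univ.sup fun k => (s k).natDegree := ⟨_, rfl⟩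
  have hle : ∀ k, (s k).natDegree ≤ b := fun k =>
    hb ▸ Finset.le_sup (f := fun k => (s k).natDegree) (Finset.mem_univ k)
  have htop : (fun k => (s k).coeff b) ≠ 0 := by
    obtain ⟨k, -, hk⟩ := Finset.exists_mem_eq_sup Finset.univ Finset.univ_nonempty
      fun k => (s k).natDegree
    rcases Nat.eq_zero_or_pos b with hb0 | hb0
    · obtain ⟨l, hl⟩ := Function.ne_iff.1 h0
      refine Function.ne_iff.2 ⟨l, ?_⟩
      rw [hb0, coeff_zero_eq_eval_zero]
      exact hl
    · refine Function.ne_iff.2 ⟨k, ?_⟩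
      rw [hb, hk, coeff_natDegree, Pi.zero_apply, leadingCoeff_ne_zero]
      intro h2
      rw [hb, hk, h2, natDegree_zero] at hb0
      exact lt_irrefl 0 hb0
  obtain ⟨θ, hθ⟩ : ∃ θ : A[X] →+* A[X], θ = (taylorAlgHom (1 : A)).toRingHom := ⟨_, rfl⟩
  have hθa : ∀ P, θ P = taylor 1 P := fun P => by rw [hθ]; rfl
  have hθtop : ∀ k, (θ (s k)).coeff b = (s k).coeff b := by
    intro k
    rw [hθa]
    rcases (hle k).lt_or_eq with hlt | heq
    · rw [coeff_eq_zero_of_natDegree_lt hlt, coeff_eq_zero_of_natDegree_lt]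
      rwa [natDegree_taylor]
    · rw [← heq, coeff_taylor_natDegree]
      rfl
  have hθ0 : ∀ k, (θ (s k)).coeff 0 = (s k).eval 1 := fun k => by rw [hθa, taylor_coeff_zero]
  have key1 := h.reducesToNonSplit_coeff_iff hi hG hred hV hVs
    (by simpa only [coeff_zero_eq_eval_zero] using h0) htop
    (fun l hl k => coeff_eq_zero_of_natDegree_lt ((hle k).trans_lt hl))
  have key2 := h.reducesToNonSplit_coeff_iff hi hG hred (s := fun k => θ (s k))
    (V := fun k => θ (V k)) (b := b) ?_ ?_ (by simpa only [hθ0] using h1)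
    (by simpa only [hθtop] using htop) ?_
  · simp only [hθtop, hθ0] at key2
    simp only [coeff_zero_eq_eval_zero] at key1
    rw [key1, key2]
  · obtain ⟨k, hk⟩ := Function.ne_iff.1 hV
    refine Function.ne_iff.2 ⟨k, ?_⟩
    rw [hθa]
    exact fun h2 => hk (taylor_injective 1 (by rw [h2]; simp))
  · have hC : θ.comp ((C : A →+* A[X]).comp (κ.comp B.subtype)) =
        (C : A →+* A[X]).comp (κ.comp B.subtype) := by
      ext x
      simp [hθa]
    rw [← map_pow, hVs, map_eval₂_six, hC]
  · intro l hl k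
    rw [hθa]
    exact coeff_eq_zero_of_natDegree_lt (by rw [natDegree_taylor]; exact (hle k).trans_lt hl)

end PrimitiveScaling

namespace Polynomial

theorem exists_common_denominator (A : Type*) [CommRing A] [IsDomain A] {ι : Type*} [Fintype ι]
    (P : ι → (FractionRing A)[X]) : ∃ g : A, g ≠ 0 ∧ ∃ Q : ι → A[X], ∀ k,
      mapRingHom (algebraMap A (FractionRing A)) (Q k) = C (algebraMap A _ g) * P k := by
  classical
  obtain ⟨g, hg⟩ := IsLocalization.exist_integer_multiples_of_finset (nonZeroDivisors A)
    (Finset.univ.biUnion fun k => (P k).coeffs)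
  have h1 : ∀ k, ∃ Q : A[X], mapRingHom (algebraMap A (FractionRing A)) Q =
      C (algebraMap A _ (g : A)) * P k := by
    intro k
    have h2 : C (algebraMap A (FractionRing A) (g : A)) * P k ∈ lifts (algebraMap A _) := by
      rw [lifts_iff_coeff_lifts]
      intro n
      rw [coeff_C_mul]
      by_cases hn : (P k).coeff n = 0
      · exact ⟨0, by rw [hn, mul_zero, map_zero]⟩
      · obtain ⟨a, ha⟩ := hg ((P k).coeff n)
          (Finset.mem_biUnion.2 ⟨k, Finset.mem_univ _, coeff_mem_coeffs hn⟩)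
        exact ⟨a, by rw [ha, Algebra.smul_def]⟩
    obtain ⟨Q, hQ⟩ := (mem_lifts _).1 h2
    exact ⟨Q, hQ⟩
  choose Q hQ using h1
  exact ⟨g, nonZeroDivisors.ne_zero g.2, Q, hQ⟩

end Polynomial

namespace PrimitiveScaling

open Polynomial

variable {K A D E : Type} [Field K] [CommRing A] [CommRing D] [Field E]
  {B : ValuationSubring K} {κ : K →+* A} {τ : B →+* D} {j : D →+* A} {ρ : D →+* E}

/-- A line through a constant point and a nonsplit point cannot be mapped to the bundle. -/
theorem false_of_specialization [IsAlgClosed K] [CharZero E] [IsDomain A]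
    (h : PrimitiveScaling B κ τ j ρ) {i : E} (hi : i ^ 2 = -1) {e : ℕ} {G : MvPolynomial (Fin 6) B}
    (hG : IsBundleForm e G) (hred : ReducesToReference e G (ρ.comp τ))
    {F : MvPolynomial (Fin 5) K}
    (hF : ∀ (S : Type) [CommRing S] (φ : K →+* S) (p q t x y z : S),
      MvPolynomial.eval₂ φ ![p, q, t * x, t * y, t * z] F =
        t ^ (2 * e + 2) * MvPolynomial.eval₂ (φ.comp B.subtype) ![p, q, t, x, y, z] G)
    {x y : D} {z b : A} (hz : z ≠ 0) (hxy : NonSplitAt ![ρ x, ρ y, 1]) {n : ℕ}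
    {Δ W : MvPolynomial (Fin n) K} {N : Fin 4 → MvPolynomial (Fin n) K}
    (hW : W ^ 2 * Δ ^ (2 * e + 2) = MvPolynomial.eval₂ MvPolynomial.C ![Δ, N 0, N 1, N 2, N 3] F)
    {S : Fin n → FractionRing A}
    (hΔ : MvPolynomial.eval₂ ((algebraMap A (FractionRing A)).comp κ) S Δ ≠ 0)
    (hN : ∀ k, MvPolynomial.eval₂ ((algebraMap A (FractionRing A)).comp κ) S (N k) =
      algebraMap A _ (![b, z * j x, z * j y, z] k) *
        MvPolynomial.eval₂ ((algebraMap A (FractionRing A)).comp κ) S Δ) : False := by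
  obtain ⟨α, hα⟩ : ∃ α, α = algebraMap A (FractionRing A) := ⟨_, rfl⟩
  have hαinj : Function.Injective α := hα ▸ IsFractionRing.injective A (FractionRing A)
  rw [← hα] at hΔ hN
  -- a point with constant coordinates
  have hN3 : N 3 ≠ 0 := by
    intro h0
    have h1 := hN 3
    rw [h0, MvPolynomial.eval₂_zero] at h1
    exact mul_ne_zero ((map_ne_zero_iff _ hαinj).2 hz) hΔ h1.symm
  have : Infinite K := IsAlgClosed.instInfinite
  obtain ⟨c, hc⟩ : ∃ c, MvPolynomial.eval c (N 3) ≠ 0 := by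
    by_contra! h0
    exact hN3 (MvPolynomial.funext fun c => by simp [h0 c])
  -- the line joining it to the generic point
  obtain ⟨χ, hχ⟩ : ∃ χ : MvPolynomial (Fin n) K →+* (FractionRing A)[X],
    χ = MvPolynomial.eval₂Hom ((C : _ →+* (FractionRing A)[X]).comp (α.comp κ))
      (fun l => C (α (κ (c l))) + X * C (S l - α (κ (c l)))) := ⟨_, rfl⟩
  have hχ0 : ∀ a, (χ a).eval 0 = α (κ (MvPolynomial.eval c a)) := by
    have h1 : (evalRingHom 0).comp χ = (α.comp κ).comp (MvPolynomial.eval c) := by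
      ext <;> simp [hχ]
    exact DFunLike.congr_fun h1
  have hχ1 : ∀ a, (χ a).eval 1 = MvPolynomial.eval₂ (α.comp κ) S a := by
    have h1 : (evalRingHom 1).comp χ = MvPolynomial.eval₂Hom (α.comp κ) S := by
      ext <;> simp [hχ]
    exact DFunLike.congr_fun h1
  obtain ⟨g, hg, Q, hQ⟩ := exists_common_denominator A
    ![χ (N 1), χ (N 2), χ (N 3), χ Δ, χ (N 0), χ (W * Δ ^ (e + 1))]
  rw [← hα] at hQ
  have hmapinj : Function.Injective (mapRingHom α) := map_injective α hαinj
  have hcurve : χ (W * Δ ^ (e + 1)) ^ 2 =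
      MvPolynomial.eval₂ (((C : _ →+* (FractionRing A)[X]).comp (α.comp κ)).comp B.subtype)
        ![χ Δ, χ (N 0), 1, χ (N 1), χ (N 2), χ (N 3)] G := by
    have h1 := congrArg χ hW
    rw [eval₂_five_map] at h1
    have hχC : χ.comp MvPolynomial.C = (C : _ →+* (FractionRing A)[X]).comp (α.comp κ) := by
      ext a : 1
      simp [hχ]
    have h2 := hF _ (χ.comp MvPolynomial.C) (χ Δ) (χ (N 0)) 1 (χ (N 1)) (χ (N 2)) (χ (N 3))
    rw [one_mul, one_mul, one_mul, one_pow, one_mul] at h2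
    rw [← hχC, ← h2, ← h1, ← map_pow]
    congr 1
    ring
  have hbundle : (![C g ^ (e + 1) * Q 5, Q 3, Q 4, 1] : Fin 4 → A[X]) 0 ^ 2 =
      MvPolynomial.eval₂ ((C : A →+* A[X]).comp (κ.comp B.subtype))
        ![Q 3, Q 4, 1, Q 0, Q 1, Q 2] G := by
    apply hmapinj
    have hC : (mapRingHom α).comp ((C : A →+* A[X]).comp (κ.comp B.subtype)) =
        ((C : _ →+* (FractionRing A)[X]).comp (α.comp κ)).comp B.subtype := by
      ext a : 1
      simp
    rw [map_eval₂_six, hC, hQ, hQ, hQ, hQ, hQ, map_one]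
    refine Eq.trans ?_ (hG.smul_base _ _ _ _ _ _ _ _ _).symm
    refine Eq.trans ?_ (congrArg _ hcurve)
    change mapRingHom α ((C g ^ (e + 1) * Q 5) ^ 2) = _
    simp only [map_pow, map_mul]
    rw [hQ]
    simp only [coe_mapRingHom, map_C]
    change (C (α g) ^ (e + 1) * (C (α g) * χ (W * Δ ^ (e + 1)))) ^ 2 = _
    simp only [map_mul, map_pow]
    ring
  have hQα : ∀ k t, α ((Q k).eval t) =
      α g * ((![χ (N 1), χ (N 2), χ (N 3), χ Δ, χ (N 0), χ (W * Δ ^ (e + 1))] :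
        Fin 6 → (FractionRing A)[X]) k).eval (α t) := by
    intro k t
    have h1 := congrArg (eval (α t)) (hQ k)
    rwa [coe_mapRingHom, eval_map_apply, eval_mul, eval_C] at h1
  have hQ0 : ∀ k : Fin 3, (![Q 0, Q 1, Q 2] k).eval 0 =
      g * κ (MvPolynomial.eval c (![N 1, N 2, N 3] k)) := by
    intro k
    apply hαinj
    rw [map_mul, ← hχ0, ← map_zero α]
    fin_cases k
    · exact hQα 0 0
    · exact hQα 1 0
    · exact hQα 2 0
  obtain ⟨q, hq, p, hp⟩ := FractionRing.exists_common_denominator A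
    (fun _ : Unit => MvPolynomial.eval₂ (α.comp κ) S Δ)
  rw [← hα] at hp
  have hQ1 : ∀ k : Fin 3, q * (![Q 0, Q 1, Q 2] k).eval 1 =
      (p () * g * z) * (![j x, j y, 1] : Fin 3 → A) k := by
    have key : ∀ (k : Fin 6) (l : Fin 4) (v : A), (![χ (N 1), χ (N 2), χ (N 3), χ Δ, χ (N 0),
        χ (W * Δ ^ (e + 1))] : Fin 6 → (FractionRing A)[X]) k = χ (N l) →
        ![b, z * j x, z * j y, z] l = z * v → q * (Q k).eval 1 = (p () * g * z) * v := by
      intro k l v h1 h2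
      apply hαinj
      simp only [map_mul]
      rw [hQα, h1, map_one, hχ1, hN, h2, map_mul]
      linear_combination (α g * α z * α v) * hp ()
    intro k
    fin_cases k
    · exact key 0 1 _ rfl rfl
    · exact key 1 2 _ rfl rfl
    · exact key 2 3 _ rfl (mul_one z).symm
  have hp0 : p () ≠ 0 := by
    intro h0
    have h1 := hp ()
    rw [h0, map_zero] at h1
    exact mul_ne_zero ((map_ne_zero_iff _ hαinj).2 hq) hΔ h1
  have hpgz : p () * g * z ≠ 0 := mul_ne_zero (mul_ne_zero hp0 hg) hz
  have hv1 : (![j x, j y, 1] : Fin 3 → A) ≠ 0 := Function.ne_iff.2 ⟨2, one_ne_zero⟩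
  have hs1 : (fun k => (![Q 0, Q 1, Q 2] k).eval 1) ≠ 0 := by
    refine Function.ne_iff.2 ⟨2, fun h0 => ?_⟩
    have h1 := hQ1 2
    rw [h0, Pi.zero_apply, mul_zero] at h1
    exact mul_ne_zero hpgz one_ne_zero h1.symm
  have hc0 : (fun k => MvPolynomial.eval c (![N 1, N 2, N 3] k)) ≠ 0 := Function.ne_iff.2 ⟨2, hc⟩
  have hs0 : (fun k => (![Q 0, Q 1, Q 2] k).eval 0) ≠ 0 := by
    refine Function.ne_iff.2 ⟨2, ?_⟩
    rw [hQ0 2]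
    exact mul_ne_zero hg ((map_ne_zero_iff _ κ.injective).2 hc)
  have hiff := h.reducesToNonSplit_eval_zero_iff hi hG hred (s := ![Q 0, Q 1, Q 2])
    (V := ![C g ^ (e + 1) * Q 5, Q 3, Q 4, 1]) (Function.ne_iff.2 ⟨3, one_ne_zero⟩) hbundle hs0 hs1
  have h1 : ReducesToNonSplit κ j ρ (fun k => (![Q 0, Q 1, Q 2] k).eval 1) := by
    rw [← h.reducesToNonSplit_smul hq hs1]
    simp only [hQ1]
    rw [h.reducesToNonSplit_smul hpgz hv1]
    refine ⟨1, one_ne_zero, ![x, y, 1], fun k => ?_, ?_⟩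
    · fin_cases k <;> simp
    · simpa [NonSplitAt] using hxy
  have h2 := hiff.2 h1
  simp only [hQ0] at h2
  rw [h.reducesToNonSplit_smul hg] at h2
  · exact h.not_reducesToNonSplit_const hc0 h2
  · exact Function.ne_iff.2 ⟨2, (map_ne_zero_iff _ κ.injective).2 hc⟩

end PrimitiveScaling

section StableRationality

open MvPolynomial

theorem IsStablyRationalFunctionField.exists_doubleCover_specialization {L : Type} [Field L]
    [Infinite L] {c : ℂ →+* L} (h : IsStablyRationalFunctionField c) {e : ℕ}
    {F : MvPolynomial (Fin 5) ℂ} (hF : F.IsHomogeneous (2 * e + 2 + 2)) {y : Fin 4 → L} {w : L}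
    (hw : w ^ 2 = eval₂ c ![1, y 0, y 1, y 2, y 3] F) :
    ∃ (n : ℕ) (Δ W : MvPolynomial (Fin n) ℂ) (N : Fin 4 → MvPolynomial (Fin n) ℂ) (S : Fin n → L),
      W ^ 2 * Δ ^ (2 * e + 2) = eval₂ C ![Δ, N 0, N 1, N 2, N 3] F ∧ eval₂ c S Δ ≠ 0 ∧
      ∀ k, eval₂ c S (N k) = y k * eval₂ c S Δ := by
  obtain ⟨n, Δ, N, S, α, f, hΔ, hN, hα, hfc, hf⟩ :=
    h.exists_specialization (fun o : Option (Fin 4) => o.elim w y)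
  refine ⟨n, Δ, N none, fun k => N (some k), S, hα ?_, hΔ, fun k => hN (some k)⟩
  rw [eval₂_five_map, ← hfc, ← hf (some 0), ← hf (some 1), ← hf (some 2), ← hf (some 3), map_mul,
    map_pow, map_pow, ← hf none]
  have h1 := eval₂_five_smul hF (f.comp c) 1 (f (y 0)) (f (y 1)) (f (y 2)) (f (y 3)) (α Δ)
  rw [mul_one] at h1
  refine Eq.trans ?_ h1.symm
  have h2 := congrArg f hw
  rw [eval₂_five_map, map_one] at h2
  rw [← h2, map_pow]
  change (α Δ * f w) ^ 2 * _ = _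
  ring

theorem not_isStablyRational_doubleCover {e : ℕ} {F : MvPolynomial (Fin 5) ℂ}
    (hF : F.IsHomogeneous (2 * e + 2 + 2))
    (hmem : F ∈ (Ideal.span {X 2, X 3, X 4} : Ideal (MvPolynomial (Fin 5) ℂ)) ^ (2 * e + 2))
    (hspec : ∀ H : MvPolynomial (Fin 5 →₀ ℕ) ℚ, aeval (fun m => coeff m F) H = 0 →
      aeval (fun m => coeff m (referenceForm e ℚ)) H = 0) :
    ¬ IsStablyRationalFunctionField (doubleCoverFFMap F) := by
  intro hrat
  obtain ⟨B, hB, hFB⟩ := exists_valuationSubring_of_specialization hspec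
  obtain ⟨G, hG, hred, hFG⟩ := exists_bundle_model hF hmem hB hFB
  have := charZero_residueField_of_ratCast_mem hB
  obtain ⟨i, hi⟩ : ∃ i : IsLocalRing.ResidueField B, i ^ 2 = -1 := by
    obtain ⟨r, hr⟩ := B.exists_sq_eq (-1)
    exact ⟨IsLocalRing.residue B r, by rw [← map_pow, hr, map_neg, map_one]⟩
  obtain ⟨A, D, E, _, _, _, κ, τ, j, ρ, _, _, hps, ⟨i', hi'⟩, hred', x, y, z, b, w, hxy, hw, hind⟩ :=
    exists_doubleCover_model B hi hred
  have hz : z ≠ 0 := by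
    intro h0
    have h1 := (hind (X 3) 0 (by simp [h0])).1
    exact X_ne_zero (R := ℂ) 3 h1
  have hv : (z ^ (e + 1) * w) ^ 2 = eval₂ κ ![1, b, z * j x, z * j y, z] F := by
    have h1 := hFG _ κ 1 b z (j x) (j y) 1
    rw [mul_one] at h1
    rw [h1, mul_pow, hw]
    ring
  obtain ⟨Φ, hΦ, hΦC, hΦi, hΦ4⟩ := exists_injective_doubleCoverChartRing F
    (y := ![b, z * j x, z * j y, z]) hv (fun P Q hPQ => by
      have h1 := hind P (Q * X 3 ^ (e + 1)) (by
        rw [← hPQ, eval₂_mul, eval₂_pow, eval₂_X, mul_assoc]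
        rfl)
      exact ⟨h1.1, (mul_eq_zero.1 h1.2).resolve_right (pow_ne_zero _ (X_ne_zero 3))⟩)
  have hdom : IsDomain (doubleCoverChartRing F) := hΦ.isDomain Φ
  obtain ⟨θ, hθ⟩ : ∃ θ : FractionRing (doubleCoverChartRing F) →+* FractionRing A,
    ∀ a, θ (algebraMap _ _ a) = algebraMap _ _ (Φ a) :=
    ⟨IsFractionRing.map hΦ, fun a => IsLocalization.map_eq _ a⟩
  have hθc : θ.comp (doubleCoverFFMap F) = (algebraMap A (FractionRing A)).comp κ := by
    ext a
    rw [RingHom.comp_apply, RingHom.comp_apply, ← hΦC, ← hθ]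
    rfl
  obtain ⟨ξ, hξ⟩ : ∃ ξ : Fin 4 → FractionRing (doubleCoverChartRing F), ∀ k,
    θ (ξ k) = algebraMap A _ (![b, z * j x, z * j y, z] k) :=
    ⟨fun k => algebraMap _ _ (doubleCoverChartMk F (X k.castSucc)), fun k => by rw [hθ, hΦi]⟩
  obtain ⟨ω, hω⟩ : ∃ ω, θ ω = algebraMap A _ (z ^ (e + 1) * w) :=
    ⟨algebraMap _ _ (doubleCoverChartMk F (X 4)), by rw [hθ, hΦ4]⟩
  have hωξ : ω ^ 2 = eval₂ (doubleCoverFFMap F) ![1, ξ 0, ξ 1, ξ 2, ξ 3] F := by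
    apply θ.injective
    rw [eval₂_five_map, hθc, map_one, hξ, hξ, hξ, hξ, map_pow, hω, ← map_pow, hv, eval₂_five_map,
      map_one]
    rfl
  have : Infinite (FractionRing (doubleCoverChartRing F)) :=
    Infinite.of_injective _ (doubleCoverFFMap F).injective
  obtain ⟨n, Δ, W, N, S, hW, hΔ, hN⟩ := hrat.exists_doubleCover_specialization hF hωξ
  have hS : ∀ a, θ (eval₂ (doubleCoverFFMap F) S a) =
      eval₂ ((algebraMap A (FractionRing A)).comp κ) (fun l => θ (S l)) a := fun a => by
    rw [hom_eval₂, hθc]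
  refine hps.false_of_specialization hi' hG hred' hFG hz hxy (b := b) hW
    (S := fun l => θ (S l)) ?_
    fun k => ?_
  · rw [← hS]
    exact (map_ne_zero θ).2 hΔ
  · rw [← hS, ← hS, hN, map_mul, hξ]

end StableRationality

theorem very_general_double_cover_P4_not_stably_rational
    (d : ℕ) (hd : 2 ≤ d) (heven : Even (d + 2)) :
    VeryGeneral
      (P := (MvPolynomial.homogeneousSubmodule (Fin 5) ℂ (d + 2) ⊓
        Submodule.restrictScalars ℂ
          ((Ideal.span {MvPolynomial.X 2, MvPolynomial.X 3, MvPolynomial.X 4} :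
            Ideal (MvPolynomial (Fin 5) ℂ)) ^ d) :
        Submodule ℂ (MvPolynomial (Fin 5) ℂ)))
      (fun F => ¬ IsStablyRationalFunctionField
        (doubleCoverFFMap (F : MvPolynomial (Fin 5) ℂ))) := by
  obtain ⟨e, rfl⟩ : ∃ e, d = 2 * e + 2 := by
    obtain ⟨r, hr⟩ := heven
    exact ⟨r - 2, by omega⟩
  refine veryGeneral_of_specialization _ ⟨referenceForm e ℂ,
    (MvPolynomial.mem_homogeneousSubmodule _ _).2 (isHomogeneous_referenceForm e ℂ),
    referenceForm_mem e ℂ⟩ fun F hF => ?_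
  refine not_isStablyRational_doubleCover ((MvPolynomial.mem_homogeneousSubmodule _ _).1 F.2.1)
    F.2.2 fun H hH => ?_
  have h1 : MvPolynomial.aeval (fun m => MvPolynomial.coeff m
      (MvPolynomial.map (algebraMap ℚ ℂ) (referenceForm e ℚ))) H = 0 := by
    rw [map_referenceForm]
    exact hF H hH
  apply (algebraMap ℚ ℂ).injective
  rw [map_zero, ← h1, MvPolynomial.aeval_def, MvPolynomial.aeval_def, MvPolynomial.hom_eval₂]
  congr 1

end
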